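/- arXiv:math/0009113 — 7 statements merged into one kernel-verified Lean document; each statement's English description precedes it below -/
import Mathlib

section
/- Let N_L(T) denote the number of integer quadruples (W,X,Y,Z) ∈ ℤ⁴ satisfying W² = X² + Y² + Z² and with Euclidean norm √(W²+X²+Y²+Z²) at most T. Then N_L(T) = (π² / (4·L(2,χ₋₄)))·T² + O(T·(log T)²) as T → ∞. -/
open Filter

open Finset in
theorem abs_sum_Ioc_div_sq_sub_le {h : ℕ → ℝ} (hh : ∀ n, |h n| ≤ 1) {H : ℝ}
    (hH : HasSum (fun n : ℕ => h n / (n : ℝ) ^ 2) H) {M : ℕ} (hM : M ≠ 0) :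
    |∑ n ∈ Ioc 0 M, h n / (n : ℝ) ^ 2 - H| ≤ 1 / M := by
  have key : ∀ N ≥ M, |∑ n ∈ Ioc 0 M, h n / (n : ℝ) ^ 2
      - ∑ n ∈ range (N + 1), h n / (n : ℝ) ^ 2| ≤ 1 / M := by
    intro N hN
    have h1 : ∑ n ∈ range (N + 1), h n / (n : ℝ) ^ 2 = ∑ n ∈ Ioc 0 N, h n / (n : ℝ) ^ 2 := by
      refine (sum_subset (fun n hn => ?_) fun n hn hn' => ?_).symm
      · simp only [mem_Ioc, mem_range] at *; omega
      · obtain rfl : n = 0 := by simp only [mem_Ioc, mem_range] at *; omega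
        simp
    have h2 := Finset.sum_Ioc_consecutive (fun n : ℕ => h n / (n : ℝ) ^ 2) (Nat.zero_le M) hN
    rw [h1, ← h2, sub_add_cancel_left, abs_neg]
    calc _ ≤ ∑ n ∈ Ioc M N, |h n / (n : ℝ) ^ 2| := abs_sum_le_sum_abs _ _
      _ ≤ ∑ n ∈ Ioc M N, ((n : ℝ) ^ 2)⁻¹ := by
        refine sum_le_sum fun n _ => ?_
        rw [abs_div, abs_of_nonneg (sq_nonneg (n : ℝ)), div_eq_mul_inv]
        exact mul_le_of_le_one_left (by positivity) (hh n)
      _ ≤ (M : ℝ)⁻¹ - (N : ℝ)⁻¹ := sum_Ioc_inv_sq_le_sub hM hN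
      _ ≤ 1 / M := by
        rw [one_div]; linarith [inv_nonneg.2 (Nat.cast_nonneg (α := ℝ) N)]
  have lim := (hH.tendsto_sum_nat.comp (tendsto_add_atTop_nat 1)).const_sub
    (∑ n ∈ Ioc 0 M, h n / (n : ℝ) ^ 2)
  exact le_of_tendsto lim.abs (eventually_atTop.2 ⟨M, key⟩)

theorem sum_Ioc_one_div_le (M : ℕ) :
    ∑ n ∈ Finset.Ioc 0 M, (1 : ℝ) / n ≤ 1 + Real.log M := by
  have := harmonic_le_one_add_log M
  rw [harmonic_eq_sum_Icc] at this
  push_cast at this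
  simpa [one_div, ← Finset.Icc_add_one_left_eq_Ioc] using this

open Finset in
/-- If the partial sums of `s` are `B K² + O(K (1 + log K) ^ r)`, then those of the Dirichlet
convolution of `s` with a bounded function `h` are `B (∑ h(n)/n²) K² + O(K (1 + log K) ^ (r+1))`. -/
theorem exists_abs_sum_mul_sub_le (h s : ArithmeticFunction ℝ) {B C H : ℝ} {r : ℕ}
    (hh : ∀ n, |h n| ≤ 1) (hH : HasSum (fun n : ℕ => h n / (n : ℝ) ^ 2) H)
    (hs : ∀ K : ℕ, |∑ k ∈ Ioc 0 K, s k - B * (K : ℝ) ^ 2| ≤ C * (K * (1 + Real.log K) ^ r)) :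
    ∃ C', ∀ M : ℕ, |∑ n ∈ Ioc 0 M, (h * s) n - B * H * (M : ℝ) ^ 2| ≤
      C' * (M * (1 + Real.log M) ^ (r + 1)) := by
  have hC : 0 ≤ C := by simpa using (abs_nonneg _).trans (hs 1)
  refine ⟨C + 3 * |B|, fun M => ?_⟩
  rcases Nat.eq_zero_or_pos M with rfl | hM
  · simp
  have hM' : (0 : ℝ) < M := by exact_mod_cast hM
  set l := 1 + Real.log M with hl
  have hl1 : 1 ≤ l := by
    have := Real.log_natCast_nonneg M
    linarith
  rw [ArithmeticFunction.sum_Ioc_mul_eq_sum_sum]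
  have hterm : ∀ d ∈ Ioc 0 M, |h d * ∑ k ∈ Ioc 0 (M / d), s k - B * M ^ 2 * (h d / (d : ℝ) ^ 2)|
      ≤ (C * l ^ r + 2 * |B|) * M * (1 / d) := by
    intro d hd
    obtain ⟨hd0, hdM⟩ := mem_Ioc.1 hd
    have hd' : (0 : ℝ) < d := by exact_mod_cast hd0
    set q := M / d with hq
    have hq1 : (q : ℝ) ≤ M / d := Nat.cast_div_le
    have hq2 : (M : ℝ) / d - q ≤ 1 := by
      have : (M : ℝ) < d * (q + 1) := by exact_mod_cast Nat.lt_mul_div_succ M hd0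
      rw [sub_le_iff_le_add, div_le_iff₀ hd']
      linarith
    have hq0 : 0 < q := Nat.div_pos hdM hd0
    have hlq : 1 + Real.log q ≤ l := by
      have : Real.log q ≤ Real.log M :=
        Real.log_le_log (by exact_mod_cast hq0) (by exact_mod_cast Nat.div_le_self M d)
      linarith
    have hlq0 : 0 ≤ 1 + Real.log q := by
      have := Real.log_natCast_nonneg q
      linarith
    have e1 : |∑ k ∈ Ioc 0 q, s k - B * (q : ℝ) ^ 2| ≤ C * l ^ r * (M / d) :=
      calc _ ≤ C * (q * (1 + Real.log q) ^ r) := hs q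
        _ ≤ C * ((M / d) * l ^ r) := by gcongr
        _ = _ := by ring
    have e2 : |B * (q : ℝ) ^ 2 - B * (M / d) ^ 2| ≤ 2 * |B| * (M / d) := by
      rw [← mul_sub, abs_mul, mul_comm 2, mul_assoc]
      gcongr
      rw [abs_le]
      have : (0 : ℝ) ≤ q := Nat.cast_nonneg q
      constructor <;> nlinarith
    calc _ = |h d * ((∑ k ∈ Ioc 0 q, s k - B * (q : ℝ) ^ 2)
            + (B * (q : ℝ) ^ 2 - B * (M / d) ^ 2))| := by
          congr 1; field_simp; ring
      _ ≤ |(∑ k ∈ Ioc 0 q, s k - B * (q : ℝ) ^ 2) + (B * (q : ℝ) ^ 2 - B * (M / d) ^ 2)| := by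
          rw [abs_mul]; exact mul_le_of_le_one_left (abs_nonneg _) (hh d)
      _ ≤ C * l ^ r * (M / d) + 2 * |B| * (M / d) := (abs_add_le _ _).trans (add_le_add e1 e2)
      _ = _ := by ring
  have s1 : |∑ d ∈ Ioc 0 M, h d * ∑ k ∈ Ioc 0 (M / d), s k
      - B * M ^ 2 * ∑ d ∈ Ioc 0 M, (h d / (d : ℝ) ^ 2)| ≤ (C * l ^ r + 2 * |B|) * M * l := by
    rw [mul_sum, ← sum_sub_distrib]
    refine (abs_sum_le_sum_abs _ _).trans ((sum_le_sum hterm).trans ?_)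
    rw [← mul_sum]
    gcongr
    exact sum_Ioc_one_div_le M
  have s2 : |B * M ^ 2 * ∑ d ∈ Ioc 0 M, (h d / (d : ℝ) ^ 2) - B * H * (M : ℝ) ^ 2| ≤ |B| * M := by
    have := abs_sum_Ioc_div_sq_sub_le hh hH hM.ne'
    calc _ = |B| * (M : ℝ) ^ 2 * |∑ d ∈ Ioc 0 M, (h d / (d : ℝ) ^ 2) - H| := by
          rw [← abs_of_nonneg (sq_nonneg (M : ℝ)), ← abs_mul, ← abs_mul,
            abs_of_nonneg (sq_nonneg (M : ℝ))]
          congr 1; ring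
      _ ≤ |B| * (M : ℝ) ^ 2 * (1 / M) := by gcongr
      _ = _ := by field_simp
  have hlr : 1 ≤ l ^ r := one_le_pow₀ hl1
  have hlr' : l ≤ l ^ (r + 1) := by rw [pow_succ]; nlinarith
  calc _ ≤ (C * l ^ r + 2 * |B|) * M * l + |B| * M :=
        (abs_sub_le _ _ _).trans (add_le_add s1 s2)
    _ = (C * l ^ (r + 1) + 2 * |B| * l + |B| * 1) * M := by ring
    _ ≤ (C * l ^ (r + 1) + 2 * |B| * l ^ (r + 1) + |B| * l ^ (r + 1)) * M := by
        gcongr; exact hl1.trans hlr'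
    _ = _ := by ring

/-- The positive solutions `(a, b, x, y)` of `a * x + b * y = N`. -/
def liouvilleQuadruples (N : ℕ) : Finset (ℕ × ℕ × ℕ × ℕ) :=
  (Finset.Icc 1 N ×ˢ Finset.Icc 1 N ×ˢ Finset.Icc 1 N ×ˢ Finset.Icc 1 N).filter
    fun q => q.1 * q.2.2.1 + q.2.1 * q.2.2.2 = N

theorem mem_liouvilleQuadruples {N a b x y : ℕ} :
    (a, b, x, y) ∈ liouvilleQuadruples N ↔
      0 < a ∧ 0 < b ∧ 0 < x ∧ 0 < y ∧ a * x + b * y = N := by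
  simp only [liouvilleQuadruples, Finset.mem_filter, Finset.mem_product, Finset.mem_Icc]
  constructor
  · rintro ⟨⟨⟨_, _⟩, ⟨_, _⟩, ⟨_, _⟩, ⟨_, _⟩⟩, h⟩
    exact ⟨by omega, by omega, by omega, by omega, h⟩
  · rintro ⟨ha, hb, hx, hy, h⟩
    refine ⟨⟨⟨ha, ?_⟩, ⟨hb, ?_⟩, ⟨hx, ?_⟩, ⟨hy, ?_⟩⟩, h⟩ <;> nlinarith

section Liouville

variable {A : Type*} [AddCommMonoid A]

open Finset

theorem sum_liouvilleQuadruples_swap (N : ℕ) (G : ℕ → ℕ → ℕ → ℕ → A) :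
    ∑ q ∈ liouvilleQuadruples N, G q.1 q.2.1 q.2.2.1 q.2.2.2 =
      ∑ q ∈ liouvilleQuadruples N, G q.2.1 q.1 q.2.2.2 q.2.2.1 := by
  refine sum_bij' (fun q _ => (q.2.1, q.1, q.2.2.2, q.2.2.1))
    (fun q _ => (q.2.1, q.1, q.2.2.2, q.2.2.1)) ?_ ?_ ?_ ?_ ?_
  all_goals
    rintro ⟨a, b, x, y⟩ h
    simp only [mem_liouvilleQuadruples] at *
    try grind

theorem sum_liouvilleQuadruples_transpose (N : ℕ) (G : ℕ → ℕ → ℕ → ℕ → A) :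
    ∑ q ∈ liouvilleQuadruples N, G q.1 q.2.1 q.2.2.1 q.2.2.2 =
      ∑ q ∈ liouvilleQuadruples N, G q.2.2.1 q.2.2.2 q.1 q.2.1 := by
  refine sum_bij' (fun q _ => (q.2.2.1, q.2.2.2, q.1, q.2.1))
    (fun q _ => (q.2.2.1, q.2.2.2, q.1, q.2.1)) ?_ ?_ ?_ ?_ ?_
  all_goals
    rintro ⟨a, b, x, y⟩ h
    simp only [mem_liouvilleQuadruples] at *
    try grind

theorem sum_liouvilleQuadruples_shear (N : ℕ) (G : ℕ → ℕ → A) :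
    ∑ q ∈ liouvilleQuadruples N with q.2.1 < q.1, G q.1 q.2.1 =
      ∑ q ∈ liouvilleQuadruples N with q.2.2.1 < q.2.2.2, G (q.1 + q.2.1) q.2.1 := by
  refine sum_bij' (fun q _ => (q.1 - q.2.1, q.2.1, q.2.2.1, q.2.2.1 + q.2.2.2))
    (fun q _ => (q.1 + q.2.1, q.2.1, q.2.2.1, q.2.2.2 - q.2.2.1)) ?_ ?_ ?_ ?_ ?_
  · rintro ⟨a, b, x, y⟩ h
    simp only [mem_filter, mem_liouvilleQuadruples] at *
    obtain ⟨⟨ha, hb, hx, hy, h⟩, hlt⟩ := h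
    obtain ⟨c, rfl⟩ := Nat.exists_eq_add_of_lt hlt
    refine ⟨⟨by omega, hb, hx, by omega, ?_⟩, by omega⟩
    rw [← h, show b + c + 1 - b = c + 1 by omega]; ring
  · rintro ⟨a, b, x, y⟩ h
    simp only [mem_filter, mem_liouvilleQuadruples] at *
    obtain ⟨⟨ha, hb, hx, hy, h⟩, hlt⟩ := h
    obtain ⟨c, rfl⟩ := Nat.exists_eq_add_of_lt hlt
    refine ⟨⟨by omega, hb, hx, by omega, ?_⟩, by omega⟩
    rw [← h, show x + c + 1 - x = c + 1 by omega]; ring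
  · rintro ⟨a, b, x, y⟩ h
    simp only [mem_filter, mem_liouvilleQuadruples] at *
    grind
  · rintro ⟨a, b, x, y⟩ h
    simp only [mem_filter, mem_liouvilleQuadruples] at *
    grind
  · rintro ⟨a, b, x, y⟩ h
    simp only [mem_filter] at *
    congr 1
    omega

theorem sum_liouvilleQuadruples_diag (N : ℕ) (G : ℕ → ℕ → ℕ → A) :
    ∑ q ∈ liouvilleQuadruples N with q.2.2.1 = q.2.2.2, G q.1 q.2.1 q.2.2.1 =
      ∑ d ∈ N.divisors, ∑ l ∈ Ico 1 d, G l (d - l) (N / d) := by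
  rw [sum_sigma']
  refine sum_bij' (fun q _ => ⟨q.1 + q.2.1, q.1⟩)
    (fun p _ => (p.2, p.1 - p.2, N / p.1, N / p.1)) ?_ ?_ ?_ ?_ ?_
  · rintro ⟨a, b, x, y⟩ h
    simp only [mem_filter, mem_liouvilleQuadruples, mem_sigma, Nat.mem_divisors, mem_Ico] at *
    obtain ⟨⟨ha, hb, hx, hy, h⟩, rfl⟩ := h
    rw [← add_mul] at h
    have : 0 < (a + b) * x := by positivity
    exact ⟨⟨⟨x, h.symm⟩, by omega⟩, by omega, by omega⟩
  · rintro ⟨d, l⟩ h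
    simp only [mem_filter, mem_liouvilleQuadruples, mem_sigma, Nat.mem_divisors, mem_Ico] at *
    obtain ⟨⟨hd, hN⟩, h1, h2⟩ := h
    have := Nat.div_pos (Nat.le_of_dvd (Nat.pos_of_ne_zero hN) hd) (by omega)
    refine ⟨⟨by omega, by omega, this, this, ?_⟩, trivial⟩
    rw [← add_mul, Nat.add_sub_cancel' h2.le, Nat.mul_div_cancel' hd]
  · rintro ⟨a, b, x, y⟩ h
    simp only [mem_filter, mem_liouvilleQuadruples] at *
    obtain ⟨⟨ha, hb, hx, hy, h⟩, rfl⟩ := h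
    have : N / (a + b) = x := by
      rw [← h, ← add_mul, Nat.mul_div_cancel_left _ (by omega)]
    simp [this]
  · rintro ⟨d, l⟩ h
    simp only [mem_sigma, mem_Ico] at *
    have : l + (d - l) = d := by omega
    simp [this]
  · rintro ⟨a, b, x, y⟩ h
    simp only [mem_filter, mem_liouvilleQuadruples] at *
    obtain ⟨⟨ha, hb, hx, hy, h⟩, rfl⟩ := h
    have : N / (a + b) = x := by
      rw [← h, ← add_mul, Nat.mul_div_cancel_left _ (by omega)]
    simp [this]

end Liouville

open Finset in
/-- Liouville's identity for an even function `F` on the integers mod `m`. -/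
theorem sum_liouvilleQuadruples_sub_sub_add {m : ℕ} (F : ZMod m → ℤ) (hF : ∀ x, F (-x) = F x)
    (N : ℕ) :
    ∑ q ∈ liouvilleQuadruples N, (F (q.1 - q.2.1) - F (q.1 + q.2.1)) =
      ∑ d ∈ N.divisors, (((d : ℤ) - 1) * F 0 - ((d : ℤ) - 1) * F d
        + 2 * ((d : ℤ) - 1) * F ↑(N / d) - 2 * ∑ l ∈ Ico 1 d, F l) := by
  set Q := liouvilleQuadruples N
  have tri₁ (G : ℕ × ℕ × ℕ × ℕ → ℤ) : ∑ q ∈ Q, G q = ∑ q ∈ Q with q.2.1 < q.1, G q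
      + ∑ q ∈ Q with q.1 < q.2.1, G q + ∑ q ∈ Q with q.1 = q.2.1, G q := by
    simp only [sum_filter, ← sum_add_distrib]
    refine sum_congr rfl fun q _ => ?_
    rcases lt_trichotomy q.1 q.2.1 with h | h | h
    · simp [h, h.ne, h.not_gt]
    · simp [h]
    · simp [h, h.ne', h.not_gt]
  have tri₂ (G : ℕ × ℕ × ℕ × ℕ → ℤ) : ∑ q ∈ Q, G q = ∑ q ∈ Q with q.2.2.1 < q.2.2.2, G q
      + ∑ q ∈ Q with q.2.2.2 < q.2.2.1, G q + ∑ q ∈ Q with q.2.2.1 = q.2.2.2, G q := by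
    simp only [sum_filter, ← sum_add_distrib]
    refine sum_congr rfl fun q _ => ?_
    rcases lt_trichotomy q.2.2.1 q.2.2.2 with h | h | h
    · simp [h, h.ne, h.not_gt]
    · simp [h]
    · simp [h, h.ne', h.not_gt]
  have swap₁ (G : ℕ → ℕ → ℤ) : ∑ q ∈ Q with q.1 < q.2.1, G q.1 q.2.1 =
      ∑ q ∈ Q with q.2.1 < q.1, G q.2.1 q.1 := by
    simp only [sum_filter]
    exact sum_liouvilleQuadruples_swap N fun a b _ _ => if a < b then G a b else 0
  have swap₂ (G : ℕ → ℕ → ℤ) : ∑ q ∈ Q with q.2.2.2 < q.2.2.1, G q.1 q.2.1 =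
      ∑ q ∈ Q with q.2.2.1 < q.2.2.2, G q.2.1 q.1 := by
    simp only [sum_filter]
    exact sum_liouvilleQuadruples_swap N fun a b x y => if y < x then G a b else 0
  have diag₁ (G : ℕ → ℤ) : ∑ q ∈ Q with q.1 = q.2.1, G q.1 =
      ∑ d ∈ N.divisors, ((d : ℤ) - 1) * G (N / d) := by
    have h1 : ∑ q ∈ Q with q.1 = q.2.1, G q.1 = ∑ q ∈ Q with q.2.2.1 = q.2.2.2, G q.2.2.1 := by
      simp only [sum_filter]
      exact sum_liouvilleQuadruples_transpose N fun a b _ _ => if a = b then G a else 0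
    rw [h1, sum_liouvilleQuadruples_diag N fun _ _ x => G x]
    refine sum_congr rfl fun d hd => ?_
    have := Nat.pos_of_mem_divisors hd
    simp [Nat.cast_sub this]
  have diag₂ (G : ℕ → ℕ → ℤ) : ∑ q ∈ Q with q.2.2.1 = q.2.2.2, G q.1 q.2.1 =
      ∑ d ∈ N.divisors, ∑ l ∈ Ico 1 d, G l (d - l) :=
    sum_liouvilleQuadruples_diag N fun a b _ => G a b
  have sh (G : ℕ → ℕ → ℤ) := sum_liouvilleQuadruples_shear N G
  -- the shear exchanges `F (a - b)` on `b < a` with `F a` on `x < y`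
  have e1 : ∑ q ∈ Q, F (q.1 - q.2.1) = 2 * ∑ q ∈ Q with q.2.2.1 < q.2.2.2, F q.1
      + ∑ q ∈ Q with q.1 = q.2.1, F 0 := by
    rw [tri₁, swap₁ fun a b => F (a - b)]
    have h1 := sh fun a b => F (a - b)
    have h2 : ∑ q ∈ Q with q.2.1 < q.1, F (q.2.1 - q.1) =
        ∑ q ∈ Q with q.2.1 < q.1, F (q.1 - q.2.1) :=
      sum_congr rfl fun q _ => by rw [← hF, neg_sub]
    have h3 : ∑ q ∈ Q with q.1 = q.2.1, F (q.1 - q.2.1) = ∑ q ∈ Q with q.1 = q.2.1, F 0 :=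
      sum_congr rfl fun q hq => by rw [(mem_filter.1 hq).2, sub_self]
    push_cast at h1
    simp only [add_sub_cancel_right] at h1
    rw [h2, h3, h1]; ring
  have e2 : ∑ q ∈ Q, F (q.1 + q.2.1) = 2 * ∑ q ∈ Q with q.2.1 < q.1, F q.1
      + ∑ q ∈ Q with q.2.2.1 = q.2.2.2, F (q.1 + q.2.1) := by
    rw [tri₂, swap₂ fun a b => F (a + b)]
    have h1 := sh fun a b => F a
    have h2 : ∑ q ∈ Q with q.2.2.1 < q.2.2.2, F (q.2.1 + q.1) =
        ∑ q ∈ Q with q.2.2.1 < q.2.2.2, F (q.1 + q.2.1) :=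
      sum_congr rfl fun q _ => by rw [add_comm]
    push_cast at h1
    rw [h2, h1]; ring
  have e3 : ∑ q ∈ Q with q.1 < q.2.1, F q.1 = ∑ q ∈ Q with q.2.2.2 < q.2.2.1, F q.1 := by
    rw [swap₁ fun a _ => F a, swap₂ fun a _ => F a]
    exact sh fun a b => F b
  have e4 := (tri₁ fun q => F q.1).symm.trans (tri₂ fun q => F q.1)
  have d1 := diag₁ fun _ => F 0
  have d2 := diag₁ fun a => F a
  have d3 := diag₂ fun a _ => F a
  have d4 : ∑ q ∈ Q with q.2.2.1 = q.2.2.2, F (q.1 + q.2.1) =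
      ∑ d ∈ N.divisors, ((d : ℤ) - 1) * F d := by
    rw [diag₂ fun a b => F (a + b)]
    refine sum_congr rfl fun d hd => ?_
    have hd := Nat.pos_of_mem_divisors hd
    rw [sum_congr rfl (g := fun _ => F d)]
    · simp [Nat.cast_sub hd]
    · intro l hl
      rw [Nat.cast_sub (mem_Ico.1 hl).2.le, add_sub_cancel]
  simp only [sum_sub_distrib, sum_add_distrib, mul_assoc, ← mul_sum]
  linarith

theorem geom_sum_mul_geom_sum_eq (z : ℤ) (i j : ℕ) :
    (∑ l ∈ Finset.range (i + 1), z ^ l) * ∑ l ∈ Finset.range (j + 1), z ^ l =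
      ∑ l ∈ Finset.range (min i j + 1), z ^ l * ∑ k ∈ Finset.range (i - l + (j - l) + 1), z ^ k := by
  induction i generalizing j with
  | zero => simp
  | succ i ih =>
    cases j with
    | zero => simp
    | succ j =>
      have h1 : ∑ l ∈ Finset.range (i + 1 + (j + 1) + 1), z ^ l = ∑ l ∈ Finset.range (j + 1 + 1), z ^ l
          + z ^ (j + 2) * ∑ l ∈ Finset.range (i + 1), z ^ l := by
        rw [show i + 1 + (j + 1) + 1 = (j + 2) + (i + 1) by ring, Finset.sum_range_add, Finset.mul_sum]
        simp only [pow_add]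
      have h2 : ∑ l ∈ Finset.range (i + 1 + 1), z ^ l
          = 1 + z * ∑ l ∈ Finset.range (i + 1), z ^ l := by
        rw [Finset.sum_range_succ', Finset.mul_sum, add_comm]
        simp [pow_succ']
      have h3 : ∑ l ∈ Finset.range (j + 1 + 1), z ^ l
          = ∑ l ∈ Finset.range (j + 1), z ^ l + z ^ (j + 1) := Finset.sum_range_succ _ _
      have h4 : ∀ l, z ^ (l + 1) * ∑ k ∈ Finset.range (i + 1 - (l + 1) + (j + 1 - (l + 1)) + 1), z ^ k
          = z * (z ^ l * ∑ k ∈ Finset.range (i - l + (j - l) + 1), z ^ k) := by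
        intro l
        rw [Nat.add_sub_add_right, Nat.add_sub_add_right]; ring
      rw [Nat.add_min_add_right, Finset.sum_range_succ' _ (min i j + 1), Finset.sum_congr rfl fun l _ => h4 l,
        ← Finset.mul_sum, ← ih j]
      simp only [Nat.sub_zero, pow_zero, one_mul]
      rw [h1, h2, h3]
      ring

section

open ArithmeticFunction ArithmeticFunction.zeta

/-- The nontrivial Dirichlet character mod `4` as an arithmetic function. -/
def chiFour : ArithmeticFunction ℤ := ⟨fun n => ZMod.χ₄ n, by simp⟩

theorem chiFour_apply (n : ℕ) : chiFour n = ZMod.χ₄ n := rfl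

theorem chiFour_mul (m n : ℕ) : chiFour (m * n) = chiFour m * chiFour n := by
  simp only [chiFour_apply, Nat.cast_mul, map_mul]

theorem chiFour_pow (m n : ℕ) : chiFour (m ^ n) = chiFour m ^ n := by
  simp only [chiFour_apply, Nat.cast_pow, map_pow]

theorem isMultiplicative_chiFour : chiFour.IsMultiplicative :=
  ⟨by simp [chiFour_apply], fun _ => chiFour_mul _ _⟩

/-- The divisor sum `∑ d ∣ n, χ₋₄(d)`. -/
def chiFourSum : ArithmeticFunction ℤ := chiFour * ζ

theorem chiFourSum_apply (n : ℕ) : chiFourSum n = ∑ d ∈ n.divisors, chiFour d :=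
  coe_mul_zeta_apply

theorem isMultiplicative_chiFourSum : chiFourSum.IsMultiplicative :=
  isMultiplicative_chiFour.mul isMultiplicative_zeta.natCast

theorem chiFourSum_prime_pow {p : ℕ} (hp : p.Prime) (k : ℕ) :
    chiFourSum (p ^ k) = ∑ l ∈ Finset.range (k + 1), chiFour p ^ l := by
  rw [chiFourSum_apply, Nat.sum_divisors_prime_pow hp]
  simp [chiFour_pow]

theorem sum_divisors_prime_pow_mul {A : Type*} [AddCommMonoid A] {p : ℕ} (hp : p.Prime) (k : ℕ)
    {n : ℕ} (hn : ¬ p ∣ n) (F : ℕ → A) :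
    ∑ d ∈ (p ^ k * n).divisors, F d =
      ∑ l ∈ Finset.range (k + 1), ∑ d ∈ n.divisors, F (p ^ l * d) := by
  have hcop : (p ^ k).Coprime n := ((Nat.Prime.coprime_iff_not_dvd hp).2 hn).pow_left k
  rw [← Nat.sum_divisors_prime_pow hp (f := fun c => ∑ d ∈ n.divisors, F (c * d)),
    ← Finset.sum_product' _ _ fun c d => F (c * d), hcop.divisors_mul, Finset.sum_map]
  exact Finset.sum_attach _ fun q : ℕ × ℕ => F (q.1 * q.2)

theorem chiFourSum_mul_chiFourSum (a b : ℕ) :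
    chiFourSum a * chiFourSum b =
      ∑ g ∈ (a.gcd b).divisors, chiFour g * chiFourSum (a / g * (b / g)) := by
  induction a using Nat.strong_induction_on generalizing b with
  | _ a ih =>
  rcases Nat.eq_zero_or_pos a with rfl | ha
  · simp
  rcases Nat.eq_zero_or_pos b with rfl | hb
  · simp
  rcases eq_or_ne a 1 with rfl | ha1
  · simp [isMultiplicative_chiFourSum.1, isMultiplicative_chiFour.1]
  obtain ⟨p, hp, hpa⟩ := Nat.exists_prime_and_dvd ha1
  obtain ⟨i, a', ha', rfl⟩ := Nat.exists_eq_pow_mul_and_not_dvd ha.ne' p hp.ne_one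
  obtain ⟨j, b', hb', rfl⟩ := Nat.exists_eq_pow_mul_and_not_dvd hb.ne' p hp.ne_one
  have hi : i ≠ 0 := by
    rintro rfl
    exact ha' (by simpa using hpa)
  have ha'0 : 0 < a' := Nat.pos_of_mul_pos_left ha
  have hlt : a' < p ^ i * a' :=
    lt_mul_of_one_lt_left ha'0 (Nat.one_lt_pow hi hp.one_lt)
  have cop : ∀ {c : ℕ}, ¬ p ∣ c → ∀ k, (p ^ k).Coprime c := fun hc k =>
    ((Nat.Prime.coprime_iff_not_dvd hp).2 hc).pow_left k
  have mulf : ∀ {c : ℕ}, ¬ p ∣ c → ∀ k, chiFourSum (p ^ k * c) =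
      (∑ l ∈ Finset.range (k + 1), chiFour p ^ l) * chiFourSum c := fun hc k => by
    rw [isMultiplicative_chiFourSum.2 (cop hc k), chiFourSum_prime_pow hp]
  have hgcd : (p ^ i * a').gcd (p ^ j * b') = p ^ min i j * a'.gcd b' := by
    rw [Nat.Coprime.gcd_mul _ (cop hb' j), Nat.Coprime.gcd_mul_right_cancel _ (cop ha' j).symm,
      Nat.Coprime.gcd_mul_left_cancel _ (cop hb' i)]
    rcases le_total i j with h | h
    · rw [min_eq_left h, Nat.gcd_eq_left (pow_dvd_pow p h)]
    · rw [min_eq_right h, Nat.gcd_eq_right (pow_dvd_pow p h)]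
  have hgp : ¬ p ∣ a'.gcd b' := fun h => ha' (h.trans (Nat.gcd_dvd_left _ _))
  rw [hgcd, sum_divisors_prime_pow_mul hp _ hgp, mulf ha', mulf hb', mul_mul_mul_comm,
    ih a' hlt b', geom_sum_mul_geom_sum_eq, Finset.sum_mul_sum]
  refine Finset.sum_congr rfl fun l hl => Finset.sum_congr rfl fun g hg => ?_
  have hl' : l ≤ i ∧ l ≤ j := by
    have := Finset.mem_range.1 hl
    omega
  have hg1 := (Nat.dvd_of_mem_divisors hg).trans (Nat.gcd_dvd_left _ _)
  have hg2 := (Nat.dvd_of_mem_divisors hg).trans (Nat.gcd_dvd_right _ _)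
  have e1 : p ^ i * a' / (p ^ l * g) * (p ^ j * b' / (p ^ l * g)) =
      p ^ (i - l + (j - l)) * (a' / g * (b' / g)) := by
    rw [Nat.mul_div_mul_comm (pow_dvd_pow p hl'.1) hg1, Nat.mul_div_mul_comm (pow_dvd_pow p hl'.2) hg2,
      Nat.pow_div hl'.1 hp.pos, Nat.pow_div hl'.2 hp.pos]
    ring
  have hnd : ¬ p ∣ a' / g * (b' / g) := by
    rw [hp.dvd_mul]
    rintro (h | h)
    · exact ha' (h.trans (Nat.div_dvd_of_dvd hg1))
    · exact hb' (h.trans (Nat.div_dvd_of_dvd hg2))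
  rw [e1, mulf hnd, chiFour_mul, chiFour_pow]
  ring

theorem chiFourSum_prime_mul {p : ℕ} (hp : p.Prime) (n : ℕ) :
    chiFourSum (p * n) = (1 + chiFour p) * chiFourSum n
      - if p ∣ n then chiFour p * chiFourSum (n / p) else 0 := by
  have h := chiFourSum_mul_chiFourSum p n
  have h1 := chiFourSum_prime_pow hp 1
  rw [pow_one, Finset.sum_range_succ, Finset.sum_range_one, pow_zero, pow_one] at h1
  rw [h1] at h
  rw [h]
  split_ifs with hpn
  · rw [Nat.gcd_eq_left hpn, hp.sum_divisors]
    simp [isMultiplicative_chiFour.1, Nat.div_self hp.pos]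
  · rw [((Nat.Prime.coprime_iff_not_dvd hp).2 hpn).gcd_eq_one]
    simp [isMultiplicative_chiFour.1]

/-- The Gaussian integers of norm `n`. -/
def gaussianOfNorm (n : ℕ) : Set GaussianInt := {z | z.norm = n}

theorem mem_gaussianOfNorm {n : ℕ} {z : GaussianInt} :
    z ∈ gaussianOfNorm n ↔ z.re ^ 2 + z.im ^ 2 = n := by
  simp only [gaussianOfNorm, Set.mem_ofPred_eq, Zsqrtd.norm_def]
  rw [show z.re * z.re - -1 * z.im * z.im = z.re ^ 2 + z.im ^ 2 by ring]

theorem finite_gaussianOfNorm (n : ℕ) : (gaussianOfNorm n).Finite := by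
  refine ((Set.finite_Icc (-(n : ℤ)) n).prod (Set.finite_Icc (-(n : ℤ)) n)).preimage
    (f := fun z : GaussianInt => (z.re, z.im)) (fun z _ w _ h => ?_) |>.subset fun z hz => ?_
  · simpa [Zsqrtd.ext_iff] using h
  · rw [mem_gaussianOfNorm] at hz
    simp only [Set.mem_preimage, Set.mem_prod, Set.mem_Icc]
    refine ⟨⟨?_, ?_⟩, ?_, ?_⟩ <;> nlinarith

theorem ncard_gaussianOfNorm_zero : (gaussianOfNorm 0).ncard = 1 := by
  rw [Set.ncard_eq_one]
  refine ⟨0, Set.ext fun z => ?_⟩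
  simp [gaussianOfNorm, GaussianInt.norm_eq_zero]

theorem ncard_gaussianOfNorm_one : (gaussianOfNorm 1).ncard = 4 := by
  have : gaussianOfNorm 1 = (({⟨1, 0⟩, ⟨-1, 0⟩, ⟨0, 1⟩, ⟨0, -1⟩} : Finset GaussianInt) : Set _) := by
    ext ⟨x, y⟩
    simp only [mem_gaussianOfNorm, Finset.coe_insert, Finset.coe_singleton, Set.mem_insert_iff,
      Set.mem_singleton_iff, Zsqrtd.ext_iff]
    constructor
    · intro h
      push_cast at h
      have hx : -1 ≤ x := by nlinarith
      have hx' : x ≤ 1 := by nlinarith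
      have hy : -1 ≤ y := by nlinarith
      have hy' : y ≤ 1 := by nlinarith
      interval_cases x <;> interval_cases y <;> simp_all
    · rintro (⟨rfl, rfl⟩ | ⟨rfl, rfl⟩ | ⟨rfl, rfl⟩ | ⟨rfl, rfl⟩) <;> norm_num
  rw [this, Set.ncard_coe_finset]
  decide

theorem setOf_dvd_gaussianOfNorm {w : GaussianInt} {m : ℕ} (hw : w.norm = m) (hm : m ≠ 0) (n : ℕ) :
    {z ∈ gaussianOfNorm (m * n) | w ∣ z} = (w * ·) '' gaussianOfNorm n := by
  have hm' : (m : ℤ) ≠ 0 := by exact_mod_cast hm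
  ext z
  constructor
  · rintro ⟨hz, u, rfl⟩
    refine ⟨u, ?_, rfl⟩
    rw [gaussianOfNorm, Set.mem_ofPred_eq, Zsqrtd.norm_mul, hw] at hz
    push_cast at hz
    exact mul_left_cancel₀ hm' hz
  · rintro ⟨u, hu, rfl⟩
    rw [gaussianOfNorm, Set.mem_ofPred_eq] at hu
    refine ⟨?_, dvd_mul_right _ _⟩
    simp [gaussianOfNorm, Zsqrtd.norm_mul, hw, hu]

theorem ncard_setOf_dvd_gaussianOfNorm {w : GaussianInt} {m : ℕ} (hw : w.norm = m) (hm : m ≠ 0)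
    (n : ℕ) : {z ∈ gaussianOfNorm (m * n) | w ∣ z}.ncard = (gaussianOfNorm n).ncard := by
  rw [setOf_dvd_gaussianOfNorm hw hm, Set.ncard_image_of_injective]
  refine mul_right_injective₀ fun h => hm ?_
  rw [h, Zsqrtd.norm_zero] at hw
  exact_mod_cast hw.symm

theorem ncard_setOf_natCast_dvd_gaussianOfNorm {p : ℕ} (hp : p ≠ 0) (n : ℕ) :
    {z ∈ gaussianOfNorm (p * n) | (p : GaussianInt) ∣ z}.ncard =
      if p ∣ n then (gaussianOfNorm (n / p)).ncard else 0 := by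
  have hnorm : (p : GaussianInt).norm = (p * p : ℕ) := by
    simp [Zsqrtd.norm_natCast]
  split_ifs with h
  · obtain ⟨k, rfl⟩ := h
    rw [Nat.mul_div_cancel_left _ (Nat.pos_of_ne_zero hp), ← mul_assoc,
      ncard_setOf_dvd_gaussianOfNorm hnorm (mul_ne_zero hp hp)]
  · rw [Set.ncard_eq_zero ((finite_gaussianOfNorm _).subset (Set.sep_subset _ _)),
      Set.eq_empty_iff_forall_notMem]
    rintro z ⟨hz, u, rfl⟩
    rw [gaussianOfNorm, Set.mem_ofPred_eq, Zsqrtd.norm_mul, hnorm] at hz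
    refine h ?_
    have hp' : (p : ℤ) ≠ 0 := by exact_mod_cast hp
    have : (n : ℤ) = p * u.norm := by
      refine mul_left_cancel₀ hp' ?_
      rw [← mul_assoc]
      exact_mod_cast hz.symm
    exact Int.natCast_dvd_natCast.1 ⟨_, this⟩

theorem natCast_dvd_mul_star {m n : ℕ} {z : GaussianInt} (hz : z ∈ gaussianOfNorm (m * n)) :
    (m : GaussianInt) ∣ z * star z := by
  rw [← Zsqrtd.norm_eq_mul_conj, show z.norm = _ from hz]
  exact ⟨n, by push_cast; rfl⟩

theorem ncard_gaussianOfNorm_two_mul (n : ℕ) :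
    (gaussianOfNorm (2 * n)).ncard = (gaussianOfNorm n).ncard := by
  rw [← ncard_setOf_dvd_gaussianOfNorm (w := ⟨1, 1⟩) (m := 2) (by decide) two_ne_zero n]
  congr 1
  ext z
  simp only [Set.mem_ofPred_eq, iff_self_and, mem_gaussianOfNorm]
  intro h
  have h2 : (z.re + z.im) % 2 = 0 := by
    have h3 : (z.re ^ 2 + z.im ^ 2) % 2 = 0 := by rw [h]; push_cast; simp
    rcases Int.emod_two_eq_zero_or_one z.re with h4 | h4 <;>
    rcases Int.emod_two_eq_zero_or_one z.im with h5 | h5 <;>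
    simp [Int.add_emod, pow_two, Int.mul_emod, h4, h5] at h3 ⊢
  obtain ⟨k, hk⟩ := Int.dvd_of_emod_eq_zero h2
  refine ⟨⟨k, k - z.re⟩, ?_⟩
  rw [Zsqrtd.ext_iff]
  simp
  omega

theorem ncard_gaussianOfNorm_inert_mul {p : ℕ} (hp : p.Prime) (hp3 : p % 4 = 3) (n : ℕ) :
    (gaussianOfNorm (p * n)).ncard = if p ∣ n then (gaussianOfNorm (n / p)).ncard else 0 := by
  rw [← ncard_setOf_natCast_dvd_gaussianOfNorm hp.ne_zero]
  have := Fact.mk hp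
  congr 1
  ext z
  simp only [Set.mem_ofPred_eq, iff_self_and]
  intro hz
  rcases (GaussianInt.prime_of_nat_prime_of_mod_four_eq_three p hp3).dvd_or_dvd
    (natCast_dvd_mul_star hz) with h | ⟨u, h⟩
  · exact h
  · refine ⟨star u, ?_⟩
    rw [← star_star z, h]
    simp

theorem ncard_gaussianOfNorm_split_mul {p : ℕ} (hp : p.Prime) (hp1 : p % 4 = 1) (n : ℕ) :
    (gaussianOfNorm (p * n)).ncard + (if p ∣ n then (gaussianOfNorm (n / p)).ncard else 0) =
      2 * (gaussianOfNorm n).ncard := by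
  have := Fact.mk hp
  obtain ⟨a, b, hab⟩ := Nat.Prime.sq_add_sq (p := p) (by omega)
  set w : GaussianInt := ⟨a, b⟩ with hw
  have hn : w.norm = p := by
    rw [← hab, hw, Zsqrtd.norm_def]; push_cast; ring
  have hn' : (star w).norm = p := by
    rw [Zsqrtd.norm_conj, hn]
  have hwp : w * star w = p := by
    rw [← Zsqrtd.norm_eq_mul_conj, hn]; simp
  have prime_of : ∀ v : GaussianInt, v.norm = p → Prime v := fun v hv => by
    refine Irreducible.prime ⟨fun h => ?_, fun x y hxy => ?_⟩
    · rw [← Zsqrtd.norm_eq_one_iff, hv, Int.natAbs_natCast] at h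
      exact hp.one_lt.ne' h
    · rw [← Zsqrtd.norm_eq_one_iff, ← Zsqrtd.norm_eq_one_iff]
      have h : x.norm.natAbs * y.norm.natAbs = p := by
        rw [← Int.natAbs_mul, ← Zsqrtd.norm_mul, ← hxy, hv, Int.natAbs_natCast]
      rcases (Nat.prime_mul_iff.1 (h ▸ hp)) with h' | h'
      · exact Or.inr h'.2
      · exact Or.inl h'.2
  have not_dvd : ¬ star w ∣ w := fun h => by
    obtain ⟨u, hu⟩ := dvd_add h dvd_rfl
    have h2 : (p : ℤ) ∣ ((2 * a * (2 * a) : ℕ) : ℤ) := by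
      refine ⟨u.norm, ?_⟩
      rw [← hn', ← Zsqrtd.norm_mul, ← hu, hw, Zsqrtd.norm_def]
      simp; ring
    rw [Int.natCast_dvd_natCast, hp.dvd_mul, or_self, hp.dvd_mul] at h2
    have hpa : p ∣ a := h2.resolve_left fun h3 => by
      have := Nat.le_of_dvd two_pos h3
      have := hp.two_le
      omega
    have hpb : p ∣ b := by
      refine hp.dvd_of_dvd_pow (n := 2) ((Nat.dvd_add_right (hpa.trans (dvd_pow_self a two_ne_zero))).1 ?_)
      rw [hab]
    have : p ^ 2 ∣ p := by
      conv_rhs => rw [← hab]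
      exact dvd_add (pow_dvd_pow_of_dvd hpa 2) (pow_dvd_pow_of_dvd hpb 2)
    have := Nat.le_of_dvd hp.pos this
    nlinarith [hp.one_lt]
  rw [two_mul]
  nth_rw 1 [← ncard_setOf_dvd_gaussianOfNorm hn hp.ne_zero n]
  rw [← ncard_setOf_dvd_gaussianOfNorm hn' hp.ne_zero n,
    ← ncard_setOf_natCast_dvd_gaussianOfNorm hp.ne_zero,
    ← Set.ncard_union_add_ncard_inter _ _
      ((finite_gaussianOfNorm _).subset (Set.sep_subset _ _))
      ((finite_gaussianOfNorm _).subset (Set.sep_subset _ _))]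
  congr 2
  · ext z
    simp only [Set.mem_union, Set.mem_ofPred_eq, ← and_or_left, iff_self_and]
    intro hz
    have h := (Dvd.intro _ hwp).trans (natCast_dvd_mul_star hz)
    refine ((prime_of w hn).dvd_or_dvd h).imp_right fun ⟨u, h⟩ => ⟨star u, ?_⟩
    rw [← star_star z, h]
    simp [mul_comm]
  · ext z
    simp only [Set.mem_inter_iff, Set.mem_ofPred_eq]
    constructor
    · rintro ⟨hz, h⟩
      exact ⟨⟨hz, (Dvd.intro _ hwp).trans h⟩, hz, (Dvd.intro_left _ hwp).trans h⟩
    · rintro ⟨⟨hz, u, rfl⟩, -, h⟩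
      refine ⟨hz, ?_⟩
      rw [← hwp]
      exact mul_dvd_mul_left w (((prime_of _ hn').dvd_or_dvd h).resolve_left not_dvd)

theorem ncard_gaussianOfNorm_prime_mul {p : ℕ} (hp : p.Prime) (n : ℕ) :
    ((gaussianOfNorm (p * n)).ncard : ℤ) = (1 + chiFour p) * (gaussianOfNorm n).ncard
      - if p ∣ n then chiFour p * (gaussianOfNorm (n / p)).ncard else 0 := by
  rcases hp.eq_two_or_odd with rfl | hodd
  · simp [ncard_gaussianOfNorm_two_mul, show chiFour 2 = 0 by decide]
  · rcases Nat.odd_mod_four_iff.1 hodd with h | h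
    · have h2 := ncard_gaussianOfNorm_split_mul hp h n
      rw [chiFour_apply, ZMod.χ₄_nat_one_mod_four h]
      split_ifs at h2 ⊢ <;> push_cast [← @Nat.cast_inj ℤ] at h2 <;> linarith
    · rw [chiFour_apply, ZMod.χ₄_nat_three_mod_four h, ncard_gaussianOfNorm_inert_mul hp h]
      split_ifs <;> simp

/-- Jacobi's two-square theorem. -/
theorem ncard_gaussianOfNorm {n : ℕ} (hn : n ≠ 0) :
    ((gaussianOfNorm n).ncard : ℤ) = 4 * chiFourSum n := by
  induction n using Nat.strong_induction_on with
  | _ n ih =>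
  rcases eq_or_ne n 1 with rfl | h1
  · rw [ncard_gaussianOfNorm_one, isMultiplicative_chiFourSum.1]; simp
  obtain ⟨p, hp, k, rfl⟩ := Nat.exists_prime_and_dvd h1
  have hk : k ≠ 0 := by rintro rfl; simp at hn
  rw [ncard_gaussianOfNorm_prime_mul hp, chiFourSum_prime_mul hp,
    ih k (lt_mul_of_one_lt_left (Nat.pos_of_ne_zero hk) hp.one_lt) hk]
  split_ifs with hpk
  · have hd : k / p ≠ 0 := (Nat.div_pos (Nat.le_of_dvd (Nat.pos_of_ne_zero hk) hpk) hp.pos).ne'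
    rw [ih (k / p) ((Nat.div_le_self k p).trans_lt
      (lt_mul_of_one_lt_left (Nat.pos_of_ne_zero hk) hp.one_lt)) hd]
    ring
  · ring

theorem sum_liouvilleQuadruples_chiFour (N : ℕ) :
    ∑ q ∈ liouvilleQuadruples N, chiFour q.1 * chiFour q.2.1 =
      ∑ p ∈ Finset.HasAntidiagonal.antidiagonal N, chiFourSum p.1 * chiFourSum p.2 := by
  simp only [chiFourSum_apply, Finset.sum_mul_sum, ← Finset.sum_product']
  rw [Finset.sum_sigma']
  refine Finset.sum_bij' (fun q _ => ⟨(q.1 * q.2.2.1, q.2.1 * q.2.2.2), (q.1, q.2.1)⟩)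
    (fun s _ => (s.2.1, s.2.2, s.1.1 / s.2.1, s.1.2 / s.2.2)) ?_ ?_ ?_ ?_ ?_
  · rintro ⟨a, b, x, y⟩ h
    simp only [mem_liouvilleQuadruples, Finset.mem_sigma, Finset.HasAntidiagonal.mem_antidiagonal,
      Finset.mem_product, Nat.mem_divisors] at *
    obtain ⟨ha, hb, hx, hy, h⟩ := h
    exact ⟨h, ⟨dvd_mul_right _ _, by positivity⟩, dvd_mul_right _ _, by positivity⟩
  · rintro ⟨⟨u, v⟩, a, b⟩ h
    simp only [mem_liouvilleQuadruples, Finset.mem_sigma, Finset.HasAntidiagonal.mem_antidiagonal,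
      Finset.mem_product, Nat.mem_divisors] at *
    obtain ⟨h, ⟨ha, hu⟩, hb, hv⟩ := h
    have ha0 := Nat.pos_of_dvd_of_pos ha (Nat.pos_of_ne_zero hu)
    have hb0 := Nat.pos_of_dvd_of_pos hb (Nat.pos_of_ne_zero hv)
    exact ⟨ha0, hb0, Nat.div_pos (Nat.le_of_dvd (Nat.pos_of_ne_zero hu) ha) ha0,
      Nat.div_pos (Nat.le_of_dvd (Nat.pos_of_ne_zero hv) hb) hb0,
      by rw [Nat.mul_div_cancel' ha, Nat.mul_div_cancel' hb, h]⟩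
  · rintro ⟨a, b, x, y⟩ h
    simp only [mem_liouvilleQuadruples] at h
    simp [Nat.mul_div_cancel_left _ h.1, Nat.mul_div_cancel_left _ h.2.1]
  · rintro ⟨⟨u, v⟩, a, b⟩ h
    simp only [Finset.mem_sigma, Finset.HasAntidiagonal.mem_antidiagonal, Finset.mem_product,
      Nat.mem_divisors] at h
    simp [Nat.mul_div_cancel' h.2.1.1, Nat.mul_div_cancel' h.2.2.1]
  · rintro ⟨a, b, x, y⟩ h
    rfl

/-- The function `cos (π x / 2)` on the integers mod `4`. -/
def cosFour : ZMod 4 → ℤ := ![1, 0, -1, 0]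

theorem abs_cosFour_le (x : ZMod 4) : |cosFour x| ≤ 1 := by
  revert x; decide

theorem cosFour_two_mul (m : ℕ) : cosFour ((2 * m : ℕ) : ZMod 4) = (-1) ^ m := by
  rcases Nat.even_or_odd' m with ⟨j, rfl | rfl⟩
  · have : ∀ x : ZMod 4, cosFour (2 * (2 * x)) = 1 := by decide
    push_cast
    rw [this, pow_mul]; simp
  · have : ∀ x : ZMod 4, cosFour (2 * (2 * x + 1)) = -1 := by decide
    push_cast
    rw [this, pow_succ, pow_mul]; simp

theorem cosFour_odd {m : ℕ} (hm : Odd m) : cosFour m = 0 := by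
  obtain ⟨j, rfl⟩ := hm
  have : ∀ x : ZMod 4, cosFour (2 * x + 1) = 0 := by decide
  push_cast
  exact this _

theorem abs_sum_cosFour_le (d : ℕ) : |∑ l ∈ Finset.Ico 1 d, cosFour l| ≤ 1 := by
  let H : ZMod 4 → ℤ := ![0, 1, 1, 0]
  have h1 : ∀ x, H x + cosFour x = H (x + 1) := by decide
  have h2 : ∀ x, |H x - 1| ≤ 1 := by decide
  have h3 : ∀ d : ℕ, ∑ l ∈ Finset.range d, cosFour l = H d := by
    intro d
    induction d with
    | zero => rfl
    | succ d ih => rw [Finset.sum_range_succ, ih, h1, Nat.cast_succ]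
  rcases Nat.eq_zero_or_pos d with rfl | hd
  · simp
  · have h4 := h3 d
    rw [Finset.sum_range_eq_add_Ico _ hd] at h4
    have h5 : cosFour ((0 : ℕ) : ZMod 4) = 1 := rfl
    rw [h5] at h4
    rw [show ∑ l ∈ Finset.Ico 1 d, cosFour l = H d - 1 by linarith]
    exact h2 _

theorem two_mul_sum_chiFourSum_mul (N : ℕ) :
    2 * ∑ p ∈ Finset.HasAntidiagonal.antidiagonal N, chiFourSum p.1 * chiFourSum p.2 =
      ∑ d ∈ N.divisors, (((d : ℤ) - 1) - ((d : ℤ) - 1) * cosFour d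
        + 2 * ((d : ℤ) - 1) * cosFour ↑(N / d) - 2 * ∑ l ∈ Finset.Ico 1 d, cosFour l) := by
  have h := sum_liouvilleQuadruples_sub_sub_add cosFour (by decide) N
  have h1 : ∀ x y : ZMod 4, cosFour (x - y) - cosFour (x + y) = 2 * (ZMod.χ₄ x * ZMod.χ₄ y) := by
    decide
  simp only [h1, ← Finset.mul_sum] at h
  rw [← sum_liouvilleQuadruples_chiFour]
  simp only [chiFour_apply]
  rw [h]
  simp only [show cosFour 0 = 1 from rfl, mul_one]

theorem Nat.sum_divisors_two_mul {A : Type*} [AddCommMonoid A] (k : ℕ) (g : ℕ → A) :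
    ∑ d ∈ (2 * k).divisors, g d =
      ∑ m ∈ k.divisors, g (2 * m) + ∑ m ∈ k.divisors with Odd m, g m := by
  rw [← Finset.sum_filter_add_sum_filter_not _ Even]
  congr 1
  · rw [← Finset.sum_image (f := g) (g := (2 * ·)) (fun a _ b _ h => by simpa using h)]
    refine Finset.sum_congr (Finset.ext fun d => ?_) fun _ _ => rfl
    simp only [Finset.mem_filter, Finset.mem_image, Nat.mem_divisors]
    constructor
    · rintro ⟨⟨h, h0⟩, hd⟩
      obtain ⟨m, rfl⟩ := hd.two_dvd
      exact ⟨m, ⟨(mul_dvd_mul_iff_left two_ne_zero).1 h, by omega⟩, rfl⟩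
    · rintro ⟨m, ⟨h, h0⟩, rfl⟩
      exact ⟨⟨mul_dvd_mul_left 2 h, by omega⟩, even_two_mul m⟩
  · refine Finset.sum_congr (Finset.ext fun d => ?_) fun _ _ => rfl
    simp only [Finset.mem_filter, Nat.mem_divisors, Nat.not_even_iff_odd]
    constructor
    · rintro ⟨⟨h, h0⟩, hd⟩
      exact ⟨⟨(Nat.coprime_two_right.2 hd).dvd_of_dvd_mul_left h, by omega⟩, hd⟩
    · rintro ⟨⟨h, h0⟩, hd⟩
      exact ⟨⟨h.mul_left 2, by omega⟩, hd⟩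

/-- The sums of `χ₋₄`-divisor sums `∑_{a + b = 2n} r(a) r(b)`. -/
def chiFourSumConv : ArithmeticFunction ℤ :=
  ⟨fun n => ∑ p ∈ Finset.HasAntidiagonal.antidiagonal (2 * n), chiFourSum p.1 * chiFourSum p.2, by simp⟩

/-- The sums of `χ₋₄`-divisor sums `∑_{a + b = 2n} r(a b)`. -/
def chiFourSumMul : ArithmeticFunction ℤ :=
  ⟨fun n => ∑ p ∈ Finset.HasAntidiagonal.antidiagonal (2 * n), chiFourSum (p.1 * p.2), by simp⟩

theorem chiFour_mul_chiFourSumMul : chiFour * chiFourSumMul = chiFourSumConv := by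
  ext n
  rcases eq_or_ne n 0 with rfl | hn
  · simp
  have h1 : ∀ p ∈ Finset.HasAntidiagonal.antidiagonal (2 * n), chiFourSum p.1 * chiFourSum p.2 =
      ∑ g ∈ n.divisors, if g ∣ p.1 ∧ g ∣ p.2 then
        chiFour g * chiFourSum (p.1 / g * (p.2 / g)) else 0 := by
    rintro ⟨a, b⟩ hab
    rw [Finset.HasAntidiagonal.mem_antidiagonal] at hab
    simp only at hab ⊢
    rw [chiFourSum_mul_chiFourSum, ← Finset.sum_filter]
    refine (Finset.sum_subset (fun g hg => ?_) fun g hg hg' => ?_).symm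
    · rw [Finset.mem_filter] at hg
      refine Nat.mem_divisors.2 ⟨Nat.dvd_gcd hg.2.1 hg.2.2, fun h => ?_⟩
      rw [Nat.gcd_eq_zero_iff] at h
      omega
    · have hga := (Nat.dvd_of_mem_divisors hg).trans (Nat.gcd_dvd_left _ _)
      have hgb := (Nat.dvd_of_mem_divisors hg).trans (Nat.gcd_dvd_right _ _)
      have hg2 : g ∣ 2 * n := hab ▸ dvd_add hga hgb
      have hodd : ¬ Odd g := fun h => hg' <| Finset.mem_filter.2
        ⟨Nat.mem_divisors.2 ⟨(Nat.coprime_two_right.2 h).dvd_of_dvd_mul_left hg2, hn⟩, hga, hgb⟩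
      rw [chiFour_apply, ZMod.χ₄_nat_eq_if_mod_four, if_pos, zero_mul]
      exact Nat.even_iff.1 (Nat.not_odd_iff_even.1 hodd)
  rw [mul_apply, Nat.sum_divisorsAntidiagonal fun g m => chiFour g * chiFourSumMul m]
  simp only [chiFourSumConv, chiFourSumMul, coe_mk]
  rw [Finset.sum_congr rfl h1, Finset.sum_comm]
  refine Finset.sum_congr rfl fun g hg => ?_
  obtain ⟨hg, -⟩ := Nat.mem_divisors.1 hg
  obtain ⟨m, rfl⟩ := hg
  have hg0 : 0 < g := Nat.pos_of_ne_zero (left_ne_zero_of_mul hn)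
  rw [← Finset.sum_filter, Finset.mul_sum, Nat.mul_div_cancel_left _ hg0]
  refine Finset.sum_bij' (fun p _ => (g * p.1, g * p.2)) (fun p _ => (p.1 / g, p.2 / g))
    ?_ ?_ ?_ ?_ ?_
  · rintro ⟨a, b⟩ h
    simp only [Finset.HasAntidiagonal.mem_antidiagonal, Finset.mem_filter] at *
    refine ⟨?_, dvd_mul_right _ _, dvd_mul_right _ _⟩
    rw [← mul_add, h]; ring
  · rintro ⟨a, b⟩ h
    simp only [Finset.HasAntidiagonal.mem_antidiagonal, Finset.mem_filter] at *
    obtain ⟨h, ⟨a, rfl⟩, b, rfl⟩ := h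
    rw [Nat.mul_div_cancel_left _ hg0, Nat.mul_div_cancel_left _ hg0]
    refine Nat.eq_of_mul_eq_mul_left hg0 ?_
    linarith
  · rintro ⟨a, b⟩ h
    simp [Nat.mul_div_cancel_left _ hg0]
  · rintro ⟨a, b⟩ h
    simp only [Finset.mem_filter] at h
    simp [Nat.mul_div_cancel' h.2.1, Nat.mul_div_cancel' h.2.2]
  · rintro ⟨a, b⟩ h
    simp [Nat.mul_div_cancel_left _ hg0]

open ArithmeticFunction.Moebius in
/-- The Dirichlet inverse of `χ₋₄`. -/
def chiFourMoebius : ArithmeticFunction ℤ := chiFour.pmul μ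

open ArithmeticFunction.Moebius in
theorem chiFourMoebius_mul_chiFour : chiFourMoebius * chiFour = 1 := by
  ext n
  have h : (chiFourMoebius * chiFour) n = chiFour n * (μ * (ζ : ArithmeticFunction ℤ)) n := by
    rw [mul_apply, mul_apply, Finset.mul_sum]
    refine Finset.sum_congr rfl fun p hp => ?_
    obtain ⟨hp, hn⟩ := Nat.mem_divisorsAntidiagonal.1 hp
    rw [chiFourMoebius, pmul_apply, ← hp, chiFour_mul, natCoe_apply, zeta_apply_ne]
    · push_cast; ring
    · rintro h; simp [h] at hp; exact hn hp.symm
  rw [h, moebius_mul_coe_zeta]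
  rcases eq_or_ne n 1 with rfl | h1
  · simp [isMultiplicative_chiFour.1]
  · simp [h1]

theorem chiFourMoebius_mul_chiFourSumConv : chiFourMoebius * chiFourSumConv = chiFourSumMul := by
  rw [← chiFour_mul_chiFourSumMul, ← mul_assoc, chiFourMoebius_mul_chiFour, one_mul]

/-- The identity restricted to odd numbers. -/
def oddId : ArithmeticFunction ℤ := ⟨fun n => if Odd n then (n : ℤ) else 0, by simp⟩

/-- The sign `(-1) ^ n` for `n ≠ 0`. -/
def negOnePow : ArithmeticFunction ℤ := ⟨fun n => if n = 0 then 0 else (-1) ^ n, by simp⟩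

theorem abs_two_mul_chiFourSumConv_sub_le (k : ℕ) :
    |2 * chiFourSumConv k - (5 * (ζ * oddId) k +
        2 * (negOnePow * (ArithmeticFunction.id : ArithmeticFunction ℤ)) k)| ≤
      12 * ((ζ * ζ : ArithmeticFunction ℤ) k) := by
  have hmain : 5 * (ζ * oddId) k +
      2 * (negOnePow * (ArithmeticFunction.id : ArithmeticFunction ℤ)) k =
      ∑ d ∈ (2 * k).divisors, ((d : ℤ) - d * cosFour d + 2 * d * cosFour ↑(2 * k / d)) := by
    rw [Finset.sum_add_distrib,
      ← Nat.sum_div_divisors _ fun d => 2 * (d : ℤ) * cosFour ↑(2 * k / d)]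
    have e : ∀ d ∈ (2 * k).divisors, 2 * ((2 * k / d : ℕ) : ℤ) * cosFour ↑(2 * k / (2 * k / d)) =
        2 * ((2 * k / d : ℕ) : ℤ) * cosFour d := fun d hd => by
      obtain ⟨hd, h0⟩ := Nat.mem_divisors.1 hd
      rw [Nat.div_div_self hd h0]
    rw [Finset.sum_congr rfl e, ← Finset.sum_add_distrib, Nat.sum_divisors_two_mul,
      coe_zeta_mul_apply, mul_apply,
      Nat.sum_divisorsAntidiagonal fun d m =>
        negOnePow d * (ArithmeticFunction.id : ArithmeticFunction ℤ) m,
      Finset.sum_filter, ← Finset.sum_add_distrib, Finset.mul_sum, Finset.mul_sum,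
      ← Finset.sum_add_distrib]
    refine Finset.sum_congr rfl fun m hm => ?_
    have hm0 : m ≠ 0 := (Nat.pos_of_mem_divisors hm).ne'
    rw [cosFour_two_mul, Nat.mul_div_mul_left _ _ two_pos]
    simp only [oddId, negOnePow, coe_mk, hm0, if_false, natCoe_apply, id_apply]
    split_ifs with ho
    · rw [cosFour_odd ho, ho.neg_one_pow]; push_cast; ring
    · rw [(Nat.not_odd_iff_even.1 ho).neg_one_pow]; push_cast; ring
  have hcard : ((2 * k).divisors.card : ℤ) ≤ 2 * ((ζ * ζ : ArithmeticFunction ℤ) k) := by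
    have h1 := Nat.sum_divisors_two_mul k fun _ => (1 : ℤ)
    have h2 : (ζ * ζ : ArithmeticFunction ℤ) k = k.divisors.card := by
      rw [coe_mul_zeta_apply, Finset.sum_congr rfl (g := fun _ => (1 : ℤ))]
      · simp
      · intro d hd
        simp [(Nat.pos_of_mem_divisors hd).ne']
    have h3 : ((k.divisors.filter Odd).card : ℤ) ≤ k.divisors.card := by
      exact_mod_cast Finset.card_filter_le _ _
    simp only [Finset.sum_const, nsmul_eq_mul, mul_one] at h1
    linarith
  rw [hmain, chiFourSumConv, coe_mk, two_mul_sum_chiFourSum_mul, ← Finset.sum_sub_distrib]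
  calc _ ≤ ∑ d ∈ (2 * k).divisors, (6 : ℤ) := by
        refine (Finset.abs_sum_le_sum_abs _ _).trans (Finset.sum_le_sum fun d _ => ?_)
        have h1 := abs_le.1 (abs_cosFour_le d)
        have h2 := abs_le.1 (abs_cosFour_le ↑(2 * k / d))
        have h3 := abs_le.1 (abs_sum_cosFour_le d)
        rw [abs_le]
        constructor <;> linarith
    _ ≤ _ := by
        rw [Finset.sum_const, nsmul_eq_mul]
        linarith

theorem exists_abs_sum_intCast_mul_sub_le (h s : ArithmeticFunction ℤ) {B C H : ℝ} {r : ℕ}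
    (hh : ∀ n, |h n| ≤ 1) (hH : HasSum (fun n : ℕ => (h n : ℝ) / (n : ℝ) ^ 2) H)
    (hs : ∀ K : ℕ, |∑ k ∈ Finset.Ioc 0 K, (s k : ℝ) - B * (K : ℝ) ^ 2| ≤
      C * (K * (1 + Real.log K) ^ r)) :
    ∃ C' : ℝ, ∀ M : ℕ, |∑ n ∈ Finset.Ioc 0 M, ((h * s) n : ℝ) - B * H * (M : ℝ) ^ 2| ≤
      C' * (M * (1 + Real.log M) ^ (r + 1)) := by
  have := exists_abs_sum_mul_sub_le (h : ArithmeticFunction ℝ) (s : ArithmeticFunction ℝ)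
    (fun n => by rw [intCoe_apply]; exact_mod_cast hh n)
    (by simpa only [intCoe_apply] using hH) (by simpa only [intCoe_apply] using hs)
  simpa only [← intCoe_mul, intCoe_apply] using this

theorem hasSum_zeta_div_sq :
    HasSum (fun n : ℕ => (((ζ : ArithmeticFunction ℤ) n : ℤ) : ℝ) / (n : ℝ) ^ 2)
      (Real.pi ^ 2 / 6) := by
  convert hasSum_zeta_two using 2 with n
  rcases eq_or_ne n 0 with rfl | hn
  · simp
  · simp [hn]

theorem abs_zeta_le (n : ℕ) : |(ζ : ArithmeticFunction ℤ) n| ≤ 1 := by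
  rw [natCoe_apply, zeta_apply]
  split_ifs <;> simp

theorem hasSum_negOnePow_div_sq :
    HasSum (fun n : ℕ => (negOnePow n : ℝ) / (n : ℝ) ^ 2) (-(Real.pi ^ 2 / 12)) := by
  have h1 : HasSum (fun n : ℕ => if Even n then 1 / (n : ℝ) ^ 2 else 0) (Real.pi ^ 2 / 24) := by
    have h := hasSum_zeta_two.mul_left (1 / 4)
    rw [show 1 / 4 * (Real.pi ^ 2 / 6) = Real.pi ^ 2 / 24 by ring] at h
    have hi : Function.Injective fun n : ℕ => 2 * n := fun a b h => by simpa using h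
    rw [← hi.hasSum_iff]
    · rw [show ((fun n : ℕ => if Even n then 1 / (n : ℝ) ^ 2 else 0) ∘ fun n => 2 * n) =
        fun n : ℕ => 1 / 4 * (1 / (n : ℝ) ^ 2) from funext fun n => ?_]
      · exact h
      rw [Function.comp_apply, if_pos (even_two_mul n)]
      push_cast
      field_simp
      norm_num
    · intro n hn
      rw [if_neg]
      rintro hn'
      obtain ⟨m, rfl⟩ := hn'.two_dvd
      exact hn ⟨m, rfl⟩
  have h2 := (h1.mul_left 2).sub hasSum_zeta_two
  rw [show 2 * (Real.pi ^ 2 / 24) - Real.pi ^ 2 / 6 = -(Real.pi ^ 2 / 12) by ring] at h2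
  rw [show (fun n : ℕ => (negOnePow n : ℝ) / (n : ℝ) ^ 2) =
    fun n : ℕ => 2 * (if Even n then 1 / (n : ℝ) ^ 2 else 0) - 1 / (n : ℝ) ^ 2 from
      funext fun n => ?_]
  · exact h2
  rcases eq_or_ne n 0 with rfl | hn
  · simp
  · simp only [negOnePow, coe_mk, hn, if_false]
    split_ifs with he
    · rw [he.neg_one_pow]; push_cast; ring
    · rw [(Nat.not_even_iff_odd.1 he).neg_one_pow]; push_cast; ring

theorem abs_negOnePow_le (n : ℕ) : |negOnePow n| ≤ 1 := by
  simp only [negOnePow, coe_mk]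
  split_ifs <;> simp [abs_pow]

theorem abs_sum_id_sub_le (K : ℕ) :
    |∑ k ∈ Finset.Ioc 0 K, (((ArithmeticFunction.id : ArithmeticFunction ℤ) k : ℤ) : ℝ)
      - 1 / 2 * (K : ℝ) ^ 2| ≤ 1 * (K * (1 + Real.log K) ^ 0) := by
  have h : ∑ k ∈ Finset.Ioc 0 K, (((ArithmeticFunction.id : ArithmeticFunction ℤ) k : ℤ) : ℝ) =
      (K : ℝ) * (K + 1) / 2 := by
    induction K with
    | zero => simp
    | succ K ih =>
      rw [Finset.sum_Ioc_succ_top (Nat.zero_le K), ih, natCoe_apply, id_apply]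
      push_cast
      ring
  have hK : (0 : ℝ) ≤ K := K.cast_nonneg
  rw [h, abs_le]
  constructor <;> nlinarith

theorem abs_sum_oddId_sub_le (K : ℕ) :
    |∑ k ∈ Finset.Ioc 0 K, (oddId k : ℝ) - 1 / 4 * (K : ℝ) ^ 2| ≤
      1 * (K * (1 + Real.log K) ^ 0) := by
  have h : ∑ k ∈ Finset.Ioc 0 K, (oddId k : ℝ) =
      if Odd K then ((K : ℝ) + 1) ^ 2 / 4 else (K : ℝ) ^ 2 / 4 := by
    induction K with
    | zero => simp
    | succ K ih =>
      rw [Finset.sum_Ioc_succ_top (Nat.zero_le K), ih]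
      simp only [oddId, coe_mk, Nat.odd_add_one]
      by_cases h1 : Odd K
      all_goals simp only [h1, not_true, not_false_iff, if_true, if_false]; push_cast; ring
  rw [h, abs_le]
  rcases Nat.eq_zero_or_pos K with rfl | h0
  · simp
  have hK : (1 : ℝ) ≤ K := by exact_mod_cast h0
  split_ifs <;> constructor <;> nlinarith

theorem exists_abs_sum_zeta_mul_zeta_le :
    ∃ C : ℝ, ∀ K : ℕ, |∑ k ∈ Finset.Ioc 0 K, ((ζ * ζ : ArithmeticFunction ℤ) k : ℝ)| ≤
      C * (K * (1 + Real.log K) ^ 1) := by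
  obtain ⟨C, hC⟩ := exists_abs_sum_intCast_mul_sub_le (ζ : ArithmeticFunction ℤ)
    (ζ : ArithmeticFunction ℤ) (B := 0) (C := 1) (r := 0) abs_zeta_le hasSum_zeta_div_sq (by
      intro K
      have h : ∑ k ∈ Finset.Ioc 0 K, (((ζ : ArithmeticFunction ℤ) k : ℤ) : ℝ) = K := by
        rw [Finset.sum_congr rfl (g := fun _ => (1 : ℝ))]
        · simp
        · intro k hk
          simp [(Finset.mem_Ioc.1 hk).1.ne']
      rw [h]
      simp)
  exact ⟨C, fun K => by simpa using hC K⟩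

theorem exists_abs_sum_chiFourSumConv_sub_le :
    ∃ C : ℝ, ∀ K : ℕ, |∑ k ∈ Finset.Ioc 0 K, (chiFourSumConv k : ℝ)
      - Real.pi ^ 2 / 16 * (K : ℝ) ^ 2| ≤ C * (K * (1 + Real.log K) ^ 1) := by
  obtain ⟨C₁, h₁⟩ := exists_abs_sum_intCast_mul_sub_le (ζ : ArithmeticFunction ℤ) oddId
    abs_zeta_le hasSum_zeta_div_sq abs_sum_oddId_sub_le
  obtain ⟨C₂, h₂⟩ := exists_abs_sum_intCast_mul_sub_le negOnePow
    (ArithmeticFunction.id : ArithmeticFunction ℤ)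
    abs_negOnePow_le hasSum_negOnePow_div_sq abs_sum_id_sub_le
  obtain ⟨C₃, h₃⟩ := exists_abs_sum_zeta_mul_zeta_le
  refine ⟨(5 * C₁ + 2 * C₂ + 12 * C₃) / 2, fun K => ?_⟩
  have h₄ : |∑ k ∈ Finset.Ioc 0 K, (2 * (chiFourSumConv k : ℝ) - (5 * ((ζ * oddId) k : ℤ)
      + 2 * ((negOnePow * (ArithmeticFunction.id : ArithmeticFunction ℤ)) k : ℤ)))| ≤
      12 * ∑ k ∈ Finset.Ioc 0 K, ((ζ * ζ : ArithmeticFunction ℤ) k : ℝ) := by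
    rw [Finset.mul_sum]
    refine (Finset.abs_sum_le_sum_abs _ _).trans (Finset.sum_le_sum fun k _ => ?_)
    exact_mod_cast abs_two_mul_chiFourSumConv_sub_le k
  rw [Finset.sum_sub_distrib, Finset.sum_add_distrib, ← Finset.mul_sum, ← Finset.mul_sum,
    ← Finset.mul_sum] at h₄
  have a₁ := abs_le.1 (h₁ K)
  have a₂ := abs_le.1 (h₂ K)
  have a₃ := abs_le.1 (h₃ K)
  have a₄ := abs_le.1 h₄
  rw [abs_le]
  constructor <;> linarith

theorem abs_chiFour_le (n : ℕ) : |chiFour n| ≤ 1 := by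
  have h : ∀ x : ZMod 4, |ZMod.χ₄ x| ≤ 1 := by decide
  exact h n

theorem abs_chiFourMoebius_le (n : ℕ) : |chiFourMoebius n| ≤ 1 := by
  rw [chiFourMoebius, pmul_apply, abs_mul]
  exact mul_le_one₀ (abs_chiFour_le n) (abs_nonneg _) abs_moebius_le_one

theorem norm_intCast_le_one {f : ArithmeticFunction ℤ} (hf : ∀ n, |f n| ≤ 1) (n : ℕ) :
    ‖(f : ArithmeticFunction ℂ) n‖ ≤ 1 := by
  rw [intCoe_apply, Complex.norm_intCast]
  exact_mod_cast hf n

theorem summable_intCast_div_sq {f : ArithmeticFunction ℤ} (hf : ∀ n, |f n| ≤ 1) :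
    Summable fun n : ℕ => (f n : ℝ) / (n : ℝ) ^ 2 := by
  refine .of_norm_bounded hasSum_zeta_two.summable fun n => ?_
  rw [norm_div, norm_pow, Real.norm_natCast, Real.norm_eq_abs]
  gcongr
  exact_mod_cast hf n

theorem LSeries_intCast_two (f : ArithmeticFunction ℤ) :
    LSeries (fun n => (f : ArithmeticFunction ℂ) n) 2 =
      ((∑' n : ℕ, (f n : ℝ) / (n : ℝ) ^ 2 : ℝ) : ℂ) := by
  rw [LSeries, Complex.ofReal_tsum]
  refine tsum_congr fun n => ?_
  rcases eq_or_ne n 0 with rfl | hn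
  · simp
  · rw [LSeries.term_of_ne_zero hn, intCoe_apply]
    push_cast
    norm_cast

theorem tsum_chiFour_div_sq :
    ∑' n : ℕ, (chiFour n : ℝ) / (n : ℝ) ^ 2 = ∑' n : ℕ, (-1 : ℝ) ^ n / (2 * (n : ℝ) + 1) ^ 2 := by
  have hi : Function.Injective fun n : ℕ => 2 * n + 1 := fun a b h => by simpa using h
  rw [← hi.tsum_eq]
  · refine tsum_congr fun n => ?_
    rw [chiFour_apply, ZMod.χ₄_eq_neg_one_pow (by omega), show (2 * n + 1) / 2 = n by omega]
    push_cast
    rfl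
  · intro n hn
    rcases Nat.even_or_odd' n with ⟨m, rfl | rfl⟩
    · refine absurd ?_ hn
      dsimp only
      rw [chiFour_apply, ZMod.χ₄_nat_eq_if_mod_four, if_pos (by omega)]
      simp
    · exact ⟨m, rfl⟩

theorem hasSum_chiFourMoebius_div_sq :
    HasSum (fun n : ℕ => (chiFourMoebius n : ℝ) / (n : ℝ) ^ 2)
      (∑' n : ℕ, (-1 : ℝ) ^ n / (2 * (n : ℝ) + 1) ^ 2)⁻¹ := by
  have hs {f : ArithmeticFunction ℤ} (hf : ∀ n, |f n| ≤ 1) :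
      LSeriesSummable (fun n => (f : ArithmeticFunction ℂ) n) 2 :=
    LSeriesSummable_of_bounded_of_one_lt_re (fun n _ => norm_intCast_le_one hf n) (by norm_num)
  have h := LSeries_mul' (hs abs_chiFourMoebius_le) (hs abs_chiFour_le)
  rw [← intCoe_mul, chiFourMoebius_mul_chiFour, intCoe_one, one_eq_delta, LSeries_delta,
    Pi.one_apply, LSeries_intCast_two, LSeries_intCast_two, tsum_chiFour_div_sq] at h
  rw [← Complex.ofReal_mul, eq_comm, Complex.ofReal_eq_one] at h
  rw [← eq_inv_of_mul_eq_one_left h]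
  exact (summable_intCast_div_sq abs_chiFourMoebius_le).hasSum

theorem exists_abs_sum_chiFourSumMul_sub_le :
    ∃ C : ℝ, ∀ M : ℕ, |∑ n ∈ Finset.Ioc 0 M, (chiFourSumMul n : ℝ)
      - Real.pi ^ 2 / 16 * (∑' n : ℕ, (-1 : ℝ) ^ n / (2 * (n : ℝ) + 1) ^ 2)⁻¹ * (M : ℝ) ^ 2| ≤
      C * (M * (1 + Real.log M) ^ 2) := by
  obtain ⟨C, hC⟩ := exists_abs_sum_chiFourSumConv_sub_le
  rw [← chiFourMoebius_mul_chiFourSumConv]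
  exact exists_abs_sum_intCast_mul_sub_le chiFourMoebius chiFourSumConv
    abs_chiFourMoebius_le hasSum_chiFourMoebius_div_sq hC

/-- Writing `W² = X² + Y² + Z²` as `(|W| - X) (|W| + X) = Y² + Z²` fibres the Lorentz quadruples
over the decompositions `a + b = 2 |W|`. -/
theorem ncard_lorentzQuadruples (M : ℕ) :
    {v : ℤ × ℤ × ℤ × ℤ | v.1 ^ 2 = v.2.1 ^ 2 + v.2.2.1 ^ 2 + v.2.2.2 ^ 2 ∧ v.1.natAbs ≤ M}.ncard =
      ∑ W ∈ Finset.Icc (-M : ℤ) M, ∑ p ∈ Finset.HasAntidiagonal.antidiagonal (2 * W.natAbs),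
        (gaussianOfNorm (p.1 * p.2)).ncard := by
  let S : Finset (Σ _ : ℤ, Σ _ : ℕ × ℕ, GaussianInt) :=
    (Finset.Icc (-M : ℤ) M).sigma fun W =>
      (Finset.HasAntidiagonal.antidiagonal (2 * W.natAbs)).sigma fun p =>
        (finite_gaussianOfNorm (p.1 * p.2)).toFinset
  have hS (W : ℤ) (a b : ℕ) (z : GaussianInt) : (⟨W, (a, b), z⟩ : Σ _ : ℤ, Σ _ : ℕ × ℕ, _) ∈ S ↔
      W.natAbs ≤ M ∧ a + b = 2 * W.natAbs ∧ z.re ^ 2 + z.im ^ 2 = a * b := by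
    simp only [S, Finset.mem_sigma, Finset.mem_Icc, Finset.HasAntidiagonal.mem_antidiagonal,
      Set.Finite.mem_toFinset, mem_gaussianOfNorm, Nat.cast_mul]
    rw [show -(M : ℤ) ≤ W ∧ W ≤ M ↔ W.natAbs ≤ M by omega]
  let f : (Σ _ : ℤ, Σ _ : ℕ × ℕ, GaussianInt) → ℤ × ℤ × ℤ × ℤ :=
    fun s => (s.1, s.1.natAbs - s.2.1.1, s.2.2.re, s.2.2.im)
  have hf : Set.InjOn f S := by
    rintro ⟨W, ⟨a, b⟩, z⟩ h ⟨W', ⟨a', b'⟩, z'⟩ h' he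
    rw [Finset.mem_coe, hS] at h h'
    simp only [f, Prod.mk.injEq] at he
    obtain ⟨rfl, he, h1, h2⟩ := he
    obtain rfl : a = a' := by omega
    obtain rfl : b = b' := by omega
    obtain rfl : z = z' := Zsqrtd.ext h1 h2
    rfl
  have himage : {v : ℤ × ℤ × ℤ × ℤ | v.1 ^ 2 = v.2.1 ^ 2 + v.2.2.1 ^ 2 + v.2.2.2 ^ 2 ∧
      v.1.natAbs ≤ M} = S.image f := by
    ext ⟨W, X, Y, Z⟩
    rw [Finset.coe_image]
    constructor
    · rintro ⟨h, hM⟩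
      simp only at h hM
      have hX : |X| ≤ |W| := sq_le_sq.1 (by nlinarith)
      rw [abs_le, Int.abs_eq_natAbs] at hX
      refine ⟨⟨W, ((W.natAbs - X).toNat, (W.natAbs + X).toNat), ⟨Y, Z⟩⟩, ?_, ?_⟩
      · rw [Finset.mem_coe, hS]
        refine ⟨hM, by omega, ?_⟩
        rw [Int.toNat_of_nonneg (by omega), Int.toNat_of_nonneg (by omega)]
        have := Int.natAbs_sq W
        simp only
        linear_combination -h - this
      · simp only [f, Prod.mk.injEq, true_and, and_true]
        omega
    · rintro ⟨⟨W, ⟨a, b⟩, z⟩, h, he⟩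
      rw [Finset.mem_coe, hS] at h
      simp only [f, Prod.mk.injEq] at he
      obtain ⟨rfl, rfl, rfl, rfl⟩ := he
      refine ⟨?_, h.1⟩
      have h1 : (b : ℤ) = 2 * W.natAbs - a := by omega
      have h2 := h.2.2
      rw [h1] at h2
      have := Int.natAbs_sq W
      simp only
      linear_combination -h2 - this
  rw [himage, Set.ncard_coe_finset, Finset.card_image_of_injOn hf, Finset.card_sigma]
  refine Finset.sum_congr rfl fun W _ => ?_
  rw [Finset.card_sigma]
  exact Finset.sum_congr rfl fun p _ => (Set.ncard_eq_toFinset_card _ _).symm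

theorem sum_ncard_gaussianOfNorm {n : ℕ} (hn : n ≠ 0) :
    ((∑ p ∈ Finset.HasAntidiagonal.antidiagonal (2 * n), (gaussianOfNorm (p.1 * p.2)).ncard : ℕ) : ℤ)
      = 2 + 4 * chiFourSumMul n := by
  have h : ∀ m : ℕ, ((gaussianOfNorm m).ncard : ℤ) = (if m = 0 then 1 else 0) + 4 * chiFourSum m := by
    intro m
    split_ifs with hm
    · simp [hm, ncard_gaussianOfNorm_zero]
    · rw [ncard_gaussianOfNorm hm, zero_add]
  push_cast
  simp only [h]
  rw [Finset.sum_add_distrib, ← Finset.mul_sum, Finset.sum_boole]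
  have hc : (Finset.HasAntidiagonal.antidiagonal (2 * n)).filter (fun p => p.1 * p.2 = 0) =
      {(0, 2 * n), (2 * n, 0)} := by
    ext ⟨a, b⟩
    simp only [Finset.mem_filter, Finset.HasAntidiagonal.mem_antidiagonal, mul_eq_zero,
      Finset.mem_insert, Finset.mem_singleton, Prod.mk.injEq]
    omega
  rw [hc, Finset.card_pair (by simp [hn])]
  rfl

theorem ncard_lorentzQuadruples_eq (M : ℕ) :
    ({v : ℤ × ℤ × ℤ × ℤ | v.1 ^ 2 = v.2.1 ^ 2 + v.2.2.1 ^ 2 + v.2.2.2 ^ 2 ∧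
      v.1.natAbs ≤ M}.ncard : ℤ) = 1 + 4 * M + 8 * ∑ n ∈ Finset.Ioc 0 M, chiFourSumMul n := by
  rw [ncard_lorentzQuadruples]
  let g : ℕ → ℤ := fun n =>
    ∑ p ∈ Finset.HasAntidiagonal.antidiagonal (2 * n), ((gaussianOfNorm (p.1 * p.2)).ncard : ℤ)
  have h0 : g 0 = 1 := by simp [g, ncard_gaussianOfNorm_zero]
  have h := Finset.sum_Icc_of_even_eq_range (f := fun W : ℤ => g W.natAbs) (fun W => by simp) M
  push_cast
  refine h.trans ?_
  rw [Finset.sum_range_succ']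
  have h1 : ∀ n ∈ Finset.range M, g ((n + 1 : ℕ) : ℤ).natAbs = 2 + 4 * chiFourSumMul (n + 1) :=
    fun n _ => by
      rw [Int.natAbs_natCast, ← sum_ncard_gaussianOfNorm n.succ_ne_zero]
      push_cast
      rfl
  have h2 : ∑ n ∈ Finset.range M, chiFourSumMul (n + 1) = ∑ n ∈ Finset.Ioc 0 M, chiFourSumMul n := by
    rw [Finset.range_eq_Ico, Finset.sum_Ico_add' chiFourSumMul]
    rfl
  rw [Finset.sum_congr rfl h1, Finset.sum_add_distrib, ← Finset.mul_sum, h2]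
  simp [h0]
  ring

theorem exists_abs_ncard_lorentzQuadruples_sub_le :
    ∃ C : ℝ, ∀ M : ℕ,
      |({v : ℤ × ℤ × ℤ × ℤ | v.1 ^ 2 = v.2.1 ^ 2 + v.2.2.1 ^ 2 + v.2.2.2 ^ 2 ∧
        v.1.natAbs ≤ M}.ncard : ℝ)
        - 2 * (Real.pi ^ 2 / (4 * ∑' n : ℕ, (-1 : ℝ) ^ n / (2 * (n : ℝ) + 1) ^ 2)) * (M : ℝ) ^ 2| ≤
      1 + 4 * M + C * (M * (1 + Real.log M) ^ 2) := by
  obtain ⟨C, hC⟩ := exists_abs_sum_chiFourSumMul_sub_le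
  refine ⟨8 * C, fun M => ?_⟩
  have h : ({v : ℤ × ℤ × ℤ × ℤ | v.1 ^ 2 = v.2.1 ^ 2 + v.2.2.1 ^ 2 + v.2.2.2 ^ 2 ∧
      v.1.natAbs ≤ M}.ncard : ℝ) = 1 + 4 * M + 8 * ∑ n ∈ Finset.Ioc 0 M, (chiFourSumMul n : ℝ) := by
    exact_mod_cast ncard_lorentzQuadruples_eq M
  have h1 := abs_le.1 (hC M)
  rw [div_mul_eq_div_div, div_eq_mul_inv _ (∑' n : ℕ, (-1 : ℝ) ^ n / (2 * (n : ℝ) + 1) ^ 2), h,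
    abs_le]
  have hM : (0 : ℝ) ≤ M := M.cast_nonneg
  constructor <;> linarith

theorem sqrt_le_iff_natAbs_le_floor {T : ℝ} (hT : 0 ≤ T) {W n : ℤ} (h : W ^ 2 = n) :
    Real.sqrt ((W ^ 2 + n : ℤ) : ℝ) ≤ T ↔ W.natAbs ≤ ⌊T / Real.sqrt 2⌋₊ := by
  rw [Nat.le_floor_iff (by positivity), le_div_iff₀ (by positivity), ← h, Nat.cast_natAbs,
    Int.cast_abs]
  push_cast
  rw [← two_mul, mul_comm, Real.sqrt_mul (sq_nonneg _), Real.sqrt_sq_eq_abs]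

end

/-- **Asymptotics for integer Lorentz quadruples.**
The number `N_L(T)` of integer quadruples `(W,X,Y,Z)` with `W² = X² + Y² + Z²`
and Euclidean norm at most `T` satisfies
`N_L(T) = (π² / (4 L(2,χ₋₄))) T² + O(T (log T)²)` as `T → ∞`. -/
theorem lorentz_quadruple_count_asymptotic :
    (fun T : ℝ =>
        (Nat.card {v : ℤ × ℤ × ℤ × ℤ //
            v.1 ^ 2 = v.2.1 ^ 2 + v.2.2.1 ^ 2 + v.2.2.2 ^ 2 ∧
            Real.sqrt (((v.1 ^ 2 + v.2.1 ^ 2 + v.2.2.1 ^ 2 + v.2.2.2 ^ 2 : ℤ) : ℝ)) ≤ T} : ℝ) -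
          Real.pi ^ 2 / (4 * ∑' n : ℕ, (-1 : ℝ) ^ n / (2 * (n : ℝ) + 1) ^ 2) * T ^ 2)
      =O[atTop] fun T => T * Real.log T ^ 2 := by
  obtain ⟨C, hC⟩ := exists_abs_ncard_lorentzQuadruples_sub_le
  set c := Real.pi ^ 2 / (4 * ∑' n : ℕ, (-1 : ℝ) ^ n / (2 * (n : ℝ) + 1) ^ 2)
  refine Asymptotics.IsBigO.of_bound (5 + 4 * |C| + 4 * |c|) ?_
  filter_upwards [eventually_ge_atTop (Real.exp 1)] with T hT
  have hT1 : 1 ≤ T := (Real.one_le_exp zero_le_one).trans hT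
  have hlog : 1 ≤ Real.log T := (Real.le_log_iff_exp_le (by linarith)).2 hT
  set x := T / Real.sqrt 2
  have hx0 : 0 ≤ x := by positivity
  have hxT : x ≤ T := div_le_self (by linarith) (Real.one_le_sqrt.2 one_le_two)
  have hx2 : 2 * x ^ 2 = T ^ 2 := by
    rw [div_pow, Real.sq_sqrt zero_le_two]; ring
  set M := ⌊x⌋₊
  have hMx : (M : ℝ) ≤ x := Nat.floor_le hx0
  have hxM : x < M + 1 := Nat.lt_floor_add_one x
  have hM0 : (0 : ℝ) ≤ M := M.cast_nonneg
  have hcard : Nat.card {v : ℤ × ℤ × ℤ × ℤ //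
      v.1 ^ 2 = v.2.1 ^ 2 + v.2.2.1 ^ 2 + v.2.2.2 ^ 2 ∧
      Real.sqrt (((v.1 ^ 2 + v.2.1 ^ 2 + v.2.2.1 ^ 2 + v.2.2.2 ^ 2 : ℤ) : ℝ)) ≤ T} =
      {v : ℤ × ℤ × ℤ × ℤ | v.1 ^ 2 = v.2.1 ^ 2 + v.2.2.1 ^ 2 + v.2.2.2 ^ 2 ∧
        v.1.natAbs ≤ M}.ncard := by
    rw [← Nat.card_coe_set_eq]
    refine Nat.card_congr (Equiv.subtypeEquivRight fun v => and_congr_right fun h => ?_)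
    rw [add_assoc (v.1 ^ 2), add_assoc (v.1 ^ 2)]
    exact sqrt_le_iff_natAbs_le_floor (by linarith) h
  have hlogM : (1 + Real.log M) ^ 2 ≤ 4 * Real.log T ^ 2 := by
    have h1 : Real.log M ≤ Real.log T := by
      rcases Nat.eq_zero_or_pos M with h | h
      · rw [h, Nat.cast_zero, Real.log_zero]; linarith
      · exact Real.log_le_log (by exact_mod_cast h) (hMx.trans hxT)
    have h2 : 0 ≤ Real.log M := Real.log_natCast_nonneg M
    nlinarith
  have hlog2 : 1 ≤ Real.log T ^ 2 := one_le_pow₀ hlog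
  have hTlog : T ≤ T * Real.log T ^ 2 := le_mul_of_one_le_right (by linarith) hlog2
  have hE : C * (M * (1 + Real.log M) ^ 2) ≤ 4 * |C| * (T * Real.log T ^ 2) := by
    calc C * (M * (1 + Real.log M) ^ 2) ≤ |C| * (T * (4 * Real.log T ^ 2)) := by
          gcongr
          · exact le_abs_self C
          · exact hMx.trans hxT
      _ = _ := by ring
  have hS : |2 * c * (M : ℝ) ^ 2 - c * T ^ 2| ≤ 4 * |c| * (T * Real.log T ^ 2) := by
    rw [← hx2, show 2 * c * (M : ℝ) ^ 2 - c * (2 * x ^ 2) = c * (2 * (M ^ 2 - x ^ 2)) by ring,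
      abs_mul, mul_comm 4, mul_assoc |c|]
    gcongr
    rw [abs_le]
    constructor <;> nlinarith
  rw [hcard, Real.norm_eq_abs, Real.norm_eq_abs, abs_of_nonneg (by positivity : 0 ≤ T * _)]
  calc _ ≤ _ := abs_sub_le _ (2 * c * (M : ℝ) ^ 2) _
    _ ≤ (1 + 4 * M + C * (M * (1 + Real.log M) ^ 2)) + 4 * |c| * (T * Real.log T ^ 2) :=
      add_le_add (hC M) hS
    _ ≤ _ := by linarith
end

section
/- Let N*_L(T) denote the number of integer quadruples (W,X,Y,Z) ∈ ℤ⁴ satisfying W² = X² + Y² + Z², with gcd(W,X,Y,Z) = 1, and with Euclidean norm √(W²+X²+Y²+Z²) at most T. Then N*_L(T) = (3 / (2·L(2,χ₋₄)))·T² + O(T·(log T)²) as T → ∞. -/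
open Filter

namespace PrimitiveLorentz

open Finset ZMod

/-- The divisor sum `∑_{d ∣ m} χ₋₄(d)`. -/
def chiDivisorSum (m : ℕ) : ℤ := ∑ d ∈ m.divisors, χ₄ d

/-- Divisors of `p * m` for a prime `p`. -/
theorem divisors_prime_mul {p m : ℕ} (hp : p.Prime) (hm : m ≠ 0) :
    (p * m).divisors = m.divisors ∪ m.divisors.image (p * ·) := by
  ext d
  simp only [Nat.mem_divisors, mem_union, mem_image]
  constructor
  · rintro ⟨hd, -⟩
    by_cases hpd : p ∣ d
    · obtain ⟨e, rfl⟩ := hpd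
      exact Or.inr ⟨e, ⟨Nat.dvd_of_mul_dvd_mul_left hp.pos hd, hm⟩, rfl⟩
    · exact Or.inl ⟨((hp.coprime_iff_not_dvd.2 hpd).symm).dvd_of_dvd_mul_left hd, hm⟩
  · rintro (⟨hd, -⟩ | ⟨e, ⟨he, -⟩, rfl⟩)
    · exact ⟨hd.mul_left p, mul_ne_zero hp.ne_zero hm⟩
    · exact ⟨Nat.mul_dvd_mul_left p he, mul_ne_zero hp.ne_zero hm⟩

theorem sum_image_prime_mul (p : ℕ) (hp : p.Prime) (m : ℕ) :
    ∑ d ∈ m.divisors.image (p * ·), χ₄ (d : ZMod 4) = χ₄ p * chiDivisorSum m := by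
  rw [sum_image (fun a _ b _ h => Nat.eq_of_mul_eq_mul_left hp.pos h), chiDivisorSum, mul_sum]
  exact sum_congr rfl fun d _ => by push_cast; rw [map_mul]

theorem chiDivisorSum_prime_mul {p m : ℕ} (hp : p.Prime) (hm : m ≠ 0) (hpm : ¬ p ∣ m) :
    chiDivisorSum (p * m) = (1 + χ₄ p) * chiDivisorSum m := by
  rw [chiDivisorSum, divisors_prime_mul hp hm, sum_union, sum_image_prime_mul p hp,
    ← chiDivisorSum]
  · ring
  · rw [disjoint_left]
    intro d hd hd'
    obtain ⟨e, -, rfl⟩ := mem_image.1 hd'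
    exact hpm ((Dvd.intro _ rfl).trans (Nat.dvd_of_mem_divisors hd))

theorem chiDivisorSum_prime_mul_mul {p m : ℕ} (hp : p.Prime) (hm : m ≠ 0) :
    chiDivisorSum (p * (p * m)) + χ₄ p * chiDivisorSum m =
      (1 + χ₄ p) * chiDivisorSum (p * m) := by
  have hpm : p * m ≠ 0 := mul_ne_zero hp.ne_zero hm
  have hinter : (p * m).divisors ∩ (p * m).divisors.image (p * ·) =
      m.divisors.image (p * ·) := by
    ext d
    simp only [mem_inter, mem_image, Nat.mem_divisors]
    constructor
    · rintro ⟨⟨hd, -⟩, e, -, rfl⟩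
      exact ⟨e, ⟨Nat.dvd_of_mul_dvd_mul_left hp.pos hd, hm⟩, rfl⟩
    · rintro ⟨e, ⟨he, -⟩, rfl⟩
      exact ⟨⟨Nat.mul_dvd_mul_left p he, hpm⟩, e, ⟨he.mul_left p, hpm⟩, rfl⟩
  rw [← sum_image_prime_mul p hp m, ← hinter, chiDivisorSum, divisors_prime_mul hp hpm,
    sum_union_inter, sum_image_prime_mul p hp, ← chiDivisorSum]
  ring

/-- The Gaussian integers of norm `m`. -/
def gaussianNormSet (m : ℕ) : Set GaussianInt := {z | z.norm = m}

theorem gaussianInt_norm_eq (z : GaussianInt) : z.norm = z.re ^ 2 + z.im ^ 2 := by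
  rw [Zsqrtd.norm_def]; ring

theorem finite_gaussianNormSet (m : ℕ) : (gaussianNormSet m).Finite := by
  refine Set.Finite.subset (Set.Finite.image (fun x : ℤ × ℤ => (⟨x.1, x.2⟩ : GaussianInt))
    ((Icc (-m : ℤ) m ×ˢ Icc (-m : ℤ) m).finite_toSet)) ?_
  intro z hz
  have hz' : z.re ^ 2 + z.im ^ 2 = m := by rw [← gaussianInt_norm_eq]; exact hz
  refine ⟨(z.re, z.im), ?_, rfl⟩
  simp only [coe_product, coe_Icc, Set.mem_prod, Set.mem_Icc]
  refine ⟨⟨?_, ?_⟩, ?_, ?_⟩ <;>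
    nlinarith [sq_nonneg z.re, sq_nonneg z.im, Int.le_self_sq z.re, Int.le_self_sq z.im,
      Int.le_self_sq (-z.re), Int.le_self_sq (-z.im)]

/-- The number of Gaussian integers of norm `m`. -/
noncomputable def gaussianNormCount (m : ℕ) : ℕ := (gaussianNormSet m).ncard

theorem gaussianNormCount_one : gaussianNormCount 1 = 4 := by
  have : gaussianNormSet 1 =
      (({⟨1, 0⟩, ⟨-1, 0⟩, ⟨0, 1⟩, ⟨0, -1⟩} : Finset GaussianInt) : Set GaussianInt) := by
    ext ⟨x, y⟩
    simp only [gaussianNormSet, Set.mem_ofPred_eq, gaussianInt_norm_eq, coe_insert, coe_singleton,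
      Set.mem_insert_iff, Set.mem_singleton_iff, Zsqrtd.ext_iff]
    constructor
    · intro h
      have h1 : x ≤ 1 := by push_cast at h; nlinarith
      have h2 : -1 ≤ x := by push_cast at h; nlinarith
      have h3 : y ≤ 1 := by push_cast at h; nlinarith
      have h4 : -1 ≤ y := by push_cast at h; nlinarith
      interval_cases x <;> interval_cases y <;> simp_all
    · rintro (⟨rfl, rfl⟩ | ⟨rfl, rfl⟩ | ⟨rfl, rfl⟩ | ⟨rfl, rfl⟩) <;> norm_num
  rw [gaussianNormCount, this, Set.ncard_coe_finset]
  decide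

theorem ncard_image_mul_gaussianNormSet {w : GaussianInt} (hw : w ≠ 0) (m : ℕ) :
    ((w * ·) '' gaussianNormSet m).ncard = gaussianNormCount m :=
  Set.ncard_image_of_injective _ (mul_right_injective₀ hw)

theorem mem_image_mul_gaussianNormSet {w : GaussianInt} (hw : w ≠ 0) {q m : ℕ}
    (hq : w.norm = q) {z : GaussianInt} :
    z ∈ (w * ·) '' gaussianNormSet m ↔ w ∣ z ∧ z ∈ gaussianNormSet (q * m) := by
  have hq0 : (q : ℤ) ≠ 0 := by rw [← hq]; exact (GaussianInt.norm_pos.2 hw).ne'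
  constructor
  · rintro ⟨y, hy, rfl⟩
    refine ⟨Dvd.intro _ rfl, ?_⟩
    have hy' : y.norm = m := hy
    simp [gaussianNormSet, Zsqrtd.norm_mul, hq, hy']
  · rintro ⟨⟨y, rfl⟩, hy⟩
    refine ⟨y, ?_, rfl⟩
    have hy' : (w * y).norm = ((q * m : ℕ) : ℤ) := hy
    rw [Zsqrtd.norm_mul, hq] at hy'
    push_cast at hy'
    exact mul_left_cancel₀ hq0 hy'

theorem prime_dvd_of_gaussian_norm_inert {p : ℕ} [Fact p.Prime] (hp3 : p % 4 = 3) {z : GaussianInt}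
    (h : (p : ℤ) ∣ z.norm) : (p : GaussianInt) ∣ z := by
  have hpr := GaussianInt.prime_of_nat_prime_of_mod_four_eq_three p hp3
  have h1 : (p : GaussianInt) ∣ z * star z := by
    rw [← Zsqrtd.norm_eq_mul_conj]
    have := (Int.castRingHom GaussianInt).map_dvd h
    simpa using this
  rcases hpr.dvd_or_dvd h1 with h2 | h2
  · exact h2
  · have := map_dvd (starRingEnd GaussianInt) h2
    simpa [starRingEnd_apply] using this

theorem gaussianNormCount_inert_mul_mul {p : ℕ} [hp : Fact p.Prime] (hp3 : p % 4 = 3) (m : ℕ) :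
    gaussianNormCount (p * (p * m)) = gaussianNormCount m := by
  have hp0 : (p : GaussianInt) ≠ 0 :=
    (GaussianInt.prime_of_nat_prime_of_mod_four_eq_three p hp3).ne_zero
  rw [← ncard_image_mul_gaussianNormSet hp0 m, gaussianNormCount]
  congr 1
  ext z
  rw [mem_image_mul_gaussianNormSet hp0 (q := p * p) (by simp [Zsqrtd.norm_natCast]), mul_assoc]
  refine ⟨fun h => ⟨prime_dvd_of_gaussian_norm_inert hp3 ?_, h⟩, And.right⟩
  have h' : z.norm = ((p * (p * m) : ℕ) : ℤ) := h
  rw [h']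
  push_cast
  exact Dvd.intro _ rfl

theorem gaussianNormCount_inert_mul {p : ℕ} [hp : Fact p.Prime] (hp3 : p % 4 = 3) {m : ℕ}
    (hpm : ¬ p ∣ m) : gaussianNormCount (p * m) = 0 := by
  rw [gaussianNormCount, Set.ncard_eq_zero (finite_gaussianNormSet _), Set.eq_empty_iff_forall_notMem]
  intro z hz
  have hz' : z.norm = ((p * m : ℕ) : ℤ) := hz
  have hd : (p : ℤ) ∣ z.norm := by rw [hz']; push_cast; exact Dvd.intro _ rfl
  obtain ⟨y, rfl⟩ := prime_dvd_of_gaussian_norm_inert hp3 hd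
  rw [Zsqrtd.norm_mul, Zsqrtd.norm_natCast] at hz'
  push_cast at hz'
  rw [mul_assoc] at hz'
  have hp0 : (p : ℤ) ≠ 0 := by exact_mod_cast hp.out.ne_zero
  have := mul_left_cancel₀ hp0 hz'
  exact hpm (Int.natCast_dvd_natCast.1 (Dvd.intro _ this))

theorem prime_of_gaussian_norm_prime {p : ℕ} (hp : p.Prime) {w : GaussianInt} (hw : w.norm = p) :
    Prime w := by
  rw [← irreducible_iff_prime, irreducible_iff]
  constructor
  · intro hu
    have := Zsqrtd.norm_eq_one_iff.2 hu
    rw [hw] at this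
    exact hp.one_lt.ne' (by simpa using this)
  · intro a b hab
    rw [← Zsqrtd.norm_eq_one_iff, ← Zsqrtd.norm_eq_one_iff]
    have h : a.norm.natAbs * b.norm.natAbs = p := by
      rw [← Int.natAbs_mul, ← Zsqrtd.norm_mul, ← hab, hw, Int.natAbs_natCast]
    have hirr : Irreducible p := hp
    have := hirr.isUnit_or_isUnit h.symm
    simpa using this

/-- Splitting of primes congruent to `1` modulo `4`. -/
theorem exists_gaussian_split {p : ℕ} [hp : Fact p.Prime] (hp1 : p % 4 = 1) :
    ∃ w : GaussianInt, w.norm = p ∧ Prime w ∧ Prime (star w) ∧ IsCoprime w (star w) := by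
  obtain ⟨a, b, hab⟩ := Nat.Prime.sq_add_sq (p := p) (by omega)
  set w : GaussianInt := ⟨a, b⟩ with hwdef
  have hw : w.norm = p := by
    rw [gaussianInt_norm_eq, ← hab]; simp [hwdef]
  have hw' : (star w).norm = p := by rw [Zsqrtd.norm_conj, hw]
  have hpw := prime_of_gaussian_norm_prime hp.out hw
  have hpw' := prime_of_gaussian_norm_prime hp.out hw'
  refine ⟨w, hw, hpw, hpw', (hpw.irreducible.coprime_iff_not_dvd).2 fun hdvd => ?_⟩
  have h2 : w ∣ ((2 * a : ℤ) : GaussianInt) := by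
    have h3 : ((2 * a : ℤ) : GaussianInt) = w + star w := by
      ext
      · simp [hwdef]; ring
      · simp [hwdef]
    rw [h3]
    exact dvd_add dvd_rfl hdvd
  obtain ⟨c, hc⟩ := h2
  have h4 : (2 * a : ℤ) * (2 * a) = p * c.norm := by
    rw [← hw, ← Zsqrtd.norm_mul, ← hc, Zsqrtd.norm_intCast]
  have h5 : p ∣ (2 * a) * (2 * a) := by
    apply Int.natCast_dvd_natCast.1
    push_cast
    exact Dvd.intro _ h4.symm
  have h6 : p ∣ 2 * a := by simpa using (hp.out.dvd_mul.1 h5)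
  have hpa : p ∣ a := by
    rcases hp.out.dvd_mul.1 h6 with h | h
    · have := Nat.le_of_dvd two_pos h
      have := hp.out.two_le
      omega
    · exact h
  have hpb : p ∣ b := by
    have h7 : p ∣ b ^ 2 := (Nat.dvd_add_right (hpa.trans (dvd_pow_self a two_ne_zero))).1
      (by rw [hab])
    exact hp.out.dvd_of_dvd_pow h7
  obtain ⟨a', rfl⟩ := hpa
  obtain ⟨b', rfl⟩ := hpb
  have h8 : p * (p * (a' ^ 2 + b' ^ 2)) = p * 1 := by linarith
  have h9 := Nat.eq_of_mul_eq_mul_left hp.out.pos h8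
  exact hp.out.one_lt.ne' (Nat.dvd_one.1 (Dvd.intro _ h9))

theorem gaussianNormCount_split_aux {p : ℕ} [hp : Fact p.Prime] (hp1 : p % 4 = 1) (m : ℕ) :
    gaussianNormCount (p * m) +
      {z : GaussianInt | (p : GaussianInt) ∣ z ∧ z ∈ gaussianNormSet (p * m)}.ncard =
      2 * gaussianNormCount m := by
  obtain ⟨w, hw, hpw, hpw', hco⟩ := exists_gaussian_split hp1
  have hw' : (star w).norm = p := by rw [Zsqrtd.norm_conj, hw]
  have hpe : (p : GaussianInt) = w * star w := by
    rw [← Zsqrtd.norm_eq_mul_conj, hw]; simp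
  have hun : (w * ·) '' gaussianNormSet m ∪ (star w * ·) '' gaussianNormSet m =
      gaussianNormSet (p * m) := by
    ext z
    rw [Set.mem_union, mem_image_mul_gaussianNormSet hpw.ne_zero hw,
      mem_image_mul_gaussianNormSet hpw'.ne_zero hw', ← or_and_right]
    refine ⟨And.right, fun h => ⟨?_, h⟩⟩
    have h' : z.norm = ((p * m : ℕ) : ℤ) := h
    have h1 : w ∣ z * star z := by
      rw [← Zsqrtd.norm_eq_mul_conj, h']
      push_cast
      rw [hpe, mul_assoc]
      exact Dvd.intro _ rfl
    rcases hpw.dvd_or_dvd h1 with h2 | h2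
    · exact Or.inl h2
    · right
      have := map_dvd (starRingEnd GaussianInt) h2
      simpa [starRingEnd_apply] using this
  have hin : (w * ·) '' gaussianNormSet m ∩ (star w * ·) '' gaussianNormSet m =
      {z : GaussianInt | (p : GaussianInt) ∣ z ∧ z ∈ gaussianNormSet (p * m)} := by
    ext z
    rw [Set.mem_inter_iff, mem_image_mul_gaussianNormSet hpw.ne_zero hw,
      mem_image_mul_gaussianNormSet hpw'.ne_zero hw', Set.mem_ofPred_eq, hpe]
    constructor
    · rintro ⟨⟨h1, h2⟩, h3, -⟩
      exact ⟨hco.mul_dvd h1 h3, h2⟩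
    · rintro ⟨h1, h2⟩
      exact ⟨⟨(Dvd.intro _ rfl).trans h1, h2⟩, (Dvd.intro_left _ rfl).trans h1, h2⟩
  have hfin (v : GaussianInt) := (finite_gaussianNormSet m).image (v * ·)
  have := Set.ncard_union_add_ncard_inter _ _ (hfin w) (hfin (star w))
  rw [hun, hin, ncard_image_mul_gaussianNormSet hpw.ne_zero,
    ncard_image_mul_gaussianNormSet hpw'.ne_zero] at this
  rw [gaussianNormCount, this, two_mul]

theorem gaussianNormCount_split_mul_mul {p : ℕ} [hp : Fact p.Prime] (hp1 : p % 4 = 1) (m : ℕ) :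
    gaussianNormCount (p * (p * m)) + gaussianNormCount m = 2 * gaussianNormCount (p * m) := by
  have hp0 : (p : GaussianInt) ≠ 0 := by exact_mod_cast hp.out.ne_zero
  rw [← gaussianNormCount_split_aux hp1 (p * m), ← ncard_image_mul_gaussianNormSet hp0 m]
  congr 2
  ext z
  rw [mem_image_mul_gaussianNormSet hp0 (q := p * p) (by simp [Zsqrtd.norm_natCast]), mul_assoc]
  rfl

theorem gaussianNormCount_split_mul {p : ℕ} [hp : Fact p.Prime] (hp1 : p % 4 = 1) {m : ℕ}
    (hpm : ¬ p ∣ m) : gaussianNormCount (p * m) = 2 * gaussianNormCount m := by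
  rw [← gaussianNormCount_split_aux hp1 m]
  convert (add_zero _).symm
  rw [Set.ncard_eq_zero ((finite_gaussianNormSet (p * m)).subset fun z hz => hz.2),
    Set.eq_empty_iff_forall_notMem]
  rintro z ⟨⟨y, rfl⟩, hz⟩
  have hz' : ((p : GaussianInt) * y).norm = ((p * m : ℕ) : ℤ) := hz
  rw [Zsqrtd.norm_mul, Zsqrtd.norm_natCast] at hz'
  push_cast at hz'
  rw [mul_assoc] at hz'
  have hp0 : (p : ℤ) ≠ 0 := by exact_mod_cast hp.out.ne_zero
  have := mul_left_cancel₀ hp0 hz'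
  exact hpm (Int.natCast_dvd_natCast.1 (Dvd.intro _ this))

/-- Jacobi's two-square theorem for odd numbers. -/
theorem gaussianNormCount_eq_of_odd (m : ℕ) (hm : Odd m) :
    (gaussianNormCount m : ℤ) = 4 * chiDivisorSum m := by
  induction m using Nat.strong_induction_on with
  | _ m ih =>
    by_cases h1 : m = 1
    · subst h1
      rw [gaussianNormCount_one]
      simp [chiDivisorSum]
    obtain ⟨p, hp, k, rfl⟩ := Nat.exists_prime_and_dvd h1
    have := Fact.mk hp
    obtain ⟨hpo, hko⟩ := Nat.odd_mul.1 hm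
    have hlt {a : ℕ} (ha : Odd a) : a < p * a := by
      have := ha.pos
      nlinarith [hp.two_le]
    have hk := ih k (hlt hko) hko
    by_cases hpk : p ∣ k
    · obtain ⟨l, rfl⟩ := hpk
      have hlo := (Nat.odd_mul.1 hko).2
      have hl := ih l ((hlt hlo).trans (hlt hko)) hlo
      have hrec := chiDivisorSum_prime_mul_mul hp hlo.pos.ne'
      rcases (by have := Nat.odd_iff.1 hpo; omega : p % 4 = 1 ∨ p % 4 = 3) with h4 | h4
      · rw [χ₄_nat_one_mod_four h4] at hrec
        have := gaussianNormCount_split_mul_mul h4 l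
        zify at this
        push_cast at *
        linarith
      · rw [χ₄_nat_three_mod_four h4] at hrec
        have := gaussianNormCount_inert_mul_mul h4 l
        zify at this
        push_cast at *
        linarith
    · have hrec := chiDivisorSum_prime_mul hp hko.pos.ne' hpk
      rcases (by have := Nat.odd_iff.1 hpo; omega : p % 4 = 1 ∨ p % 4 = 3) with h4 | h4
      · rw [χ₄_nat_one_mod_four h4] at hrec
        have := gaussianNormCount_split_mul h4 hpk
        zify at this
        linarith
      · rw [χ₄_nat_three_mod_four h4] at hrec
        have := gaussianNormCount_inert_mul h4 hpk
        zify at this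
        linarith

/-- The quadruples of odd natural numbers `(d, a, e, b)` with `d * a + e * b = 2 * m`. -/
def oddQuadruples (m : ℕ) : Finset (ℕ × ℕ × ℕ × ℕ) :=
  {x ∈ range (2 * m + 1) ×ˢ range (2 * m + 1) ×ˢ range (2 * m + 1) ×ˢ range (2 * m + 1) |
    Odd x.1 ∧ Odd x.2.1 ∧ Odd x.2.2.1 ∧ Odd x.2.2.2 ∧ x.1 * x.2.1 + x.2.2.1 * x.2.2.2 = 2 * m}

theorem mem_oddQuadruples {m d a e b : ℕ} : (d, a, e, b) ∈ oddQuadruples m ↔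
    Odd d ∧ Odd a ∧ Odd e ∧ Odd b ∧ d * a + e * b = 2 * m := by
  simp only [oddQuadruples, mem_filter, mem_product, mem_range, and_iff_right_iff_imp]
  rintro ⟨hd, ha, he, hb, h⟩
  have := hd.pos
  have := ha.pos
  have := he.pos
  have := hb.pos
  refine ⟨?_, ?_, ?_, ?_⟩ <;> nlinarith

/-- The quadruples of positive integers `(u, q, a, v)` with `q`, `a` odd and
`u * a + q * v = m`. -/
def mixedQuadruples (m : ℕ) : Finset (ℕ × ℕ × ℕ × ℕ) :=
  {x ∈ range (m + 1) ×ˢ range (m + 1) ×ˢ range (m + 1) ×ˢ range (m + 1) |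
    0 < x.1 ∧ Odd x.2.1 ∧ Odd x.2.2.1 ∧ 0 < x.2.2.2 ∧ x.1 * x.2.2.1 + x.2.1 * x.2.2.2 = m}

theorem mem_mixedQuadruples {m u q a v : ℕ} : (u, q, a, v) ∈ mixedQuadruples m ↔
    0 < u ∧ Odd q ∧ Odd a ∧ 0 < v ∧ u * a + q * v = m := by
  simp only [mixedQuadruples, mem_filter, mem_product, mem_range, and_iff_right_iff_imp]
  rintro ⟨hu, hq, ha, hv, h⟩
  have := hq.pos
  have := ha.pos
  refine ⟨?_, ?_, ?_, ?_⟩ <;> nlinarith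

theorem neg_one_pow_add_eq_zero {m u q a v : ℕ} (hm : Odd m) (hq : Odd q) (ha : Odd a)
    (h : u * a + q * v = m) : (-1 : ℤ) ^ u + (-1) ^ v = 0 := by
  have hp : Odd (u + v) := by
    rw [← h] at hm
    simp only [Nat.odd_add, Nat.odd_mul, Nat.even_mul] at hm ⊢
    have := Nat.not_even_iff_odd.2 hq
    tauto
  rcases Nat.even_or_odd u with hu | hu
  · have hv : Odd v := by rw [Nat.odd_add'] at hp; tauto
    rw [hu.neg_one_pow, hv.neg_one_pow]; norm_num
  · have hv : Even v := by rw [Nat.odd_add] at hp; tauto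
    rw [hu.neg_one_pow, hv.neg_one_pow]; norm_num

theorem sum_mixedQuadruples {m : ℕ} (hm : Odd m) :
    ∑ x ∈ mixedQuadruples m, (-1 : ℤ) ^ x.1 = 0 := by
  refine sum_involution (fun x _ => (x.2.2.2, x.2.2.1, x.2.1, x.1)) ?_ ?_ ?_ ?_
  · rintro ⟨u, q, a, v⟩ hx
    obtain ⟨hu, hq, ha, hv, h⟩ := mem_mixedQuadruples.1 hx
    exact neg_one_pow_add_eq_zero hm hq ha h
  · rintro ⟨u, q, a, v⟩ hx - heq
    obtain ⟨hu, hq, ha, hv, h⟩ := mem_mixedQuadruples.1 hx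
    have h0 := neg_one_pow_add_eq_zero hm hq ha h
    simp only [Prod.mk.injEq] at heq
    rw [heq.1] at h0
    have := pow_ne_zero u (show (-1 : ℤ) ≠ 0 by norm_num)
    omega
  · rintro ⟨u, q, a, v⟩ hx
    obtain ⟨hu, hq, ha, hv, h⟩ := mem_mixedQuadruples.1 hx
    exact mem_mixedQuadruples.2 ⟨hv, ha, hq, hu, by rw [← h]; ring⟩
  · rintro ⟨u, q, a, v⟩ hx
    rfl

theorem sum_mixedQuadruples_lt {m : ℕ} (hm : Odd m) :
    ∑ x ∈ mixedQuadruples m with 2 * x.2.2.2 < x.2.2.1, (-1 : ℤ) ^ x.1 = 0 := by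
  refine sum_involution
    (fun x _ => (x.2.2.2, x.2.2.1 - 2 * x.2.2.2, 2 * x.1 + x.2.1, x.1)) ?_ ?_ ?_ ?_
  · rintro ⟨u, q, a, v⟩ hx
    obtain ⟨hx, hlt⟩ := mem_filter.1 hx
    obtain ⟨hu, hq, ha, hv, h⟩ := mem_mixedQuadruples.1 hx
    exact neg_one_pow_add_eq_zero hm hq ha h
  · rintro ⟨u, q, a, v⟩ hx - heq
    obtain ⟨hx, hlt⟩ := mem_filter.1 hx
    obtain ⟨hu, hq, ha, hv, h⟩ := mem_mixedQuadruples.1 hx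
    have h0 := neg_one_pow_add_eq_zero hm hq ha h
    simp only [Prod.mk.injEq] at heq
    rw [heq.1] at h0
    have := pow_ne_zero u (show (-1 : ℤ) ≠ 0 by norm_num)
    omega
  · rintro ⟨u, q, a, v⟩ hx
    obtain ⟨hx, hlt⟩ := mem_filter.1 hx
    obtain ⟨hu, hq, ha, hv, h⟩ := mem_mixedQuadruples.1 hx
    simp only at hlt
    obtain ⟨c, rfl⟩ := Nat.exists_eq_add_of_lt hlt
    simp only [mem_filter, mem_mixedQuadruples]
    refine ⟨⟨hv, ?_, ?_, hu, ?_⟩, by have := hq.pos; omega⟩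
    · rw [Nat.odd_iff] at *; omega
    · rw [Nat.odd_iff] at *; omega
    · rw [← h, show 2 * v + c + 1 - 2 * v = c + 1 by omega]; ring
  · rintro ⟨u, q, a, v⟩ hx
    obtain ⟨hx, hlt⟩ := mem_filter.1 hx
    simp only at hlt
    simp only [Prod.mk.injEq, true_and, and_true]
    omega

theorem sum_mixedQuadruples_gt {m : ℕ} (hm : Odd m) :
    ∑ x ∈ mixedQuadruples m with x.2.2.1 < 2 * x.2.2.2, (-1 : ℤ) ^ x.1 = 0 := by
  have h := sum_filter_add_sum_filter_not (mixedQuadruples m)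
    (fun x => 2 * x.2.2.2 < x.2.2.1) (fun x => (-1 : ℤ) ^ x.1)
  rw [sum_mixedQuadruples hm, sum_mixedQuadruples_lt hm, zero_add] at h
  rw [← h]
  refine sum_congr (filter_congr ?_) fun _ _ => rfl
  rintro ⟨u, q, a, v⟩ hx
  obtain ⟨-, -, ha, -⟩ := mem_mixedQuadruples.1 hx
  rw [Nat.odd_iff] at ha
  simp only
  omega

theorem chi_mul_chi_eq_neg_one_pow (u q : ℕ) (hq : Odd q) :
    χ₄ ((2 * u + q : ℕ) : ZMod 4) * χ₄ (q : ZMod 4) = (-1) ^ u := by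
  have h2 : (2 * u + q) % 2 = 1 := by rw [Nat.odd_iff] at hq; omega
  rw [χ₄_eq_neg_one_pow h2, χ₄_eq_neg_one_pow (Nat.odd_iff.1 hq),
    show (2 * u + q) / 2 = u + q / 2 by omega, pow_add, mul_assoc, ← pow_add,
    Even.neg_one_pow ⟨q / 2, rfl⟩, mul_one]

theorem sum_oddQuadruples_gt {m : ℕ} (hm : Odd m) :
    ∑ x ∈ oddQuadruples m with x.2.2.1 < x.1, χ₄ (x.1 : ZMod 4) * χ₄ (x.2.2.1 : ZMod 4) = 0 := by
  rw [← sum_mixedQuadruples_gt hm]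
  refine sum_bij' (fun x _ => ((x.1 - x.2.2.1) / 2, x.2.2.1, x.2.1, (x.2.1 + x.2.2.2) / 2))
    (fun x _ => (2 * x.1 + x.2.1, x.2.2.1, x.2.1, 2 * x.2.2.2 - x.2.2.1)) ?_ ?_ ?_ ?_ ?_
  · rintro ⟨d, a, e, b⟩ hx
    simp only [mem_filter, mem_oddQuadruples] at hx
    obtain ⟨⟨⟨d', rfl⟩, ⟨a', rfl⟩, ⟨e', rfl⟩, ⟨b', rfl⟩, h⟩, hlt⟩ := hx
    obtain ⟨c, rfl⟩ := Nat.exists_eq_add_of_lt (show e' < d' by omega)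
    simp only [mem_filter, mem_mixedQuadruples]
    rw [show (2 * (e' + c + 1) + 1 - (2 * e' + 1)) / 2 = c + 1 by omega,
      show (2 * a' + 1 + (2 * b' + 1)) / 2 = a' + b' + 1 by omega]
    refine ⟨⟨by omega, ⟨e', rfl⟩, ⟨a', rfl⟩, by omega, by nlinarith⟩, by omega⟩
  · rintro ⟨u, q, a, v⟩ hx
    simp only [mem_filter, mem_mixedQuadruples] at hx
    obtain ⟨⟨hu, hq, ha, hv, h⟩, hlt⟩ := hx
    obtain ⟨c, hc⟩ := Nat.exists_eq_add_of_lt hlt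
    simp only [mem_filter, mem_oddQuadruples]
    rw [show 2 * v - a = c + 1 by omega]
    refine ⟨⟨?_, ha, hq, ?_, by nlinarith⟩, by omega⟩
    · rw [Nat.odd_iff] at *; omega
    · rw [Nat.odd_iff] at *; omega
  · rintro ⟨d, a, e, b⟩ hx
    simp only [mem_filter, mem_oddQuadruples] at hx
    obtain ⟨⟨⟨d', rfl⟩, ⟨a', rfl⟩, ⟨e', rfl⟩, ⟨b', rfl⟩, h⟩, hlt⟩ := hx
    simp only [Prod.mk.injEq, true_and]
    omega
  · rintro ⟨u, q, a, v⟩ hx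
    simp only [mem_filter, mem_mixedQuadruples] at hx
    obtain ⟨⟨hu, hq, ha, hv, h⟩, hlt⟩ := hx
    simp only [Prod.mk.injEq, true_and]
    omega
  · rintro ⟨d, a, e, b⟩ hx
    simp only [mem_filter, mem_oddQuadruples] at hx
    obtain ⟨⟨⟨d', rfl⟩, -, he, -, h⟩, hlt⟩ := hx
    rw [← chi_mul_chi_eq_neg_one_pow _ _ he]
    simp only
    congr 3
    rw [Nat.odd_iff] at he
    omega

theorem sum_oddQuadruples_lt {m : ℕ} (hm : Odd m) :
    ∑ x ∈ oddQuadruples m with x.1 < x.2.2.1, χ₄ (x.1 : ZMod 4) * χ₄ (x.2.2.1 : ZMod 4) = 0 := by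
  rw [← sum_oddQuadruples_gt hm]
  refine sum_bij' (fun x _ => (x.2.2.1, x.2.2.2, x.1, x.2.1))
    (fun x _ => (x.2.2.1, x.2.2.2, x.1, x.2.1)) ?_ ?_ ?_ ?_ ?_
  · rintro ⟨d, a, e, b⟩ hx
    simp only [mem_filter, mem_oddQuadruples] at hx ⊢
    rw [add_comm]
    tauto
  · rintro ⟨d, a, e, b⟩ hx
    simp only [mem_filter, mem_oddQuadruples] at hx ⊢
    rw [add_comm]
    tauto
  · rintro ⟨d, a, e, b⟩ hx
    rfl
  · rintro ⟨d, a, e, b⟩ hx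
    rfl
  · rintro ⟨d, a, e, b⟩ hx
    exact mul_comm _ _

theorem chi_mul_self_of_odd {d : ℕ} (hd : Odd d) : χ₄ (d : ZMod 4) * χ₄ (d : ZMod 4) = 1 := by
  simpa using chi_mul_chi_eq_neg_one_pow 0 d hd

theorem sum_oddQuadruples_diag {m : ℕ} (hm : Odd m) :
    ∑ x ∈ oddQuadruples m with x.1 = x.2.2.1, χ₄ (x.1 : ZMod 4) * χ₄ (x.2.2.1 : ZMod 4) =
      ∑ d ∈ m.divisors, (d : ℤ) := by
  have h1 : ∑ d ∈ m.divisors, (d : ℤ) =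
      ∑ p ∈ m.divisorsAntidiagonal, ∑ i ∈ range p.2, (1 : ℤ) := by
    rw [Nat.sum_divisorsAntidiagonal' (fun _ k => ∑ i ∈ range k, (1 : ℤ))]
    simp
  rw [h1, sum_sigma']
  refine sum_bij' (fun x _ => ⟨(x.1, (x.2.1 + x.2.2.2) / 2), x.2.1 / 2⟩)
    (fun y _ => (y.1.1, 2 * y.2 + 1, y.1.1, 2 * y.1.2 - (2 * y.2 + 1))) ?_ ?_ ?_ ?_ ?_
  · rintro ⟨d, a, e, b⟩ hx
    simp only [mem_filter, mem_oddQuadruples] at hx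
    obtain ⟨⟨hd, ⟨a', rfl⟩, -, ⟨b', rfl⟩, h⟩, rfl⟩ := hx
    simp only [mem_sigma, Nat.mem_divisorsAntidiagonal, mem_range]
    rw [show (2 * a' + 1 + (2 * b' + 1)) / 2 = a' + b' + 1 by omega]
    exact ⟨⟨by nlinarith, hm.pos.ne'⟩, by omega⟩
  · rintro ⟨⟨d, k⟩, i⟩ hy
    simp only [mem_sigma, Nat.mem_divisorsAntidiagonal, mem_range] at hy
    obtain ⟨⟨rfl, -⟩, hi⟩ := hy
    obtain ⟨c, rfl⟩ := Nat.exists_eq_add_of_lt hi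
    simp only [mem_filter, mem_oddQuadruples]
    rw [show 2 * (i + c + 1) - (2 * i + 1) = 2 * c + 1 by omega]
    have hd := (Nat.odd_mul.1 hm).1
    exact ⟨⟨hd, ⟨i, rfl⟩, hd, ⟨c, rfl⟩, by ring⟩, trivial⟩
  · rintro ⟨d, a, e, b⟩ hx
    simp only [mem_filter, mem_oddQuadruples] at hx
    obtain ⟨⟨hd, ⟨a', rfl⟩, -, ⟨b', rfl⟩, h⟩, rfl⟩ := hx
    simp only [Prod.mk.injEq, true_and]
    omega
  · rintro ⟨⟨d, k⟩, i⟩ hy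
    simp only [mem_sigma, Nat.mem_divisorsAntidiagonal, mem_range] at hy
    obtain ⟨-, hi⟩ := hy
    have h1 : (2 * i + 1 + (2 * k - (2 * i + 1))) / 2 = k := by omega
    have h2 : (2 * i + 1) / 2 = i := by omega
    simp only [h1, h2]
  · rintro ⟨d, a, e, b⟩ hx
    simp only [mem_filter, mem_oddQuadruples] at hx
    obtain ⟨⟨hd, -⟩, rfl⟩ := hx
    exact chi_mul_self_of_odd hd

theorem sum_oddQuadruples {m : ℕ} (hm : Odd m) :
    ∑ x ∈ oddQuadruples m, χ₄ (x.1 : ZMod 4) * χ₄ (x.2.2.1 : ZMod 4) =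
      ∑ d ∈ m.divisors, (d : ℤ) := by
  rw [← sum_filter_add_sum_filter_not _ (fun x => x.2.2.1 < x.1), sum_oddQuadruples_gt hm,
    zero_add, ← sum_filter_add_sum_filter_not _ (fun x => x.1 < x.2.2.1), filter_filter,
    filter_filter, ← sum_oddQuadruples_diag hm]
  have h1 : ∀ x ∈ oddQuadruples m,
      (¬ x.2.2.1 < x.1 ∧ x.1 < x.2.2.1 ↔ x.1 < x.2.2.1) := fun x _ => by omega
  have h2 : ∀ x ∈ oddQuadruples m,
      (¬ x.2.2.1 < x.1 ∧ ¬ x.1 < x.2.2.1 ↔ x.1 = x.2.2.1) := fun x _ => by omega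
  rw [filter_congr h1, filter_congr h2, sum_oddQuadruples_lt hm, zero_add]

/-- Dirichlet's convolution identity behind the four-square theorem. -/
theorem sum_antidiagonal_chiDivisorSum {m : ℕ} (hm : Odd m) :
    ∑ x ∈ antidiagonal (2 * m) with Odd x.1, chiDivisorSum x.1 * chiDivisorSum x.2 =
      ∑ d ∈ m.divisors, (d : ℤ) := by
  rw [← sum_oddQuadruples hm]
  have h1 (n : ℕ) : chiDivisorSum n = ∑ p ∈ n.divisorsAntidiagonal, χ₄ (p.1 : ZMod 4) := by
    rw [chiDivisorSum, Nat.sum_divisorsAntidiagonal (fun d _ => χ₄ (d : ZMod 4))]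
  simp only [h1, sum_mul_sum, ← sum_product', sum_sigma']
  refine sum_bij' (fun y _ => (y.2.1.1, y.2.1.2, y.2.2.1, y.2.2.2))
    (fun x _ => ⟨(x.1 * x.2.1, x.2.2.1 * x.2.2.2), (x.1, x.2.1), (x.2.2.1, x.2.2.2)⟩) ?_ ?_ ?_ ?_ ?_
  · rintro ⟨⟨s, t⟩, ⟨d, a⟩, ⟨e, b⟩⟩ hy
    simp only [mem_sigma, mem_filter, HasAntidiagonal.mem_antidiagonal, mem_product,
      Nat.mem_divisorsAntidiagonal] at hy
    obtain ⟨⟨h, hodd⟩, ⟨rfl, -⟩, rfl, -⟩ := hy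
    have h2 : Odd (e * b) := by rw [Nat.odd_iff] at *; omega
    rw [Nat.odd_mul] at hodd h2
    exact mem_oddQuadruples.2 ⟨hodd.1, hodd.2, h2.1, h2.2, h⟩
  · rintro ⟨d, a, e, b⟩ hx
    obtain ⟨hd, ha, he, hb, h⟩ := mem_oddQuadruples.1 hx
    simp only [mem_sigma, mem_filter, HasAntidiagonal.mem_antidiagonal, mem_product,
      Nat.mem_divisorsAntidiagonal]
    exact ⟨⟨h, hd.mul ha⟩, ⟨trivial, (hd.mul ha).pos.ne'⟩, trivial, (he.mul hb).pos.ne'⟩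
  · rintro ⟨⟨s, t⟩, ⟨d, a⟩, ⟨e, b⟩⟩ hy
    simp only [mem_sigma, mem_product, Nat.mem_divisorsAntidiagonal] at hy
    obtain ⟨-, ⟨rfl, -⟩, rfl, -⟩ := hy
    rfl
  · rintro ⟨d, a, e, b⟩ hx
    rfl
  · rintro ⟨⟨s, t⟩, ⟨d, a⟩, ⟨e, b⟩⟩ hy
    rfl

theorem sum_divisors_moebius_eq (n : ℕ) :
    ∑ g ∈ n.divisors, ArithmeticFunction.moebius g = if n = 1 then 1 else 0 := by
  rw [← ArithmeticFunction.coe_mul_zeta_apply, ArithmeticFunction.moebius_mul_coe_zeta,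
    ArithmeticFunction.one_apply]

/-- The divisors of `a * b` factor uniquely as `d * e` with `d ∣ a`, `e ∣ b` and `e` coprime to
`a / d`. -/
theorem chiDivisorSum_mul_eq_sum_coprime {a b : ℕ} (ha : a ≠ 0) (hb : b ≠ 0) :
    chiDivisorSum (a * b) = ∑ x ∈ a.divisors ×ˢ b.divisors with Nat.gcd x.2 (a / x.1) = 1,
      χ₄ (x.1 : ZMod 4) * χ₄ (x.2 : ZMod 4) := by
  rw [chiDivisorSum]
  refine sum_bij' (fun c _ => (Nat.gcd c a, c / Nat.gcd c a)) (fun x _ => x.1 * x.2) ?_ ?_ ?_ ?_ ?_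
  · intro c hc
    have hc' := Nat.dvd_of_mem_divisors hc
    have hpos : 0 < Nat.gcd c a := Nat.gcd_pos_of_pos_right _ (Nat.pos_of_ne_zero ha)
    have hco := Nat.coprime_div_gcd_div_gcd hpos
    simp only [mem_filter, mem_product, Nat.mem_divisors]
    refine ⟨⟨⟨Nat.gcd_dvd_right _ _, ha⟩, ?_, hb⟩, hco⟩
    refine hco.dvd_of_dvd_mul_left (Nat.dvd_of_mul_dvd_mul_left hpos ?_)
    rw [Nat.mul_div_cancel' (Nat.gcd_dvd_left c a), ← mul_assoc,
      Nat.mul_div_cancel' (Nat.gcd_dvd_right c a)]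
    exact hc'
  · rintro ⟨d, e⟩ hx
    simp only [mem_filter, mem_product, Nat.mem_divisors] at hx
    exact Nat.mem_divisors.2 ⟨mul_dvd_mul hx.1.1.1 hx.1.2.1, mul_ne_zero ha hb⟩
  · intro c hc
    exact Nat.mul_div_cancel' (Nat.gcd_dvd_left c a)
  · rintro ⟨d, e⟩ hx
    simp only [mem_filter, mem_product, Nat.mem_divisors] at hx
    obtain ⟨⟨⟨⟨k, rfl⟩, -⟩, -⟩, hco⟩ := hx
    have hd : 0 < d := Nat.pos_of_ne_zero (left_ne_zero_of_mul ha)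
    rw [Nat.mul_div_cancel_left _ hd] at hco
    have h1 : Nat.gcd (d * e) (d * k) = d := by rw [Nat.gcd_mul_left, hco, mul_one]
    simp only [h1, Nat.mul_div_cancel_left _ hd]
  · intro c hc
    rw [← map_mul, ← Nat.cast_mul, Nat.mul_div_cancel' (Nat.gcd_dvd_left c a)]

theorem chiDivisorSum_mul {a b : ℕ} (ha : a ≠ 0) (hb : b ≠ 0) :
    chiDivisorSum (a * b) = ∑ g ∈ (Nat.gcd a b).divisors, ArithmeticFunction.moebius g *
      χ₄ (g : ZMod 4) * (chiDivisorSum (a / g) * chiDivisorSum (b / g)) := by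
  rw [chiDivisorSum_mul_eq_sum_coprime ha hb, sum_filter]
  have h1 : ∀ x ∈ a.divisors ×ˢ b.divisors,
      (if Nat.gcd x.2 (a / x.1) = 1 then χ₄ (x.1 : ZMod 4) * χ₄ (x.2 : ZMod 4) else 0) =
      ∑ g ∈ (Nat.gcd x.2 (a / x.1)).divisors,
        ArithmeticFunction.moebius g * (χ₄ (x.1 : ZMod 4) * χ₄ (x.2 : ZMod 4)) := by
    intro x _
    rw [← sum_mul, sum_divisors_moebius_eq, ite_mul, one_mul, zero_mul]
  rw [sum_congr rfl h1]
  have h2 (g : ℕ) : ArithmeticFunction.moebius g * χ₄ (g : ZMod 4) *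
      (chiDivisorSum (a / g) * chiDivisorSum (b / g)) =
      ∑ y ∈ (a / g).divisors ×ˢ (b / g).divisors, ArithmeticFunction.moebius g *
        χ₄ (g : ZMod 4) * (χ₄ (y.1 : ZMod 4) * χ₄ (y.2 : ZMod 4)) := by
    rw [chiDivisorSum, chiDivisorSum, sum_mul_sum, ← sum_product', mul_sum]
  simp only [h2, sum_sigma']
  refine sum_bij' (fun y _ => ⟨y.2, y.1.1, y.1.2 / y.2⟩) (fun y _ => ⟨(y.2.1, y.1 * y.2.2), y.1⟩)
    ?_ ?_ ?_ ?_ ?_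
  · rintro ⟨⟨d, e⟩, g⟩ hy
    simp only [mem_sigma, mem_product, Nat.mem_divisors, Nat.dvd_gcd_iff] at hy ⊢
    obtain ⟨⟨⟨⟨k, rfl⟩, -⟩, heb, -⟩, ⟨hge, hgk⟩, -⟩ := hy
    have hd : 0 < d := Nat.pos_of_ne_zero (left_ne_zero_of_mul ha)
    rw [Nat.mul_div_cancel_left _ hd] at hgk
    obtain ⟨e', rfl⟩ := hge
    obtain ⟨k', rfl⟩ := hgk
    obtain ⟨b', rfl⟩ := heb
    have hg : 0 < g := Nat.pos_of_ne_zero (by rintro rfl; simp at ha)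
    have he' : e' ≠ 0 := by rintro rfl; simp at hb
    have hb' : b' ≠ 0 := by rintro rfl; simp at hb
    have hk' : k' ≠ 0 := by rintro rfl; simp at ha
    rw [show d * (g * k') = g * (d * k') by ring, mul_assoc, Nat.mul_div_cancel_left _ hg,
      Nat.mul_div_cancel_left _ hg, Nat.mul_div_cancel_left _ hg]
    refine ⟨⟨⟨Dvd.intro _ rfl, Dvd.intro _ rfl⟩, ?_⟩, ⟨Dvd.intro _ rfl, ?_⟩, Dvd.intro _ rfl, ?_⟩
    · rw [Nat.gcd_mul_left]
      exact mul_ne_zero hg.ne' (Nat.gcd_ne_zero_left (mul_ne_zero hd.ne' hk'))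
    · exact mul_ne_zero hd.ne' hk'
    · exact mul_ne_zero he' hb'
  · rintro ⟨g, d, e⟩ hy
    simp only [mem_sigma, mem_product, Nat.mem_divisors, Nat.dvd_gcd_iff] at hy ⊢
    obtain ⟨⟨⟨⟨a', rfl⟩, ⟨b', rfl⟩⟩, -⟩, ⟨hda, -⟩, heb, -⟩ := hy
    have hg : 0 < g := Nat.pos_of_ne_zero (left_ne_zero_of_mul ha)
    rw [Nat.mul_div_cancel_left _ hg] at hda heb
    obtain ⟨k, rfl⟩ := hda
    have hd : 0 < d := Nat.pos_of_ne_zero (by rintro rfl; simp at ha)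
    have hk : k ≠ 0 := by rintro rfl; simp at ha
    rw [show g * (d * k) = d * (g * k) by ring, Nat.mul_div_cancel_left _ hd]
    exact ⟨⟨⟨Dvd.intro _ rfl, mul_ne_zero hd.ne' (mul_ne_zero hg.ne' hk)⟩,
      Nat.mul_dvd_mul_left g heb, hb⟩, ⟨Dvd.intro _ rfl, Dvd.intro _ rfl⟩,
      Nat.gcd_ne_zero_right (mul_ne_zero hg.ne' hk)⟩
  · rintro ⟨⟨d, e⟩, g⟩ hy
    simp only [mem_sigma, Nat.mem_divisors, Nat.dvd_gcd_iff] at hy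
    simp only [Nat.mul_div_cancel' hy.2.1.1]
  · rintro ⟨g, d, e⟩ hy
    simp only [mem_sigma, Nat.mem_divisors, Nat.dvd_gcd_iff] at hy
    have hg : 0 < g := Nat.pos_of_dvd_of_pos hy.1.1.1 (Nat.pos_of_ne_zero ha)
    simp only [Nat.mul_div_cancel_left _ hg]
  · rintro ⟨⟨d, e⟩, g⟩ hy
    simp only [mem_sigma, Nat.mem_divisors, Nat.dvd_gcd_iff] at hy
    obtain ⟨-, ⟨⟨e', rfl⟩, -⟩, -⟩ := hy
    rcases Nat.eq_zero_or_pos g with rfl | hg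
    · simp
    · simp only [Nat.mul_div_cancel_left _ hg]
      push_cast
      rw [map_mul]
      ring

/-- The integer points on the sphere of radius `n`. -/
noncomputable def spherePoints (n : ℕ) : Finset (ℤ × ℤ × ℤ) :=
  {v ∈ Icc (-n : ℤ) n ×ˢ Icc (-n : ℤ) n ×ˢ Icc (-n : ℤ) n |
    v.1 ^ 2 + v.2.1 ^ 2 + v.2.2 ^ 2 = (n : ℤ) ^ 2}

theorem mem_spherePoints {n : ℕ} {x y z : ℤ} :
    (x, y, z) ∈ spherePoints n ↔ x ^ 2 + y ^ 2 + z ^ 2 = (n : ℤ) ^ 2 := by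
  simp only [spherePoints, mem_filter, mem_product, mem_Icc, and_iff_right_iff_imp]
  intro h
  have key {t : ℤ} (ht : t ^ 2 ≤ (n : ℤ) ^ 2) : -(n : ℤ) ≤ t ∧ t ≤ n := abs_le.1 (by
    simpa using sq_le_sq.1 ht)
  exact ⟨key (by nlinarith), key (by nlinarith), key (by nlinarith)⟩

theorem exactly_one_odd {n : ℕ} (hn : Odd n) {x y z : ℤ}
    (h : x ^ 2 + y ^ 2 + z ^ 2 = (n : ℤ) ^ 2) :
    (Odd x ∧ Even y ∧ Even z) ∨ (Even x ∧ Odd y ∧ Even z) ∨ (Even x ∧ Even y ∧ Odd z) := by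
  have hn' : (n : ℤ) ^ 2 % 4 = 1 := by
    obtain ⟨k, rfl⟩ := hn
    have : ((2 * k + 1 : ℕ) : ℤ) ^ 2 = 4 * ((k : ℤ) ^ 2 + k) + 1 := by push_cast; ring
    omega
  have hsq (t : ℤ) : (Even t ∧ t ^ 2 % 4 = 0) ∨ (Odd t ∧ t ^ 2 % 4 = 1) := by
    rcases Int.even_or_odd' t with ⟨k, rfl | rfl⟩
    · exact Or.inl ⟨⟨k, by ring⟩, by rw [show (2 * k) ^ 2 = 4 * k ^ 2 by ring]; omega⟩
    · exact Or.inr ⟨⟨k, rfl⟩, by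
        rw [show (2 * k + 1) ^ 2 = 4 * (k ^ 2 + k) + 1 by ring]; omega⟩
  rcases hsq x with ⟨hx, hx'⟩ | ⟨hx, hx'⟩ <;> rcases hsq y with ⟨hy, hy'⟩ | ⟨hy, hy'⟩ <;>
    rcases hsq z with ⟨hz, hz'⟩ | ⟨hz, hz'⟩ <;> first | (exfalso; omega) | tauto

theorem three_mul_card_even_spherePoints {n : ℕ} (hn : Odd n) :
    3 * #{v ∈ spherePoints n | Even v.2.2} = 2 * #(spherePoints n) := by
  have hx : #{v ∈ spherePoints n | Even v.1} = #{v ∈ spherePoints n | Even v.2.2} := by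
    refine card_bij' (fun v _ => (v.2.2, v.2.1, v.1)) (fun v _ => (v.2.2, v.2.1, v.1))
      ?_ ?_ (fun _ _ => rfl) (fun _ _ => rfl) <;>
    · rintro ⟨x, y, z⟩ hv
      simp only [mem_filter, mem_spherePoints] at hv ⊢
      exact ⟨by linarith, hv.2⟩
  have hy : #{v ∈ spherePoints n | Even v.2.1} = #{v ∈ spherePoints n | Even v.2.2} := by
    refine card_bij' (fun v _ => (v.1, v.2.2, v.2.1)) (fun v _ => (v.1, v.2.2, v.2.1))
      ?_ ?_ (fun _ _ => rfl) (fun _ _ => rfl) <;>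
    · rintro ⟨x, y, z⟩ hv
      simp only [mem_filter, mem_spherePoints] at hv ⊢
      exact ⟨by linarith, hv.2⟩
  have hsum : #{v ∈ spherePoints n | Even v.1} + #{v ∈ spherePoints n | Even v.2.1} +
      #{v ∈ spherePoints n | Even v.2.2} = 2 * #(spherePoints n) := by
    simp only [card_filter]
    rw [← sum_add_distrib, ← sum_add_distrib, mul_comm, ← smul_eq_mul, ← sum_const]
    refine sum_congr rfl ?_
    rintro ⟨x, y, z⟩ hv
    rcases exactly_one_odd hn (mem_spherePoints.1 hv) with ⟨h1, h2, h3⟩ | ⟨h1, h2, h3⟩ | ⟨h1, h2, h3⟩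
    · simp [h2, h3, Int.not_even_iff_odd.2 h1]
    · simp [h1, h3, Int.not_even_iff_odd.2 h2]
    · simp [h1, h2, Int.not_even_iff_odd.2 h3]
  omega

theorem card_even_spherePoints_fiber {n a b : ℕ} (hab : a + b = 2 * n) (ha : Odd a) (hn : Odd n) :
    #{v ∈ ({v ∈ spherePoints n | Even v.2.2} : Finset (ℤ × ℤ × ℤ)) |
      (((n : ℤ) - v.2.2).toNat, ((n : ℤ) + v.2.2).toNat) = (a, b)} = gaussianNormCount (a * b) := by
  rw [gaussianNormCount, Set.ncard_eq_toFinset_card _ (finite_gaussianNormSet _)]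
  have hab' : (a : ℤ) + b = 2 * n := by exact_mod_cast hab
  refine card_bij' (fun v _ => (⟨v.1, v.2.1⟩ : GaussianInt)) (fun w _ => (w.re, w.im, (n : ℤ) - a))
    ?_ ?_ ?_ ?_
  · rintro ⟨x, y, z⟩ hv
    simp only [mem_filter, mem_spherePoints, Prod.mk.injEq] at hv
    obtain ⟨⟨hs, hz⟩, h1, h2⟩ := hv
    simp only [Set.Finite.mem_toFinset, gaussianNormSet, Set.mem_ofPred_eq, gaussianInt_norm_eq]
    have hapos := ha.pos
    have hz : z = n - a := by omega
    subst hz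
    push_cast
    have : (b : ℤ) = 2 * n - a := by linarith
    rw [this]
    linarith
  · rintro ⟨x, y⟩ hw
    simp only [Set.Finite.mem_toFinset, gaussianNormSet, Set.mem_ofPred_eq,
      gaussianInt_norm_eq] at hw
    simp only [mem_filter, mem_spherePoints, Prod.mk.injEq]
    push_cast at hw
    refine ⟨⟨?_, ?_⟩, by omega, by omega⟩
    · have : (b : ℤ) = 2 * n - a := by linarith
      rw [this] at hw
      linarith
    · have h1 : Odd (n : ℤ) := by exact_mod_cast hn
      have h2 : Odd (a : ℤ) := by exact_mod_cast ha
      exact h1.sub_odd h2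
  · rintro ⟨x, y, z⟩ hv
    simp only [mem_filter, mem_spherePoints, Prod.mk.injEq] at hv
    obtain ⟨⟨hs, hz⟩, h1, h2⟩ := hv
    have hapos := ha.pos
    simp only [Prod.mk.injEq, true_and]
    omega
  · rintro ⟨x, y⟩ hw
    rfl

theorem card_even_spherePoints {n : ℕ} (hn : Odd n) :
    #{v ∈ spherePoints n | Even v.2.2} =
      ∑ x ∈ antidiagonal (2 * n) with Odd x.1, gaussianNormCount (x.1 * x.2) := by
  rw [card_eq_sum_card_fiberwise (f := fun v : ℤ × ℤ × ℤ => (((n : ℤ) - v.2.2).toNat, ((n : ℤ) + v.2.2).toNat))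
    (t := {x ∈ antidiagonal (2 * n) | Odd x.1})]
  · refine sum_congr rfl ?_
    rintro ⟨a, b⟩ hx
    simp only [mem_filter, HasAntidiagonal.mem_antidiagonal] at hx
    exact card_even_spherePoints_fiber hx.1 hx.2 hn
  · rintro ⟨x, y, z⟩ hv
    simp only [coe_filter, Set.mem_ofPred_eq, mem_spherePoints] at hv
    simp only [coe_filter, Set.mem_ofPred_eq, HasAntidiagonal.mem_antidiagonal]
    have hz : |z| ≤ n := by
      have : z ^ 2 ≤ (n : ℤ) ^ 2 := by nlinarith
      simpa using sq_le_sq.1 this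
    rw [abs_le] at hz
    obtain ⟨⟨k, rfl⟩, ⟨c, hc⟩⟩ := And.intro hn hv.2
    refine ⟨by omega, ?_⟩
    rw [Nat.odd_iff]
    omega

theorem sum_antidiagonal_chiDivisorSum_mul {n : ℕ} (hn : Odd n) :
    ∑ x ∈ antidiagonal (2 * n) with Odd x.1, chiDivisorSum (x.1 * x.2) =
      ∑ p ∈ n.divisorsAntidiagonal, ArithmeticFunction.moebius p.1 * χ₄ (p.1 : ZMod 4) *
        ∑ d ∈ p.2.divisors, (d : ℤ) := by
  have h1 : ∀ x ∈ ({x ∈ antidiagonal (2 * n) | Odd x.1} : Finset (ℕ × ℕ)),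
      chiDivisorSum (x.1 * x.2) = ∑ g ∈ (Nat.gcd x.1 x.2).divisors, ArithmeticFunction.moebius g *
      χ₄ (g : ZMod 4) * (chiDivisorSum (x.1 / g) * chiDivisorSum (x.2 / g)) := by
    rintro ⟨a, b⟩ hx
    simp only [mem_filter, HasAntidiagonal.mem_antidiagonal] at hx
    obtain ⟨hab, ha⟩ := hx
    refine chiDivisorSum_mul ha.pos.ne' ?_
    rintro rfl
    rw [Nat.odd_iff] at ha
    omega
  have h2 : ∀ p ∈ n.divisorsAntidiagonal, ArithmeticFunction.moebius p.1 * χ₄ (p.1 : ZMod 4) *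
        ∑ d ∈ p.2.divisors, (d : ℤ) = ∑ x ∈ antidiagonal (2 * p.2) with Odd x.1,
        ArithmeticFunction.moebius p.1 * χ₄ (p.1 : ZMod 4) *
          (chiDivisorSum x.1 * chiDivisorSum x.2) := by
    rintro ⟨g, k⟩ hp
    obtain ⟨rfl, -⟩ := Nat.mem_divisorsAntidiagonal.1 hp
    rw [← sum_antidiagonal_chiDivisorSum (Nat.odd_mul.1 hn).2, mul_sum]
  rw [sum_congr rfl h1, sum_congr rfl h2, sum_sigma', sum_sigma']
  refine sum_bij' (fun y _ => ⟨(y.2, n / y.2), (y.1.1 / y.2, y.1.2 / y.2)⟩)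
    (fun y _ => ⟨(y.1.1 * y.2.1, y.1.1 * y.2.2), y.1.1⟩) ?_ ?_ ?_ ?_ ?_
  · rintro ⟨⟨a, b⟩, g⟩ hy
    simp only [mem_sigma, mem_filter, HasAntidiagonal.mem_antidiagonal, Nat.mem_divisors,
      Nat.dvd_gcd_iff] at hy
    obtain ⟨⟨hab, ha⟩, ⟨⟨a', rfl⟩, ⟨b', rfl⟩⟩, -⟩ := hy
    obtain ⟨hg, ha'⟩ := Nat.odd_mul.1 ha
    have hgn : g ∣ n := by
      refine (Nat.Coprime.symm (Nat.coprime_two_left.2 hg)).dvd_of_dvd_mul_left (m := 2) ?_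
      rw [← hab, ← mul_add]
      exact Dvd.intro _ rfl
    obtain ⟨k, rfl⟩ := hgn
    simp only [mem_sigma, mem_filter, HasAntidiagonal.mem_antidiagonal,
      Nat.mem_divisorsAntidiagonal, Nat.mul_div_cancel_left _ hg.pos]
    refine ⟨⟨trivial, hn.pos.ne'⟩, ?_, ha'⟩
    refine Nat.eq_of_mul_eq_mul_left hg.pos ?_
    linarith
  · rintro ⟨⟨g, k⟩, ⟨a, b⟩⟩ hy
    simp only [mem_sigma, mem_filter, HasAntidiagonal.mem_antidiagonal,
      Nat.mem_divisorsAntidiagonal] at hy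
    obtain ⟨⟨rfl, -⟩, hab, ha⟩ := hy
    have hg := (Nat.odd_mul.1 hn).1
    simp only [mem_sigma, mem_filter, HasAntidiagonal.mem_antidiagonal, Nat.mem_divisors,
      Nat.dvd_gcd_iff]
    refine ⟨⟨?_, hg.mul ha⟩, ⟨Dvd.intro _ rfl, Dvd.intro _ rfl⟩,
      Nat.gcd_ne_zero_left (hg.mul ha).pos.ne'⟩
    rw [← mul_add, hab]
    ring
  · rintro ⟨⟨a, b⟩, g⟩ hy
    simp only [mem_sigma, Nat.mem_divisors, Nat.dvd_gcd_iff] at hy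
    simp only [Nat.mul_div_cancel' hy.2.1.1, Nat.mul_div_cancel' hy.2.1.2]
  · rintro ⟨⟨g, k⟩, ⟨a, b⟩⟩ hy
    simp only [mem_sigma, Nat.mem_divisorsAntidiagonal] at hy
    obtain ⟨⟨rfl, -⟩, -⟩ := hy
    have hg := (Nat.odd_mul.1 hn).1.pos
    simp only [Nat.mul_div_cancel_left _ hg]
  · rintro ⟨⟨a, b⟩, g⟩ hy
    rfl

/-- The number of representations of an odd square as a sum of three squares. -/
theorem card_spherePoints {n : ℕ} (hn : Odd n) :
    (#(spherePoints n) : ℤ) = 6 * ∑ p ∈ n.divisorsAntidiagonal,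
      ArithmeticFunction.moebius p.1 * χ₄ (p.1 : ZMod 4) * ∑ d ∈ p.2.divisors, (d : ℤ) := by
  have h1 := three_mul_card_even_spherePoints hn
  have h2 : (#{v ∈ spherePoints n | Even v.2.2} : ℤ) =
      4 * ∑ x ∈ antidiagonal (2 * n) with Odd x.1, chiDivisorSum (x.1 * x.2) := by
    rw [card_even_spherePoints hn, Nat.cast_sum, mul_sum]
    refine sum_congr rfl ?_
    rintro ⟨a, b⟩ hx
    simp only [mem_filter, HasAntidiagonal.mem_antidiagonal] at hx
    refine gaussianNormCount_eq_of_odd _ (hx.2.mul ?_)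
    have := hx.2
    rw [Nat.odd_iff] at *
    omega
  rw [sum_antidiagonal_chiDivisorSum_mul hn] at h2
  zify at h1
  linarith

/-- The integer points `(x, y, z)` on the sphere of radius `n` with `gcd(n, x, y, z) = 1`. -/
noncomputable def primitiveSpherePoints (n : ℕ) : Finset (ℤ × ℤ × ℤ) :=
  {v ∈ spherePoints n | Int.gcd (Int.gcd (Int.gcd n v.1) v.2.1) v.2.2 = 1}

theorem dvd_gcd_four {g : ℕ} {w x y z : ℤ} :
    g ∣ Int.gcd (Int.gcd (Int.gcd w x) y) z ↔
      (g : ℤ) ∣ w ∧ (g : ℤ) ∣ x ∧ (g : ℤ) ∣ y ∧ (g : ℤ) ∣ z := by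
  rw [← Int.natCast_dvd_natCast, Int.dvd_coe_gcd_iff, Int.dvd_coe_gcd_iff, Int.dvd_coe_gcd_iff]
  tauto

theorem gcd_four_mul (g : ℕ) (w x y z : ℤ) :
    Int.gcd (Int.gcd (Int.gcd (g * w) (g * x)) (g * y)) (g * z) =
      g * Int.gcd (Int.gcd (Int.gcd w x) y) z := by
  rw [Int.gcd_mul_left, Int.natAbs_natCast, Nat.cast_mul, Int.gcd_mul_left, Int.natAbs_natCast,
    Nat.cast_mul, Int.gcd_mul_left, Int.natAbs_natCast]

theorem card_spherePoints_eq_sum {n : ℕ} (hn : n ≠ 0) :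
    #(spherePoints n) = ∑ p ∈ n.divisorsAntidiagonal, #(primitiveSpherePoints p.2) := by
  rw [← card_sigma]
  symm
  let gcd4 (v : ℤ × ℤ × ℤ) : ℕ := Int.gcd (Int.gcd (Int.gcd n v.1) v.2.1) v.2.2
  refine card_bij' (fun y _ => ((y.1.1 * y.2.1 : ℤ), (y.1.1 * y.2.2.1 : ℤ), (y.1.1 * y.2.2.2 : ℤ)))
    (fun v _ => ⟨(gcd4 v, n / gcd4 v), (v.1 / gcd4 v, v.2.1 / gcd4 v, v.2.2 / gcd4 v)⟩) ?_ ?_ ?_ ?_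
  · rintro ⟨⟨g, k⟩, ⟨x, y, z⟩⟩ h
    simp only [mem_sigma, Nat.mem_divisorsAntidiagonal, primitiveSpherePoints, mem_filter,
      mem_spherePoints] at h ⊢
    obtain ⟨⟨rfl, -⟩, h, -⟩ := h
    push_cast
    rw [mul_pow, mul_pow, mul_pow, mul_pow, ← h]
    ring
  · rintro ⟨x, y, z⟩ h
    rw [mem_spherePoints] at h
    obtain ⟨h1, h2, h3, h4⟩ := dvd_gcd_four.1 (dvd_refl (gcd4 (x, y, z)))
    have hpos : 0 < gcd4 (x, y, z) :=
      Nat.pos_of_dvd_of_pos (Int.natCast_dvd_natCast.1 h1) (Nat.pos_of_ne_zero hn)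
    have hdef : gcd4 (x, y, z) = Int.gcd (Int.gcd (Int.gcd n x) y) z := rfl
    generalize gcd4 (x, y, z) = g at *
    obtain ⟨k, rfl⟩ := Int.natCast_dvd_natCast.1 h1
    obtain ⟨x, rfl⟩ := h2
    obtain ⟨y, rfl⟩ := h3
    obtain ⟨z, rfl⟩ := h4
    have hg : (g : ℤ) ≠ 0 := by exact_mod_cast hpos.ne'
    simp only [mem_sigma, Nat.mem_divisorsAntidiagonal, primitiveSpherePoints, mem_filter,
      mem_spherePoints, Nat.mul_div_cancel_left _ hpos, Int.mul_ediv_cancel_left _ hg]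
    refine ⟨⟨trivial, hn⟩, ?_, ?_⟩
    · refine mul_left_cancel₀ (pow_ne_zero 2 hg) ?_
      push_cast at h
      linarith
    · rw [Nat.cast_mul, gcd_four_mul] at hdef
      exact Nat.eq_of_mul_eq_mul_left hpos (by linarith)
  · rintro ⟨⟨g, k⟩, ⟨x, y, z⟩⟩ h
    simp only [mem_sigma, Nat.mem_divisorsAntidiagonal, primitiveSpherePoints, mem_filter] at h
    obtain ⟨⟨rfl, -⟩, -, h⟩ := h
    have hpos : 0 < g := Nat.pos_of_ne_zero (left_ne_zero_of_mul hn)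
    have hg : (g : ℤ) ≠ 0 := by exact_mod_cast hpos.ne'
    have h5 : gcd4 ((g * x : ℤ), (g * y : ℤ), (g * z : ℤ)) = g := by
      simp only [gcd4]
      rw [Nat.cast_mul, gcd_four_mul, h, mul_one]
    simp only [h5, Nat.mul_div_cancel_left _ hpos, Int.mul_ediv_cancel_left _ hg]
  · rintro ⟨x, y, z⟩ h
    obtain ⟨h1, h2, h3, h4⟩ := dvd_gcd_four.1 (dvd_refl (gcd4 (x, y, z)))
    simp only [Prod.mk.injEq]
    exact ⟨Int.mul_ediv_cancel' h2, Int.mul_ediv_cancel' h3, Int.mul_ediv_cancel' h4⟩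

/-- The arithmetic function `n ↦ μ(n) χ₋₄(n)`. -/
def moebiusChi : ArithmeticFunction ℤ :=
  ⟨fun n => ArithmeticFunction.moebius n * χ₄ (n : ZMod 4), by simp⟩

theorem moebiusChi_apply (n : ℕ) :
    moebiusChi n = ArithmeticFunction.moebius n * χ₄ (n : ZMod 4) := rfl

/-- The number of primitive representations of an odd square as a sum of three squares. -/
theorem card_primitiveSpherePoints (n : ℕ) (hn : Odd n) :
    (#(primitiveSpherePoints n) : ℤ) =
      6 * ∑ p ∈ n.divisorsAntidiagonal, moebiusChi p.1 * (p.2 : ℤ) := by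
  let idZ : ArithmeticFunction ℤ := ⟨fun n => n, by simp⟩
  have hconv (n : ℕ) : (moebiusChi * idZ) n =
      ∑ p ∈ n.divisorsAntidiagonal, moebiusChi p.1 * (p.2 : ℤ) := by
    rw [ArithmeticFunction.mul_apply]
    rfl
  rw [← hconv]
  have key (m : ℕ) (hm : Odd m) : ∑ d ∈ m.divisors, (#(primitiveSpherePoints d) : ℤ) =
      ∑ d ∈ m.divisors, 6 * (moebiusChi * idZ) d := by
    rw [← mul_sum, ← ArithmeticFunction.coe_mul_zeta_apply, mul_assoc,
      ArithmeticFunction.mul_apply]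
    have h1 := card_spherePoints hm
    rw [card_spherePoints_eq_sum hm.pos.ne',
      Nat.sum_divisorsAntidiagonal' (fun _ d => #(primitiveSpherePoints d))] at h1
    push_cast at h1
    rw [h1]
    congr 1
    refine sum_congr rfl fun p _ => ?_
    rw [moebiusChi_apply, ArithmeticFunction.coe_mul_zeta_apply]
    rfl
  induction n using Nat.strong_induction_on with
  | _ n ih =>
    have h := key n hn
    rw [← Nat.insert_self_properDivisors hn.pos.ne', sum_insert Nat.self_notMem_properDivisors,
      sum_insert Nat.self_notMem_properDivisors] at h
    have h2 : ∑ d ∈ n.properDivisors, (#(primitiveSpherePoints d) : ℤ) =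
        ∑ d ∈ n.properDivisors, 6 * (moebiusChi * idZ) d := by
      refine sum_congr rfl fun d hd => ?_
      obtain ⟨hd1, hd2⟩ := Nat.mem_properDivisors.1 hd
      exact ih d hd2 (hn.of_dvd_nat hd1)
    linarith

theorem primitiveSpherePoints_eq_empty {n : ℕ} (hn : Even n) : primitiveSpherePoints n = ∅ := by
  rw [eq_empty_iff_forall_notMem]
  rintro ⟨x, y, z⟩ hv
  simp only [primitiveSpherePoints, mem_filter, mem_spherePoints] at hv
  obtain ⟨h, hg⟩ := hv
  have hn' : (n : ℤ) ^ 2 % 4 = 0 := by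
    obtain ⟨k, rfl⟩ := hn
    have : ((k + k : ℕ) : ℤ) ^ 2 = 4 * ((k : ℤ) ^ 2) := by push_cast; ring
    omega
  have hsq (t : ℤ) : (((2 : ℕ) : ℤ) ∣ t ∧ t ^ 2 % 4 = 0) ∨ (t ^ 2 % 4 = 1) := by
    rcases Int.even_or_odd' t with ⟨k, rfl | rfl⟩
    · exact Or.inl ⟨⟨k, rfl⟩, by rw [show (2 * k) ^ 2 = 4 * k ^ 2 by ring]; omega⟩
    · exact Or.inr (by rw [show (2 * k + 1) ^ 2 = 4 * (k ^ 2 + k) + 1 by ring]; omega)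
  have h2 : 2 ∣ Int.gcd (Int.gcd (Int.gcd n x) y) z := by
    rw [dvd_gcd_four]
    refine ⟨Int.natCast_dvd_natCast.2 hn.two_dvd, ?_⟩
    rcases hsq x with ⟨hx, hx'⟩ | hx' <;> rcases hsq y with ⟨hy, hy'⟩ | hy' <;>
      rcases hsq z with ⟨hz, hz'⟩ | hz' <;> first | (exfalso; omega) | exact ⟨hx, hy, hz⟩
  rw [hg] at h2
  norm_num at h2

/-- The identity function restricted to odd numbers. -/
def oddId : ArithmeticFunction ℤ := ⟨fun n => if Odd n then (n : ℤ) else 0, by simp⟩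

theorem oddId_apply (n : ℕ) : oddId n = if Odd n then (n : ℤ) else 0 := rfl

theorem moebiusChi_of_even {n : ℕ} (hn : Even n) : moebiusChi n = 0 := by
  rw [moebiusChi_apply, χ₄_nat_eq_if_mod_four, if_pos (Nat.even_iff.1 hn), mul_zero]

theorem card_primitiveSpherePoints_eq_mul (n : ℕ) :
    (#(primitiveSpherePoints n) : ℤ) = 6 * (moebiusChi * oddId) n := by
  rw [ArithmeticFunction.mul_apply]
  rcases Nat.even_or_odd n with hn | hn
  · rw [primitiveSpherePoints_eq_empty hn, card_empty, Nat.cast_zero, sum_eq_zero, mul_zero]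
    rintro ⟨d, k⟩ hp
    obtain ⟨rfl, -⟩ := Nat.mem_divisorsAntidiagonal.1 hp
    rcases Nat.even_mul.1 hn with h | h
    · rw [moebiusChi_of_even h, zero_mul]
    · rw [oddId_apply, if_neg (Nat.not_odd_iff_even.2 h), mul_zero]
  · rw [card_primitiveSpherePoints n hn]
    congr 1
    refine sum_congr rfl ?_
    rintro ⟨d, k⟩ hp
    obtain ⟨rfl, -⟩ := Nat.mem_divisorsAntidiagonal.1 hp
    rw [oddId_apply, if_pos (Nat.odd_mul.1 hn).2]

theorem sum_oddId (M : ℕ) : ∑ k ∈ Ioc 0 M, oddId k = (((M + 1) / 2 : ℕ) : ℤ) ^ 2 := by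
  induction M with
  | zero => simp
  | succ M ih =>
    rw [← insert_Ioc_right_eq_Ioc_add_one (Nat.zero_le M), sum_insert (by simp), ih, oddId_apply]
    rcases Nat.even_or_odd' M with ⟨c, rfl | rfl⟩
    · rw [if_pos ⟨c, rfl⟩, show (2 * c + 1) / 2 = c by omega,
        show (2 * c + 1 + 1) / 2 = c + 1 by omega]
      push_cast
      ring
    · rw [if_neg (by rw [Nat.not_odd_iff_even]; exact ⟨c + 1, by ring⟩),
        show (2 * c + 1 + 1) / 2 = c + 1 by omega, show (2 * c + 1 + 1 + 1) / 2 = c + 1 by omega]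
      ring

theorem sum_card_primitiveSpherePoints (N : ℕ) :
    ∑ n ∈ Ioc 0 N, (#(primitiveSpherePoints n) : ℤ) =
      6 * ∑ d ∈ Ioc 0 N, moebiusChi d * (((N / d + 1) / 2 : ℕ) : ℤ) ^ 2 := by
  simp only [card_primitiveSpherePoints_eq_mul, ← mul_sum,
    ArithmeticFunction.sum_Ioc_mul_eq_sum_sum, sum_oddId]

theorem abs_moebiusChi_le (n : ℕ) : |(moebiusChi n : ℝ)| ≤ 1 := by
  rw [← Int.cast_abs, moebiusChi_apply, abs_mul]
  have h1 : |ArithmeticFunction.moebius n| ≤ 1 := ArithmeticFunction.abs_moebius_le_one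
  have h2 : |χ₄ (n : ZMod 4)| ≤ 1 := by
    rw [χ₄_nat_eq_if_mod_four]
    split_ifs <;> simp
  exact_mod_cast mul_le_one₀ h1 (abs_nonneg _) h2

/-- The value `L(2, χ₋₄)`, i.e. Catalan's constant. -/
noncomputable def chiLTwo : ℝ := ∑' n : ℕ, (-1 : ℝ) ^ n / (2 * (n : ℝ) + 1) ^ 2

theorem summable_of_abs_le_one {f : ℕ → ℝ} (hf : ∀ n, |f n| ≤ 1) :
    Summable fun n : ℕ => f n / (n : ℝ) ^ 2 := by
  refine Summable.of_norm_bounded (Real.summable_one_div_nat_pow.2 one_lt_two) fun n => ?_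
  rw [norm_div, Real.norm_eq_abs, norm_pow, Real.norm_natCast]
  gcongr
  exact hf n

theorem tsum_chi_div_sq : ∑' n : ℕ, (χ₄ (n : ZMod 4) : ℝ) / (n : ℝ) ^ 2 = chiLTwo := by
  have hinj : Function.Injective fun n : ℕ => 2 * n + 1 := fun a b h => by simpa using h
  rw [chiLTwo, ← hinj.tsum_eq]
  · refine tsum_congr fun n => ?_
    rw [χ₄_eq_neg_one_pow (by omega), show (2 * n + 1) / 2 = n by omega]
    push_cast
    rfl
  · intro n hn
    rcases Nat.even_or_odd n with h | ⟨k, rfl⟩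
    · refine absurd ?_ hn
      change (χ₄ (n : ZMod 4) : ℝ) / (n : ℝ) ^ 2 = 0
      rw [χ₄_nat_eq_if_mod_four, if_pos (Nat.even_iff.1 h)]
      simp
    · exact ⟨k, rfl⟩

theorem LSeries_two_eq_ofReal_tsum (f : ℕ → ℝ) :
    LSeries (fun n => (f n : ℂ)) 2 = ((∑' n : ℕ, f n / (n : ℝ) ^ 2 : ℝ) : ℂ) := by
  rw [LSeries, Complex.ofReal_tsum]
  refine tsum_congr fun n => ?_
  rw [LSeries.term_of_ne_zero' two_ne_zero]
  push_cast
  rw [Complex.cpow_ofNat]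

theorem chiLTwo_mul_tsum :
    chiLTwo * ∑' n : ℕ, (moebiusChi n : ℝ) / (n : ℝ) ^ 2 = 1 := by
  have h := DirichletCharacter.LSeries.mul_mu_eq_one (χ₄.ringHomComp (Int.castRingHom ℂ))
    (s := 2) (by norm_num)
  rw [← tsum_chi_div_sq]
  have h1 := LSeries_two_eq_ofReal_tsum fun n => (χ₄ (n : ZMod 4) : ℝ)
  have h2 := LSeries_two_eq_ofReal_tsum fun n => (moebiusChi n : ℝ)
  rw [← Complex.ofReal_inj, Complex.ofReal_mul, ← h1, ← h2, Complex.ofReal_one, ← h]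
  congr 2
  ext n
  simp [moebiusChi_apply, mul_comm]

theorem chiLTwo_ne_zero : chiLTwo ≠ 0 := left_ne_zero_of_mul_eq_one chiLTwo_mul_tsum

theorem hasSum_moebiusChi :
    HasSum (fun n : ℕ => (moebiusChi n : ℝ) / (n : ℝ) ^ 2) (1 / chiLTwo) := by
  rw [← eq_one_div_of_mul_eq_one_right chiLTwo_mul_tsum]
  exact (summable_of_abs_le_one abs_moebiusChi_le).hasSum

theorem abs_sum_moebiusChi_sub_le (N : ℕ) :
    |∑ d ∈ Ioc 0 N, (moebiusChi d : ℝ) / (d : ℝ) ^ 2 - 1 / chiLTwo| ≤ 2 / (N + 1) := by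
  rw [abs_sub_comm]
  refine le_of_tendsto ((hasSum_moebiusChi.tendsto_sum_nat.sub_const _).abs) ?_
  filter_upwards [eventually_gt_atTop N] with M hM
  have h0 : ∑ d ∈ range M, (moebiusChi d : ℝ) / (d : ℝ) ^ 2 -
      ∑ d ∈ Ioc 0 N, (moebiusChi d : ℝ) / (d : ℝ) ^ 2 =
      ∑ d ∈ Ioo N M, (moebiusChi d : ℝ) / (d : ℝ) ^ 2 := by
    have hsub : Ioc 0 N ⊆ range M := fun d hd => by
      rw [mem_Ioc] at hd; rw [mem_range]; omega
    rw [← sum_sdiff hsub, add_sub_cancel_right]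
    symm
    refine sum_subset (fun d hd => ?_) fun d hd hd' => ?_
    · simp only [mem_Ioo, Finset.mem_sdiff, mem_Ioc, mem_range] at *; omega
    · simp only [mem_Ioo, Finset.mem_sdiff, mem_Ioc, mem_range] at *
      obtain rfl : d = 0 := by omega
      simp
  rw [h0]
  refine (abs_sum_le_sum_abs _ _).trans (le_trans (sum_le_sum fun d _ => ?_)
    (sum_Ioo_inv_sq_le (α := ℝ) N M))
  rw [abs_div, abs_of_nonneg (sq_nonneg (d : ℝ)), div_eq_mul_inv]
  exact mul_le_of_le_one_left (by positivity) (abs_moebiusChi_le d)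

theorem abs_half_floor_sq_sub_le {y : ℝ} (hy : 1 ≤ y) :
    |(((⌊y⌋₊ + 1) / 2 : ℕ) : ℝ) ^ 2 - y ^ 2 / 4| ≤ y := by
  have h1 := Nat.floor_le (zero_le_one.trans hy)
  have h2 := Nat.lt_floor_add_one y
  set M := ⌊y⌋₊
  set q := (M + 1) / 2 with hq
  have h3 : (M : ℝ) ≤ 2 * q := by exact_mod_cast (by omega : M ≤ 2 * q)
  have h4 : (2 * q : ℝ) ≤ M + 1 := by exact_mod_cast (by omega : 2 * q ≤ M + 1)
  rw [abs_le]
  constructor <;> nlinarith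

theorem abs_sum_card_primitiveSpherePoints_sub_le {x : ℝ} (hx : 1 ≤ x) :
    |∑ n ∈ Ioc 0 ⌊x⌋₊, (#(primitiveSpherePoints n) : ℝ) - 3 / (2 * chiLTwo) * x ^ 2| ≤
      6 * (x * (3 / 2 + Real.log x)) := by
  have hx0 : 0 < x := by linarith
  set N := ⌊x⌋₊ with hN
  have hsum : ∑ n ∈ Ioc 0 N, (#(primitiveSpherePoints n) : ℝ) =
      6 * ∑ d ∈ Ioc 0 N, (moebiusChi d : ℝ) * (((N / d + 1) / 2 : ℕ) : ℝ) ^ 2 := by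
    have h := congrArg (Int.cast (R := ℝ)) (sum_card_primitiveSpherePoints N)
    simpa only [Int.cast_sum, Int.cast_mul, Int.cast_natCast, Int.cast_pow, Int.cast_ofNat] using h
  have hfirst : |∑ d ∈ Ioc 0 N, (moebiusChi d : ℝ) *
      ((((N / d + 1) / 2 : ℕ) : ℝ) ^ 2 - (x / d) ^ 2 / 4)| ≤ x * (1 + Real.log x) := by
    calc _ ≤ ∑ d ∈ Ioc 0 N, x * (d : ℝ)⁻¹ := by
          refine (abs_sum_le_sum_abs _ _).trans (sum_le_sum fun d hd => ?_)
          obtain ⟨hd0, hdN⟩ := mem_Ioc.1 hd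
          have hd0' : (0 : ℝ) < d := by exact_mod_cast hd0
          have hdx : (d : ℝ) ≤ x := (Nat.le_floor_iff hx0.le).1 hdN
          rw [abs_mul, hN, ← Nat.floor_div_natCast, ← div_eq_mul_inv]
          refine le_trans (mul_le_of_le_one_left (abs_nonneg _) (abs_moebiusChi_le d)) ?_
          exact abs_half_floor_sq_sub_le ((one_le_div hd0').2 hdx)
      _ = x * (harmonic N : ℝ) := by
          rw [← mul_sum, harmonic_eq_sum_Icc]
          push_cast
          rfl
      _ ≤ x * (1 + Real.log x) := by
          gcongr
          exact harmonic_floor_le_one_add_log x hx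
  have hsecond : |x ^ 2 / 4 * (∑ d ∈ Ioc 0 N, (moebiusChi d : ℝ) / (d : ℝ) ^ 2 - 1 / chiLTwo)| ≤
      x / 2 := by
    rw [abs_mul, abs_of_nonneg (by positivity)]
    have h1 : (2 : ℝ) / (N + 1) ≤ 2 / x := by
      gcongr
      exact (Nat.lt_floor_add_one x).le
    calc _ ≤ x ^ 2 / 4 * (2 / x) := by
          gcongr
          exact (abs_sum_moebiusChi_sub_le N).trans h1
      _ = x / 2 := by field_simp; norm_num
  have hsplit : ∑ n ∈ Ioc 0 N, (#(primitiveSpherePoints n) : ℝ) - 3 / (2 * chiLTwo) * x ^ 2 =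
      6 * (∑ d ∈ Ioc 0 N, (moebiusChi d : ℝ) *
        ((((N / d + 1) / 2 : ℕ) : ℝ) ^ 2 - (x / d) ^ 2 / 4) +
      x ^ 2 / 4 * (∑ d ∈ Ioc 0 N, (moebiusChi d : ℝ) / (d : ℝ) ^ 2 - 1 / chiLTwo)) := by
    rw [hsum, mul_sub (x ^ 2 / 4), mul_sum (a := x ^ 2 / 4)]
    simp only [mul_sub, sum_sub_distrib]
    have h1 : ∑ d ∈ Ioc 0 N, (moebiusChi d : ℝ) * ((x / d) ^ 2 / 4) =
        ∑ d ∈ Ioc 0 N, x ^ 2 / 4 * ((moebiusChi d : ℝ) / (d : ℝ) ^ 2) :=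
      sum_congr rfl fun d _ => by rw [div_pow]; ring
    rw [h1]
    have := chiLTwo_ne_zero
    field_simp
    ring
  rw [hsplit, abs_mul, abs_of_pos (by norm_num : (0 : ℝ) < 6)]
  refine mul_le_mul_of_nonneg_left ((abs_add_le _ _).trans ?_) (by norm_num)
  linarith

/-- The primitive Lorentz quadruples with first coordinate of absolute value at most `N`. -/
noncomputable def primitiveLorentzQuadruples (N : ℕ) : Finset (ℤ × ℤ × ℤ × ℤ) :=
  (Ioc 0 N).biUnion fun n =>
    (primitiveSpherePoints n).image (fun u => ((n : ℤ), u)) ∪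
      (primitiveSpherePoints n).image (fun u => (-(n : ℤ), u))

theorem card_primitiveLorentzQuadruples (N : ℕ) :
    #(primitiveLorentzQuadruples N) = 2 * ∑ n ∈ Ioc 0 N, #(primitiveSpherePoints n) := by
  rw [primitiveLorentzQuadruples, card_biUnion, mul_sum]
  · refine sum_congr rfl fun n hn => ?_
    rw [card_union_of_disjoint, card_image_of_injective _ (Prod.mk_right_injective _),
      card_image_of_injective _ (Prod.mk_right_injective _), two_mul]
    rw [disjoint_left]
    intro v h1 h2
    obtain ⟨u, -, rfl⟩ := mem_image.1 h1
    obtain ⟨u', -, h⟩ := mem_image.1 h2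
    have h3 := congrArg Prod.fst h
    simp only at h3
    have := (mem_Ioc.1 hn).1
    omega
  · intro n hn k hk hnk
    simp only [disjoint_left, mem_union, mem_image]
    rintro v (⟨u, -, rfl⟩ | ⟨u, -, rfl⟩) (⟨u', -, h⟩ | ⟨u', -, h⟩) <;>
    · have h3 := congrArg Prod.fst h
      simp only at h3
      have := (mem_Ioc.1 hn).1
      have := (mem_Ioc.1 hk).1
      omega

theorem mem_primitiveLorentzQuadruples {N : ℕ} {v : ℤ × ℤ × ℤ × ℤ} :
    v ∈ primitiveLorentzQuadruples N ↔ v.1 ^ 2 = v.2.1 ^ 2 + v.2.2.1 ^ 2 + v.2.2.2 ^ 2 ∧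
      Int.gcd (Int.gcd (Int.gcd v.1 v.2.1) v.2.2.1) v.2.2.2 = 1 ∧ v.1.natAbs ≤ N := by
  obtain ⟨w, x, y, z⟩ := v
  simp only [primitiveLorentzQuadruples, mem_biUnion, mem_union, mem_image, mem_Ioc,
    Prod.mk.injEq, primitiveSpherePoints, mem_filter]
  constructor
  · rintro ⟨n, ⟨hn, hnN⟩, ⟨⟨x', y', z'⟩, ⟨hs, hg⟩, rfl, h⟩ | ⟨⟨x', y', z'⟩, ⟨hs, hg⟩, rfl, h⟩⟩ <;>
    · simp only [Prod.mk.injEq] at h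
      obtain ⟨rfl, rfl, rfl⟩ := h
      rw [mem_spherePoints] at hs
      refine ⟨by linarith, ?_, by omega⟩
      simpa using hg
  · rintro ⟨hs, hg, hN⟩
    have hw : w ≠ 0 := by
      rintro rfl
      have hx : x = 0 := by nlinarith
      have hy : y = 0 := by nlinarith
      have hz : z = 0 := by nlinarith
      subst hx hy hz
      simp at hg
    refine ⟨w.natAbs, ⟨by omega, hN⟩, ?_⟩
    rcases Int.natAbs_eq w with h | h
    · refine Or.inl ⟨(x, y, z), ⟨?_, ?_⟩, h.symm, rfl⟩
      · rw [mem_spherePoints, Int.natAbs_sq, hs]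
      · rw [← h]; exact hg
    · refine Or.inr ⟨(x, y, z), ⟨?_, ?_⟩, h.symm, rfl⟩
      · rw [mem_spherePoints, Int.natAbs_sq, hs]
      · rw [h, Int.neg_gcd] at hg; exact hg

theorem card_primitive_lorentz_quadruples {T : ℝ} (hT : 0 ≤ T) :
    Nat.card {v : ℤ × ℤ × ℤ × ℤ //
        v.1 ^ 2 = v.2.1 ^ 2 + v.2.2.1 ^ 2 + v.2.2.2 ^ 2 ∧
        Int.gcd (Int.gcd (Int.gcd v.1 v.2.1) v.2.2.1) v.2.2.2 = 1 ∧
        Real.sqrt (((v.1 ^ 2 + v.2.1 ^ 2 + v.2.2.1 ^ 2 + v.2.2.2 ^ 2 : ℤ) : ℝ)) ≤ T} =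
      2 * ∑ n ∈ Ioc 0 ⌊T / Real.sqrt 2⌋₊, #(primitiveSpherePoints n) := by
  rw [← card_primitiveLorentzQuadruples, ← Nat.card_eq_finsetCard]
  refine Nat.card_congr (Equiv.subtypeEquivRight fun v => ?_)
  rw [mem_primitiveLorentzQuadruples]
  refine and_congr_right fun hs => and_congr_right fun _ => ?_
  have h2 : (0 : ℝ) < Real.sqrt 2 := by positivity
  have hnorm : ((v.1 ^ 2 + v.2.1 ^ 2 + v.2.2.1 ^ 2 + v.2.2.2 ^ 2 : ℤ) : ℝ) =
      2 * ((v.1.natAbs : ℕ) : ℝ) ^ 2 := by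
    have h3 : v.1 ^ 2 + v.2.1 ^ 2 + v.2.2.1 ^ 2 + v.2.2.2 ^ 2 = 2 * (v.1.natAbs : ℤ) ^ 2 := by
      rw [Int.natAbs_sq]
      linarith
    rw [h3]
    simp only [Int.cast_mul, Int.cast_pow, Int.cast_natCast, Int.cast_ofNat]
  rw [hnorm, Real.sqrt_mul zero_le_two, Real.sqrt_sq (Nat.cast_nonneg _),
    Nat.le_floor_iff (by positivity), le_div_iff₀' h2]

end PrimitiveLorentz

/-- **Asymptotics for primitive integer Lorentz quadruples.**
The number `N*_L(T)` of integer quadruples `(W,X,Y,Z)` with `W² = X² + Y² + Z²`,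
`gcd(W,X,Y,Z) = 1`, and Euclidean norm at most `T` satisfies
`N*_L(T) = (3 / (2 L(2,χ₋₄))) T² + O(T (log T)²)` as `T → ∞`. -/
theorem primitive_lorentz_quadruple_count_asymptotic :
    (fun T : ℝ =>
        (Nat.card {v : ℤ × ℤ × ℤ × ℤ //
            v.1 ^ 2 = v.2.1 ^ 2 + v.2.2.1 ^ 2 + v.2.2.2 ^ 2 ∧
            Int.gcd (Int.gcd (Int.gcd v.1 v.2.1) v.2.2.1) v.2.2.2 = 1 ∧
            Real.sqrt (((v.1 ^ 2 + v.2.1 ^ 2 + v.2.2.1 ^ 2 + v.2.2.2 ^ 2 : ℤ) : ℝ)) ≤ T} : ℝ) -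
          3 / (2 * ∑' n : ℕ, (-1 : ℝ) ^ n / (2 * (n : ℝ) + 1) ^ 2) * T ^ 2)
      =O[atTop] fun T => T * Real.log T ^ 2 := by
  refine Asymptotics.IsBigO.of_bound 30 ?_
  filter_upwards [eventually_ge_atTop (Real.exp 1), eventually_ge_atTop 2] with T hT hT2
  have hlog : 1 ≤ Real.log T := (Real.le_log_iff_exp_le (by linarith)).2 hT
  have hs1 : (1 : ℝ) ≤ Real.sqrt 2 := Real.one_le_sqrt.2 one_le_two
  have hs2 : Real.sqrt 2 ≤ 2 := by rw [Real.sqrt_le_left zero_le_two]; norm_num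
  have hsq : Real.sqrt 2 ^ 2 = 2 := Real.sq_sqrt zero_le_two
  rw [PrimitiveLorentz.card_primitive_lorentz_quadruples (by linarith)]
  set x := T / Real.sqrt 2 with hx
  have hx1 : 1 ≤ x := (one_le_div (by linarith)).2 (hs2.trans hT2)
  have hxT : x ≤ T := div_le_self (by linarith) hs1
  have hxsq : x ^ 2 = T ^ 2 / 2 := by rw [hx, div_pow, hsq]
  have hlogx : Real.log x ≤ Real.log T := Real.log_le_log (by linarith) hxT
  have hlogx0 : 0 ≤ Real.log x := Real.log_nonneg hx1
  have key := PrimitiveLorentz.abs_sum_card_primitiveSpherePoints_sub_le hx1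
  rw [PrimitiveLorentz.chiLTwo, hxsq] at key
  have hT0 : 0 ≤ T := by linarith
  rw [Real.norm_eq_abs, Real.norm_of_nonneg (by positivity)]
  push_cast
  set L := ∑' n : ℕ, (-1 : ℝ) ^ n / (2 * (n : ℝ) + 1) ^ 2
  set S := ∑ n ∈ Finset.Ioc 0 ⌊x⌋₊, ((PrimitiveLorentz.primitiveSpherePoints n).card : ℝ)
  calc |2 * S - 3 / (2 * L) * T ^ 2| = 2 * |S - 3 / (2 * L) * (T ^ 2 / 2)| := by
        rw [show 2 * S - 3 / (2 * L) * T ^ 2 = 2 * (S - 3 / (2 * L) * (T ^ 2 / 2)) by ring,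
          abs_mul, abs_two]
    _ ≤ 2 * (6 * (x * (3 / 2 + Real.log x))) := by gcongr
    _ ≤ 2 * (6 * (T * (3 / 2 * Real.log T ^ 2 + Real.log T ^ 2))) := by
        gcongr
        · nlinarith
        · nlinarith
    _ = 30 * (T * Real.log T ^ 2) := by ring
end

section
/- Let J₀ be the 4×4 matrix (1/2)·[[1,1,1,1],[1,1,−1,−1],[1,−1,1,−1],[1,−1,−1,1]]. The map (w,x,y,z)ᵀ ↦ J₀·(w,x,y,z)ᵀ is a bijection from the set of real quadruples satisfying the Descartes equation 2(w²+x²+y²+z²) = (w+x+y+z)² onto the set of real quadruples (W,X,Y,Z) satisfying −W²+X²+Y²+Z² = 0, and this bijection preserves the Euclidean norm. Moreover it restricts to a bijection from integer Descartes quadruples onto integer Lorentz quadruples, and further to a bijection from primitive integer Descartes quadruples onto primitive integer Lorentz quadruples. -/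
/-- The Descartes-to-Lorentz matrix `J₀`. -/
noncomputable def descartesLorentz : Matrix (Fin 4) (Fin 4) ℝ :=
  (1 / 2 : ℝ) • !![1, 1, 1, 1; 1, 1, -1, -1; 1, -1, 1, -1; 1, -1, -1, 1]

namespace descartesLorentz

theorem mulVec_eq (v : Fin 4 → ℝ) : descartesLorentz.mulVec v =
    ![(v 0 + v 1 + v 2 + v 3) / 2, (v 0 + v 1 - v 2 - v 3) / 2,
      (v 0 - v 1 + v 2 - v 3) / 2, (v 0 - v 1 - v 2 + v 3) / 2] := by
  ext i
  fin_cases i <;>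
    simp [descartesLorentz, Matrix.mulVec, dotProduct, Fin.sum_univ_four] <;> ring

theorem mulVec_mulVec (v : Fin 4 → ℝ) :
    descartesLorentz.mulVec (descartesLorentz.mulVec v) = v := by
  ext i
  fin_cases i <;> simp [mulVec_eq] <;> ring

/-- Every integer vector in `A` has even coordinate sum. -/
def EvenSum (A : Set (Fin 4 → ℝ)) : Prop :=
  ∀ w : Fin 4 → ℤ, (fun i => (w i : ℝ)) ∈ A → Even (w 0 + w 1 + w 2 + w 3)

theorem exists_int_mulVec {w : Fin 4 → ℤ} (hw : Even (w 0 + w 1 + w 2 + w 3)) :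
    ∃ u : Fin 4 → ℤ, descartesLorentz.mulVec (fun i => (w i : ℝ)) = fun i => (u i : ℝ) := by
  obtain ⟨s, hs⟩ := hw
  have hs' : (w 0 + w 1 + w 2 + w 3 : ℝ) = s + s := mod_cast hs
  refine ⟨![s, w 0 + w 1 - s, w 0 + w 2 - s, w 0 + w 3 - s], ?_⟩
  ext i
  fin_cases i <;> simp [mulVec_eq] <;> linarith

theorem bijOn {A B : Set (Fin 4 → ℝ)} (hAB : Set.MapsTo descartesLorentz.mulVec A B)
    (hBA : Set.MapsTo descartesLorentz.mulVec B A) :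
    Set.BijOn descartesLorentz.mulVec A B :=
  Set.InvOn.bijOn ⟨fun v _ => mulVec_mulVec v, fun v _ => mulVec_mulVec v⟩ hAB hBA

theorem mapsTo_int {A B : Set (Fin 4 → ℝ)} (hA : EvenSum A)
    (hAB : Set.MapsTo descartesLorentz.mulVec A B) :
    Set.MapsTo descartesLorentz.mulVec {v ∈ A | ∀ i, ∃ m : ℤ, v i = (m : ℝ)}
      {v ∈ B | ∀ i, ∃ m : ℤ, v i = (m : ℝ)} := by
  rintro v ⟨hv, hint⟩
  choose w hw using hint
  obtain rfl : v = fun i => (w i : ℝ) := funext hw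
  obtain ⟨u, hu⟩ := exists_int_mulVec (hA w hv)
  exact ⟨hAB hv, fun i => ⟨u i, congrFun hu i⟩⟩

theorem mapsTo_primitive {A B : Set (Fin 4 → ℝ)} (hA : EvenSum A) (hB : EvenSum B)
    (hAB : Set.MapsTo descartesLorentz.mulVec A B)
    (hsmul : ∀ c : ℝ, ∀ v ∈ B, c • v ∈ B) :
    Set.MapsTo descartesLorentz.mulVec
      {v ∈ A | ∃ w : Fin 4 → ℤ, (∀ i, v i = (w i : ℝ)) ∧ Finset.univ.gcd w = 1}
      {v ∈ B | ∃ w : Fin 4 → ℤ, (∀ i, v i = (w i : ℝ)) ∧ Finset.univ.gcd w = 1} := by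
  rintro v ⟨hv, w, hw, hgcd⟩
  obtain rfl : v = fun i => (w i : ℝ) := funext hw
  obtain ⟨u, hu⟩ := exists_int_mulVec (hA w hv)
  have huB := hAB hv
  refine ⟨huB, u, fun i => congrFun hu i, ?_⟩
  rw [hu] at huB
  have hinv : descartesLorentz.mulVec (fun i => (u i : ℝ)) = fun i => (w i : ℝ) := by
    rw [← hu, mulVec_mulVec]
  set g := Finset.univ.gcd u
  have hdvd : ∀ i, g ∣ u i := fun i => Finset.gcd_dvd (Finset.mem_univ i)
  choose t ht using hdvd
  have hut : (fun i => (u i : ℝ)) = (g : ℝ) • fun i => (t i : ℝ) := by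
    ext i
    simp [ht i]
  have hgw : ∀ i, g ∣ w i := by
    by_cases hg0 : (g : ℝ) = 0
    · intro i
      have := congrFun hinv i
      rw [hut, hg0, zero_smul, Matrix.mulVec_zero, Pi.zero_apply] at this
      have hwi : w i = 0 := by exact_mod_cast this.symm
      simp [hwi]
    · have htB := hsmul (g : ℝ)⁻¹ _ huB
      rw [hut, inv_smul_smul₀ hg0] at htB
      obtain ⟨s, hs⟩ := exists_int_mulVec (hB t htB)
      intro i
      have := congrFun hinv i
      rw [hut, Matrix.mulVec_smul, hs, Pi.smul_apply, smul_eq_mul] at this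
      exact ⟨s i, by exact_mod_cast this.symm⟩
  have hunit : IsUnit g := isUnit_of_dvd_one (hgcd ▸ Finset.dvd_gcd fun i _ => hgw i)
  exact Finset.normalize_gcd.symm.trans (normalize_eq_one.mpr hunit)

end descartesLorentz


/-- **The map `J₀` is a norm-preserving bijection from Descartes quadruples to
Lorentz quadruples**, restricting to bijections on integer quadruples and on
primitive integer quadruples. -/
theorem J0_bijection_descartes_lorentz :
    let J₀ : Matrix (Fin 4) (Fin 4) ℝ :=
      (1 / 2 : ℝ) • !![1, 1, 1, 1; 1, 1, -1, -1; 1, -1, 1, -1; 1, -1, -1, 1]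
    let D : Set (Fin 4 → ℝ) :=
      {v | 2 * (v 0 ^ 2 + v 1 ^ 2 + v 2 ^ 2 + v 3 ^ 2) = (v 0 + v 1 + v 2 + v 3) ^ 2}
    let L : Set (Fin 4 → ℝ) :=
      {v | -v 0 ^ 2 + v 1 ^ 2 + v 2 ^ 2 + v 3 ^ 2 = 0}
    let isInt : (Fin 4 → ℝ) → Prop := fun v => ∀ i, ∃ m : ℤ, v i = (m : ℝ)
    let isPrim : (Fin 4 → ℝ) → Prop :=
      fun v => ∃ w : Fin 4 → ℤ, (∀ i, v i = (w i : ℝ)) ∧ Finset.univ.gcd w = 1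
    Set.BijOn J₀.mulVec D L ∧
    (∀ v : Fin 4 → ℝ, ∑ i, (J₀.mulVec v) i ^ 2 = ∑ i, v i ^ 2) ∧
    Set.BijOn J₀.mulVec {v ∈ D | isInt v} {v ∈ L | isInt v} ∧
    Set.BijOn J₀.mulVec {v ∈ D | isPrim v} {v ∈ L | isPrim v} := by
  intro J₀ D L isInt isPrim
  have hDL : Set.MapsTo descartesLorentz.mulVec D L := by
    intro v hv
    simp only [D, L, Set.mem_ofPred_eq, descartesLorentz.mulVec_eq] at hv ⊢
    simp
    linarith
  have hLD : Set.MapsTo descartesLorentz.mulVec L D := by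
    intro v hv
    simp only [D, L, Set.mem_ofPred_eq, descartesLorentz.mulVec_eq] at hv ⊢
    simp
    linarith
  have hD : descartesLorentz.EvenSum D := by
    intro w hw
    have h : 2 * (w 0 ^ 2 + w 1 ^ 2 + w 2 ^ 2 + w 3 ^ 2) = (w 0 + w 1 + w 2 + w 3) ^ 2 := by
      simp only [D, Set.mem_ofPred_eq] at hw
      exact_mod_cast hw
    have : Even ((w 0 + w 1 + w 2 + w 3) ^ 2) := h ▸ even_two_mul _
    exact (Int.even_pow.mp this).1
  have hL : descartesLorentz.EvenSum L := by
    intro w hw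
    have h : -w 0 ^ 2 + w 1 ^ 2 + w 2 ^ 2 + w 3 ^ 2 = 0 := by
      simp only [L, Set.mem_ofPred_eq] at hw
      exact_mod_cast hw
    have : Even (-w 0 ^ 2 + w 1 ^ 2 + w 2 ^ 2 + w 3 ^ 2) := h ▸ Even.zero
    simpa [Int.even_add, Int.even_pow] using this
  have hDsmul : ∀ c : ℝ, ∀ v ∈ D, c • v ∈ D := by
    intro c v hv
    simp only [D, Set.mem_ofPred_eq, Pi.smul_apply, smul_eq_mul] at hv ⊢
    linear_combination c ^ 2 * hv
  have hLsmul : ∀ c : ℝ, ∀ v ∈ L, c • v ∈ L := by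
    intro c v hv
    simp only [L, Set.mem_ofPred_eq, Pi.smul_apply, smul_eq_mul] at hv ⊢
    linear_combination c ^ 2 * hv
  refine ⟨descartesLorentz.bijOn hDL hLD, fun v => ?_,
    descartesLorentz.bijOn (descartesLorentz.mapsTo_int hD hDL)
      (descartesLorentz.mapsTo_int hL hLD),
    descartesLorentz.bijOn (descartesLorentz.mapsTo_primitive hD hL hDL hLsmul)
      (descartesLorentz.mapsTo_primitive hL hD hLD hDsmul)⟩
  change ∑ i, (descartesLorentz.mulVec v) i ^ 2 = _
  simp [descartesLorentz.mulVec_eq, Fin.sum_univ_four]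
  ring
end

section
/- Let (a,b,c,d) ∈ ℝ⁴ satisfy the Descartes equation 2(a²+b²+c²+d²) = (a+b+c+d)², with a ≤ b ≤ c ≤ d and a+b+c+d > 0. Then a+b ≥ 0, and equality a+b = 0 holds only if a = b = 0 and c = d. In particular b ≥ 0. -/
/-- If `(a,b,c,d)` is a real Descartes quadruple with `a ≤ b ≤ c ≤ d` and
`a+b+c+d > 0`, then `a+b ≥ 0`, with equality only if `a = b = 0` and `c = d`;
in particular `b ≥ 0`. -/
theorem descartes_ab_nonneg (a b c d : ℝ)
    (hD : 2 * (a ^ 2 + b ^ 2 + c ^ 2 + d ^ 2) = (a + b + c + d) ^ 2)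
    (hab : a ≤ b) (hbc : b ≤ c) (hcd : c ≤ d) (hsum : 0 < a + b + c + d) :
    0 ≤ a + b ∧ (a + b = 0 → a = 0 ∧ b = 0 ∧ c = d) ∧ 0 ≤ b := by
  have key : (a - b) ^ 2 + (c - d) ^ 2 = 2 * ((a + b) * (c + d)) := by linarith
  have hs : 0 ≤ a + b := by
    by_contra! h
    have hneg : (a + b) * (c + d) < 0 := mul_neg_of_neg_of_pos h (by linarith)
    linarith [sq_nonneg (a - b), sq_nonneg (c - d)]
  refine ⟨hs, fun h => ?_, by linarith⟩
  rw [h, zero_mul, mul_zero] at key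
  have h₁ : a - b = 0 := by
    apply sq_eq_zero_iff.mp
    linarith [sq_nonneg (a - b), sq_nonneg (c - d)]
  have h₂ : c - d = 0 := by
    apply sq_eq_zero_iff.mp
    linarith [sq_nonneg (a - b), sq_nonneg (c - d)]
  exact ⟨by linarith, by linarith, by linarith⟩
end

section
/- Let (a,b,c,d) ∈ ℝ⁴ satisfy the Descartes equation 2(a²+b²+c²+d²) = (a+b+c+d)², with 0 ≤ a ≤ b ≤ c ≤ d, and set d' = 2(a+b+c) − d. Then d' ≤ c ≤ d, and if d' = c then c = d = d'. -/
/-- If `(a,b,c,d)` is a real Descartes quadruple with `0 ≤ a ≤ b ≤ c ≤ d` and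
`d' = 2(a+b+c) - d`, then `d' ≤ c ≤ d`, and if `d' = c` then `c = d = d'`. -/
theorem descartes_dprime_le (a b c d : ℝ)
    (hD : 2 * (a ^ 2 + b ^ 2 + c ^ 2 + d ^ 2) = (a + b + c + d) ^ 2)
    (ha : 0 ≤ a) (hab : a ≤ b) (hbc : b ≤ c) (hcd : c ≤ d) :
    2 * (a + b + c) - d ≤ c ∧ c ≤ d ∧
      (2 * (a + b + c) - d = c → c = d ∧ d = 2 * (a + b + c) - d) := by
  have key : 3 * (c * (a + b)) ≤ (d - c) * (c - (2 * (a + b + c) - d)) := by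
    nlinarith [mul_nonneg ha (sub_nonneg.2 hab), mul_nonneg ha (ha.trans hab),
      mul_nonneg (sub_nonneg.2 hbc) (ha.trans hab),
      mul_nonneg ha ((ha.trans hab).trans hbc)]
  -- If `c` is a root of the quadratic with roots `d` and `d'`, then `a` and `b` vanish.
  have hzero (h : (d - c) * (c - (2 * (a + b + c) - d)) = 0) : a = 0 ∧ b = 0 := by
    have hb : b = 0 := by
      have : b ^ 2 ≤ 0 := by
        nlinarith [mul_nonneg (sub_nonneg.2 hbc) (ha.trans hab),
          mul_nonneg ha ((ha.trans hab).trans hbc)]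
      exact pow_eq_zero_iff two_ne_zero |>.1 (le_antisymm this (sq_nonneg b))
    exact ⟨le_antisymm (hb ▸ hab) ha, hb⟩
  refine ⟨?_, hcd, fun h => ?_⟩
  · rcases hcd.eq_or_lt with h | h
    · obtain ⟨h₁, h₂⟩ := hzero (by rw [← h]; ring)
      linarith
    · have hnonneg : 0 ≤ (d - c) * (c - (2 * (a + b + c) - d)) :=
        le_trans (by have := ha.trans hab; have := this.trans hbc; positivity) key
      linarith [nonneg_of_mul_nonneg_right hnonneg (sub_pos.2 h)]
  · obtain ⟨h₁, h₂⟩ := hzero (by rw [h]; ring)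
    constructor <;> linarith
end

section
/- Let v ∈ ℤ⁴ satisfy the Descartes equation 2(a²+b²+c²+d²) = (a+b+c+d)² with positive entry-sum. Then there exists a finite product M of the matrices S₁, S₂, S₃, S₄ such that the entries of M·v, when sorted into increasing order, form a root quadruple. -/
/-- The generators `S₁, S₂, S₃, S₄` of the Apollonian group.  `S i` agrees with
the identity matrix except in row `i`, which has `-1` on the diagonal and `2`
in the other positions. -/
def S (i : Fin 4) : Matrix (Fin 4) (Fin 4) ℤ :=
  Matrix.of fun k l => if k = i then (if l = i then -1 else 2) else (if k = l then 1 else 0)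

theorem S_mulVec (i : Fin 4) (v : Fin 4 → ℤ) :
    (S i).mulVec v = Function.update v i (2 * ∑ j, v j - 3 * v i) := by
  funext k
  fin_cases i <;> fin_cases k <;>
    simp [S, Matrix.mulVec, dotProduct, Fin.sum_univ_four, Function.update] <;> ring

theorem sum_S_mulVec (i : Fin 4) (v : Fin 4 → ℤ) :
    ∑ j, (S i).mulVec v j = 3 * ∑ j, v j - 4 * v i := by
  rw [S_mulVec]
  fin_cases i <;> simp [Fin.sum_univ_four, Function.update] <;> ring

theorem sum_sq_S_mulVec (i : Fin 4) (v : Fin 4 → ℤ) :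
    ∑ j, (S i).mulVec v j ^ 2 = ∑ j, v j ^ 2 - v i ^ 2 + (2 * ∑ j, v j - 3 * v i) ^ 2 := by
  rw [S_mulVec]
  fin_cases i <;> simp [Fin.sum_univ_four, Function.update] <;> ring

theorem descartes_S_mulVec {v : Fin 4 → ℤ} (hD : 2 * ∑ j, v j ^ 2 = (∑ j, v j) ^ 2)
    (i : Fin 4) :
    2 * ∑ j, (S i).mulVec v j ^ 2 = (∑ j, (S i).mulVec v j) ^ 2 := by
  rw [sum_S_mulVec, sum_sq_S_mulVec]
  linear_combination hD

/-- The reflections preserve positivity of the sum of a Descartes quadruple. -/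
theorem sum_S_mulVec_pos {v : Fin 4 → ℤ} (hD : 2 * ∑ j, v j ^ 2 = (∑ j, v j) ^ 2)
    (hsum : 0 < ∑ j, v j) (i : Fin 4) : 0 < ∑ j, (S i).mulVec v j := by
  rw [sum_S_mulVec]
  have hi : v i ^ 2 ≤ ∑ j, v j ^ 2 :=
    Finset.single_le_sum (fun j _ => sq_nonneg (v j)) (Finset.mem_univ i)
  by_contra! h
  nlinarith [mul_nonneg hsum.le (neg_nonneg.mpr h), sq_nonneg (∑ j, v j - v i)]

/-- A sorted Descartes quadruple whose largest entry is at most the sum of the other three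
is a root quadruple. -/
theorem root_of_sorted {a b c d : ℤ}
    (hD : 2 * (a ^ 2 + b ^ 2 + c ^ 2 + d ^ 2) = (a + b + c + d) ^ 2)
    (hab : a ≤ b) (hbc : b ≤ c) (hcd : c ≤ d) (hd : d ≤ a + b + c) :
    a ≤ 0 ∧ 0 ≤ b := by
  constructor
  · by_contra! ha
    have h : (a + b + c - d) ^ 2 = 4 * (a * b + b * c + c * a) := by linear_combination hD
    have h' : (a + b + c - d) ^ 2 ≤ (a + b) ^ 2 := pow_le_pow_left₀ (by linarith) (by linarith) 2
    have hb : 0 < b := ha.trans_le hab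
    nlinarith [mul_pos ha hb, mul_le_mul_of_nonneg_left hbc hb.le,
      mul_le_mul_of_nonneg_left (hab.trans hbc) ha.le]
  · linarith

/-- **Existence of a root quadruple.** Every integer Descartes quadruple with
positive entry-sum can be transformed, by a finite product of the matrices
`S₁, S₂, S₃, S₄` followed by sorting the entries into increasing order, into a
root quadruple. -/
theorem exists_root_quadruple (v : Fin 4 → ℤ)
    (hD : 2 * (v 0 ^ 2 + v 1 ^ 2 + v 2 ^ 2 + v 3 ^ 2) = (v 0 + v 1 + v 2 + v 3) ^ 2)
    (hsum : 0 < v 0 + v 1 + v 2 + v 3) :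
    ∃ (l : List (Fin 4)) (σ : Equiv.Perm (Fin 4)),
      let w : Fin 4 → ℤ := ((l.map S).prod.mulVec v) ∘ σ
      (w 0 ≤ w 1 ∧ w 1 ≤ w 2 ∧ w 2 ≤ w 3) ∧
      w 0 ≤ 0 ∧ 0 ≤ w 1 ∧ w 3 ≤ w 0 + w 1 + w 2 := by
  obtain ⟨n, hn⟩ : ∃ n : ℕ, (∑ j, v j).toNat = n := ⟨_, rfl⟩
  simp only [← Fin.sum_univ_four (fun j => v j ^ 2), ← Fin.sum_univ_four v] at hD hsum
  induction n using Nat.strong_induction_on generalizing v with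
  | _ n ih =>
    let σ := Tuple.sort v
    have hσ : Monotone (v ∘ σ) := Tuple.monotone_sort v
    have h_sum : ∑ j, v j = v (σ 0) + v (σ 1) + v (σ 2) + v (σ 3) := by
      rw [← Equiv.sum_comp σ v, Fin.sum_univ_four]
    have h_sq : ∑ j, v j ^ 2 = v (σ 0) ^ 2 + v (σ 1) ^ 2 + v (σ 2) ^ 2 + v (σ 3) ^ 2 := by
      rw [← Equiv.sum_comp σ (fun j => v j ^ 2), Fin.sum_univ_four]
    by_cases hd : v (σ 3) ≤ v (σ 0) + v (σ 1) + v (σ 2)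
    · have h01 : v (σ 0) ≤ v (σ 1) := hσ (by decide)
      have h12 : v (σ 1) ≤ v (σ 2) := hσ (by decide)
      have h23 : v (σ 2) ≤ v (σ 3) := hσ (by decide)
      rw [h_sq, h_sum] at hD
      obtain ⟨h0, h1⟩ := root_of_sorted hD h01 h12 h23 hd
      refine ⟨[], σ, ?_⟩
      simpa using ⟨⟨h01, h12, h23⟩, h0, h1, hd⟩
    · have hpos := sum_S_mulVec_pos hD hsum (σ 3)
      have hlt : ∑ j, (S (σ 3)).mulVec v j < ∑ j, v j := by
        rw [sum_S_mulVec]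
        linarith
      obtain ⟨l, τ, h⟩ := ih _ (by omega) _ rfl (descartes_S_mulVec hD (σ 3)) hpos
      refine ⟨l ++ [σ 3], τ, ?_⟩
      simpa [Matrix.mulVec_mulVec] using h
end

section
/- The map (a,b,c,d) ↦ (x, d₁, d₂, m) := (a, a+b, a+c, (a+b+c−d)/2) is a bijection from the set of integer solutions of the Descartes equation 2(a²+b²+c²+d²) = (a+b+c+d)² onto the set of integer solutions of x² + m² = d₁·d₂ (note a+b+c+d is always even for integer Descartes quadruples, so m ∈ ℤ). Moreover: (i) gcd(a,b,c,d) = 1 if and only if gcd(x, d₁, d₂) = 1; (ii) a quadruple (a,b,c,d) with a+b+c+d > 0 and a < 0 is a root quadruple if and only if x < 0 ≤ 2m ≤ d₁ ≤ d₂. -/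
/-- In an integer Descartes quadruple the last entry is `a + b + c - 2m`, where
`m ^ 2 = ab + bc + ca`. -/
theorem exists_descartes_half {a b c d : ℤ}
    (h : 2 * (a ^ 2 + b ^ 2 + c ^ 2 + d ^ 2) = (a + b + c + d) ^ 2) :
    ∃ m : ℤ, d = a + b + c - 2 * m ∧ m ^ 2 = a * b + b * c + c * a := by
  have h_even : (2 : ℤ) ∣ a + b + c + d :=
    Int.prime_two.dvd_of_dvd_pow (Dvd.intro _ h)
  obtain ⟨k, hk⟩ := h_even
  obtain rfl : d = 2 * k - (a + b + c) := by linarith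
  refine ⟨a + b + c - k, by ring, ?_⟩
  exact mul_left_cancel₀ four_ne_zero (by linear_combination h)

/-- If `m ^ 2 = ab + bc + ca`, adjoining `a + b + c - 2m` to `a, b, c` preserves coprimality. -/
theorem gcd_descartes_eq_one_iff {a b c m : ℤ} (hm : m ^ 2 = a * b + b * c + c * a) :
    Int.gcd (Int.gcd (Int.gcd a b) c) (a + b + c - 2 * m) = 1 ↔
      Int.gcd (Int.gcd a (a + b)) (a + c) = 1 := by
  constructor <;> intro h
  · set g : ℤ := (Int.gcd (Int.gcd a (a + b)) (a + c) : ℤ) with hg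
    have hga' : g ∣ (Int.gcd a (a + b) : ℤ) := Int.gcd_dvd_left _ _
    have hga : g ∣ a := hga'.trans (Int.gcd_dvd_left _ _)
    have hgb : g ∣ b := (dvd_add_right hga).1 (hga'.trans (Int.gcd_dvd_right _ _))
    have hgc : g ∣ c := (dvd_add_right hga).1 (Int.gcd_dvd_right _ _)
    have hgm : g ∣ m := by
      rw [← Int.pow_dvd_pow_iff two_ne_zero, hm, sq]
      exact dvd_add (dvd_add (mul_dvd_mul hga hgb) (mul_dvd_mul hgb hgc)) (mul_dvd_mul hgc hga)
    have h_one : g ∣ (Int.gcd (Int.gcd (Int.gcd a b) c) (a + b + c - 2 * m) : ℤ) :=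
      Int.dvd_coe_gcd (Int.dvd_coe_gcd (Int.dvd_coe_gcd hga hgb) hgc)
        (dvd_sub (dvd_add (dvd_add hga hgb) hgc) (hgm.mul_left 2))
    rw [h, hg] at h_one
    exact Nat.dvd_one.1 (by exact_mod_cast h_one)
  · have h_gcd : Int.gcd (Int.gcd a b) c = 1 := by
      set g : ℤ := (Int.gcd (Int.gcd a b) c : ℤ) with hg
      have hga' : g ∣ (Int.gcd a b : ℤ) := Int.gcd_dvd_left _ _
      have hga : g ∣ a := hga'.trans (Int.gcd_dvd_left _ _)
      have h_one : g ∣ (Int.gcd (Int.gcd a (a + b)) (a + c) : ℤ) :=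
        Int.dvd_coe_gcd
          (Int.dvd_coe_gcd hga (dvd_add hga (hga'.trans (Int.gcd_dvd_right _ _))))
          (dvd_add hga (Int.gcd_dvd_right _ _))
      rw [h, hg] at h_one
      exact Nat.dvd_one.1 (by exact_mod_cast h_one)
    simp [h_gcd]


/-- **Descartes quadruples correspond to solutions of `x² + m² = d₁d₂`.**
The map `(a,b,c,d) ↦ (x,d₁,d₂,m) = (a, a+b, a+c, (a+b+c-d)/2)` is a bijection
from integer Descartes quadruples onto integer solutions of `x² + m² = d₁·d₂`
(division by 2 is exact since `a+b+c+d` is even for integer Descartes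
quadruples).  Moreover (i) `gcd(a,b,c,d) = 1 ↔ gcd(x,d₁,d₂) = 1`, and
(ii) a quadruple with `a+b+c+d > 0` and `a < 0` is a root quadruple iff
`x < 0 ≤ 2m ≤ d₁ ≤ d₂`. -/
theorem descartes_to_xm_bijection :
    let f : ℤ × ℤ × ℤ × ℤ → ℤ × ℤ × ℤ × ℤ := fun p =>
      (p.1, p.1 + p.2.1, p.1 + p.2.2.1, (p.1 + p.2.1 + p.2.2.1 - p.2.2.2) / 2)
    let D : Set (ℤ × ℤ × ℤ × ℤ) :=
      {p | 2 * (p.1 ^ 2 + p.2.1 ^ 2 + p.2.2.1 ^ 2 + p.2.2.2 ^ 2) =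
        (p.1 + p.2.1 + p.2.2.1 + p.2.2.2) ^ 2}
    let T : Set (ℤ × ℤ × ℤ × ℤ) :=
      {q | q.1 ^ 2 + q.2.2.2 ^ 2 = q.2.1 * q.2.2.1}
    Set.BijOn f D T ∧
    (∀ p ∈ D,
      (Int.gcd (Int.gcd (Int.gcd p.1 p.2.1) p.2.2.1) p.2.2.2 = 1 ↔
        Int.gcd (Int.gcd (f p).1 (f p).2.1) (f p).2.2.1 = 1)) ∧
    (∀ p ∈ D, 0 < p.1 + p.2.1 + p.2.2.1 + p.2.2.2 → p.1 < 0 →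
      ((p.1 ≤ 0 ∧ 0 ≤ p.2.1 ∧ p.2.1 ≤ p.2.2.1 ∧ p.2.2.1 ≤ p.2.2.2 ∧
          p.2.2.2 ≤ p.1 + p.2.1 + p.2.2.1) ↔
        ((f p).1 < 0 ∧ 0 ≤ 2 * (f p).2.2.2 ∧ 2 * (f p).2.2.2 ≤ (f p).2.1 ∧
          (f p).2.1 ≤ (f p).2.2.1))) := by
  intro f D T
  have h_half (a b c m : ℤ) : (a + b + c - (a + b + c - 2 * m)) / 2 = m := by omega
  have h_mem {a b c d : ℤ} (h : (a, b, c, d) ∈ D) :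
      ∃ m : ℤ, d = a + b + c - 2 * m ∧ m ^ 2 = a * b + b * c + c * a :=
    exists_descartes_half h
  refine ⟨⟨?_, ?_, ?_⟩, ?_, ?_⟩
  · rintro ⟨a, b, c, d⟩ h
    obtain ⟨m, rfl, hm⟩ := h_mem h
    simp only [f, T, Set.mem_ofPred_eq, h_half]
    linear_combination hm
  · rintro ⟨a, b, c, d⟩ h ⟨a', b', c', d'⟩ h' h_eq
    obtain ⟨m, rfl, -⟩ := h_mem h
    obtain ⟨m', rfl, -⟩ := h_mem h'
    simp only [f, h_half, Prod.mk.injEq] at h_eq ⊢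
    omega
  · rintro ⟨x, d₁, d₂, m⟩ h
    simp only [T, Set.mem_ofPred_eq] at h
    refine ⟨(x, d₁ - x, d₂ - x, x + (d₁ - x) + (d₂ - x) - 2 * m), ?_, ?_⟩
    · simp only [D, Set.mem_ofPred_eq]
      linear_combination 4 * h
    · simp only [f, h_half]
      simp only [add_sub_cancel]
  · rintro ⟨a, b, c, d⟩ h
    obtain ⟨m, rfl, hm⟩ := h_mem h
    exact gcd_descartes_eq_one_iff hm
  · rintro ⟨a, b, c, d⟩ h - ha
    obtain ⟨m, rfl, -⟩ := h_mem h
    simp only [f, h_half] at ha ⊢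
    omega
end
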